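/- arXiv:1902.04305 — 6 statements merged into one kernel-verified Lean document; each statement's English description precedes it below -/
import Mathlib

section
/- For the function f(τ) = τ sin τ + 1 the following hold: (i) ∫_s^t f(τ) dτ ≤ 2(t−s) + 2s + 2 for all t ≥ s ≥ 0; (ii) for every natural number k, taking s = 2kπ and t = (2k+1)π one has ∫_s^t f(τ) dτ = 2(t−s) + 2s; (iii) consequently there are no constants K > 0 and ã > 0 such that ∫_s^t f(τ) dτ ≤ ã(t−s) + ln K for all t ≥ s ≥ 0, i.e., the scalar equation x' = (t sin t + 1)x does not have uniformly bounded growth. -/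
theorem integral_id_mul_sin_add_one (s t : ℝ) :
    ∫ τ in s..t, (τ * Real.sin τ + 1) =
      (Real.sin t - t * Real.cos t + t) - (Real.sin s - s * Real.cos s + s) := by
  refine intervalIntegral.integral_eq_sub_of_hasDerivAt
    (f := fun τ => Real.sin τ - τ * Real.cos τ + τ) (fun x _ => ?_)
    (Continuous.intervalIntegrable (by fun_prop) _ _)
  refine (((Real.hasDerivAt_sin x).sub
    ((hasDerivAt_id x).mul (Real.hasDerivAt_cos x))).add (hasDerivAt_id x)).congr_deriv ?_
  simp only [id_eq]
  ring

theorem integral_id_mul_sin_add_one_half_period (k : ℕ) :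
    ∫ τ in (2 * (k : ℝ) * Real.pi)..((2 * (k : ℝ) + 1) * Real.pi), (τ * Real.sin τ + 1) =
      2 * ((2 * (k : ℝ) + 1) * Real.pi - 2 * (k : ℝ) * Real.pi) +
        2 * (2 * (k : ℝ) * Real.pi) := by
  have hs : 2 * (k : ℝ) * Real.pi = k * (2 * Real.pi) := by ring
  have ht : (2 * (k : ℝ) + 1) * Real.pi = k * (2 * Real.pi) + Real.pi := by ring
  rw [integral_id_mul_sin_add_one, hs, ht, Real.sin_add_pi, Real.cos_add_pi,
    Real.cos_nat_mul_two_pi]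
  have h : Real.sin (k * (2 * Real.pi)) = 0 := by
    simpa using Real.sin_add_nat_mul_two_pi 0 k
  rw [h]
  ring

/-- For `f(τ) = τ sin τ + 1`: (i) `∫_s^t f ≤ 2(t-s) + 2s + 2` for all
`t ≥ s ≥ 0`; (ii) for every `k : ℕ`, with `s = 2kπ` and `t = (2k+1)π`,
`∫_s^t f = 2(t-s) + 2s`; (iii) consequently there are no constants `K > 0`, `ã > 0` with
`∫_s^t f ≤ ã(t-s) + ln K` for all `t ≥ s ≥ 0`, i.e. the scalar equation
`x' = (t sin t + 1) x` does not have uniformly bounded growth. -/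
theorem no_uniform_bounded_growth_t_sin_t_plus_one :
    (∀ s t : ℝ, 0 ≤ s → s ≤ t →
      (∫ τ in s..t, (τ * Real.sin τ + 1)) ≤ 2 * (t - s) + 2 * s + 2) ∧
    (∀ k : ℕ,
      (∫ τ in (2 * (k : ℝ) * Real.pi)..((2 * (k : ℝ) + 1) * Real.pi),
          (τ * Real.sin τ + 1)) =
        2 * ((2 * (k : ℝ) + 1) * Real.pi - 2 * (k : ℝ) * Real.pi) +
          2 * (2 * (k : ℝ) * Real.pi)) ∧
    ¬ ∃ K > (0 : ℝ), ∃ a > (0 : ℝ), ∀ s t : ℝ, 0 ≤ s → s ≤ t →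
      (∫ τ in s..t, (τ * Real.sin τ + 1)) ≤ a * (t - s) + Real.log K := by
  refine ⟨fun s t hs hst => ?_, integral_id_mul_sin_add_one_half_period, ?_⟩
  · rw [integral_id_mul_sin_add_one]
    have h₁ := mul_le_mul_of_nonneg_left (Real.neg_one_le_cos t) (hs.trans hst)
    have h₂ := mul_le_mul_of_nonneg_left (Real.cos_le_one s) hs
    linarith [Real.sin_le_one t, Real.neg_one_le_sin s]
  · rintro ⟨K, -, a, -, h⟩
    obtain ⟨k, hk⟩ := exists_nat_gt (a * Real.pi + Real.log K)
    have hle := h (2 * k * Real.pi) ((2 * k + 1) * Real.pi) (by positivity)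
      (by nlinarith [Real.pi_pos])
    rw [integral_id_mul_sin_add_one_half_period] at hle
    have hkpi : (k : ℝ) * 1 ≤ k * Real.pi :=
      mul_le_mul_of_nonneg_left (by linarith [Real.pi_gt_three]) k.cast_nonneg
    have hk0 : (0 : ℝ) ≤ k := k.cast_nonneg
    have hd : (2 * (k : ℝ) + 1) * Real.pi - 2 * k * Real.pi = Real.pi := by ring
    rw [hd] at hle
    linarith [Real.pi_pos]
end

section
/- Let f(τ) = τ sin τ + 1. For every natural number m, set H = (2m+1)π. Then for every natural number k the Steklov average satisfies f^H(2kπ) = 2 + 4kπ/H. Consequently, for each such fixed H > 0, sup_{t ≥ 0} f^H(t) = +∞, i.e., the Steklov averages of f with fixed step H are unbounded. -/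
theorem integral_mul_sin_add_one (a b : ℝ) :
    ∫ τ in a..b, (τ * Real.sin τ + 1) =
      (Real.sin b - b * Real.cos b + b) - (Real.sin a - a * Real.cos a + a) := by
  refine intervalIntegral.integral_eq_sub_of_hasDerivAt
    (f := fun τ => Real.sin τ - τ * Real.cos τ + τ) (fun x _ => ?_)
    (Continuous.intervalIntegrable (by fun_prop) a b)
  exact (((Real.hasDerivAt_sin x).sub ((hasDerivAt_id x).mul (Real.hasDerivAt_cos x))).add
    (hasDerivAt_id x)).congr_deriv (by simp)

/-- Let `f(τ) = τ sin τ + 1` and `H = (2m+1)π` for a natural number `m`.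
Then for every natural number `k` the Steklov average `f^H(t) = (1/H) ∫_t^{t+H} f` satisfies
`f^H(2kπ) = 2 + 4kπ/H`. Consequently, for each such fixed `H > 0`,
`sup_{t ≥ 0} f^H(t) = +∞`, i.e. the Steklov averages of `f` with fixed step `H` are
unbounded above. -/
theorem steklov_averages_unbounded_t_sin_t_plus_one
    (m : ℕ) (H : ℝ) (hH : H = (2 * (m : ℝ) + 1) * Real.pi) :
    (∀ k : ℕ,
      (1 / H) * ∫ τ in (2 * (k : ℝ) * Real.pi)..(2 * (k : ℝ) * Real.pi + H),
          (τ * Real.sin τ + 1) =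
        2 + 4 * (k : ℝ) * Real.pi / H) ∧
    (∀ C : ℝ, ∃ t : ℝ, 0 ≤ t ∧
      C < (1 / H) * ∫ τ in t..(t + H), (τ * Real.sin τ + 1)) := by
  have hpos : 0 < H := by rw [hH]; positivity
  have average_eq : ∀ k : ℕ,
      (1 / H) * ∫ τ in (2 * (k : ℝ) * Real.pi)..(2 * (k : ℝ) * Real.pi + H),
          (τ * Real.sin τ + 1) =
        2 + 4 * (k : ℝ) * Real.pi / H := by
    intro k
    have hb : 2 * (k : ℝ) * Real.pi + H =
        Real.pi + ((k + m : ℕ) : ℝ) * (2 * Real.pi) := by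
      rw [hH]; push_cast; ring
    have ha : 2 * (k : ℝ) * Real.pi = 0 + (k : ℝ) * (2 * Real.pi) := by ring
    have sin_b : Real.sin (2 * (k : ℝ) * Real.pi + H) = 0 := by
      rw [hb, Real.sin_add_nat_mul_two_pi, Real.sin_pi]
    have cos_b : Real.cos (2 * (k : ℝ) * Real.pi + H) = -1 := by
      rw [hb, Real.cos_add_nat_mul_two_pi, Real.cos_pi]
    have sin_a : Real.sin (2 * (k : ℝ) * Real.pi) = 0 := by
      rw [ha, Real.sin_add_nat_mul_two_pi, Real.sin_zero]
    have cos_a : Real.cos (2 * (k : ℝ) * Real.pi) = 1 := by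
      rw [ha, Real.cos_add_nat_mul_two_pi, Real.cos_zero]
    rw [integral_mul_sin_add_one, sin_b, cos_b, sin_a, cos_a]
    field_simp
    ring
  refine ⟨average_eq, fun C => ?_⟩
  obtain ⟨k, hk⟩ := exists_nat_gt (C * H / (4 * Real.pi))
  refine ⟨2 * (k : ℝ) * Real.pi, by positivity, ?_⟩
  rw [average_eq k]
  rw [div_lt_iff₀ (by positivity)] at hk
  have : C < 4 * (k : ℝ) * Real.pi / H := by
    rw [lt_div_iff₀ hpos]
    linarith
  linarith
end

section
/- (Forward direction of Lemma 4.1.) Let f₁, f₂ : [0,∞) → ℝ be continuous, each having nonuniformly bounded growth with the same constants ã ≥ 0, b̃ ≥ 0, d̃ ≥ 0. Let H > 0 and suppose there is a constant M > 2b̃ such that the Steklov averages satisfy f₂^H(t) − f₁^H(t) ≥ M for all t ≥ 0. Then for all t ≥ s ≥ 0, ∫_s^t (f₂(τ) − f₁(τ)) dτ ≥ (M − 2b̃)(t−s) − 4b̃s − 4(ãH + d̃); in particular f₁ and f₂ are weakly integrally separated with rate constant a = M − 2b̃ > 0 and bias constant b = 4b̃. -/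
open intervalIntegral in
/-- If every window of length `H` starting at a nonnegative time contributes at least `c` to the
integral of `g`, then `n` consecutive windows contribute at least `n * c`. -/
theorem nat_mul_le_integral_of_window_le {g : ℝ → ℝ} (hg : Continuous g) {H c : ℝ} (hH : 0 ≤ H)
    (hwindow : ∀ t : ℝ, 0 ≤ t → c ≤ ∫ τ in t..(t + H), g τ) {s : ℝ} (hs : 0 ≤ s) (n : ℕ) :
    n * c ≤ ∫ τ in s..(s + n * H), g τ := by
  induction n with
  | zero => simp
  | succ n ih =>
    have hstep := hwindow (s + n * H) (by positivity)
    have hend : s + ((n + 1 : ℕ) : ℝ) * H = s + n * H + H := by push_cast; ring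
    rw [hend, ← integral_add_adjacent_intervals (hg.intervalIntegrable s (s + n * H))
      (hg.intervalIntegrable _ _)]
    push_cast
    linarith


/-- forward direction of Lemma 4.1. Let `f₁, f₂` be continuous, each with
nonuniformly bounded growth with the same constants `ã ≥ 0`, `b̃ ≥ 0`, `d̃ ≥ 0`. Let `H > 0`
and suppose the Steklov averages satisfy `f₂^H(t) - f₁^H(t) ≥ M` for all `t ≥ 0`, with
`M > 2b̃`. Then for all `t ≥ s ≥ 0`,
`∫_s^t (f₂ - f₁) ≥ (M - 2b̃)(t-s) - 4b̃ s - 4(ã H + d̃)`; in particular `f₁` and `f₂` are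
weakly integrally separated with rate constant `M - 2b̃ > 0` and bias constant `4b̃`. -/
theorem steklov_separation_implies_weak_integral_separation
    (f₁ f₂ : ℝ → ℝ) (hf₁ : Continuous f₁) (hf₂ : Continuous f₂)
    (ta tb td : ℝ) (hta : 0 ≤ ta) (htb : 0 ≤ tb) (htd : 0 ≤ td)
    (hgrowth₁ : ∀ s t : ℝ, 0 ≤ s → s ≤ t →
      (∫ τ in s..t, |f₁ τ|) ≤ ta * (t - s) + tb * s + td)
    (hgrowth₂ : ∀ s t : ℝ, 0 ≤ s → s ≤ t →
      (∫ τ in s..t, |f₂ τ|) ≤ ta * (t - s) + tb * s + td)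
    (H : ℝ) (hH : 0 < H)
    (M : ℝ) (hM : 2 * tb < M)
    (hsteklov : ∀ t : ℝ, 0 ≤ t →
      M ≤ (1 / H) * (∫ τ in t..(t + H), f₂ τ) - (1 / H) * (∫ τ in t..(t + H), f₁ τ)) :
    (∀ s t : ℝ, 0 ≤ s → s ≤ t →
      (M - 2 * tb) * (t - s) - 4 * tb * s - 4 * (ta * H + td) ≤
        ∫ τ in s..t, (f₂ τ - f₁ τ)) ∧
    (0 < M - 2 * tb ∧ ∃ d : ℝ, ∀ s t : ℝ, 0 ≤ s → s ≤ t →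
      (M - 2 * tb) * (t - s) - 4 * tb * s + d ≤ ∫ τ in s..t, (f₂ τ - f₁ τ)) := by
  have hint₁ (a b : ℝ) := hf₁.intervalIntegrable (μ := MeasureTheory.volume) a b
  have hint₂ (a b : ℝ) := hf₂.intervalIntegrable (μ := MeasureTheory.volume) a b
  have hg : Continuous fun τ => f₂ τ - f₁ τ := hf₂.sub hf₁
  have hwindow (t : ℝ) (ht : 0 ≤ t) : H * M ≤ ∫ τ in t..(t + H), (f₂ τ - f₁ τ) := by
    rw [intervalIntegral.integral_sub (hint₂ _ _) (hint₁ _ _)]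
    have h := mul_le_mul_of_nonneg_left (hsteklov t ht) hH.le
    rwa [← mul_sub, ← mul_assoc, mul_one_div_cancel hH.ne', one_mul] at h
  have habs (s t : ℝ) (hs : 0 ≤ s) (hst : s ≤ t) :
      |∫ τ in s..t, (f₂ τ - f₁ τ)| ≤ 2 * (ta * (t - s) + tb * s + td) := by
    rw [intervalIntegral.integral_sub (hint₂ _ _) (hint₁ _ _)]
    have h₁ := (intervalIntegral.abs_integral_le_integral_abs (f := f₁) hst).trans
      (hgrowth₁ s t hs hst)
    have h₂ := (intervalIntegral.abs_integral_le_integral_abs (f := f₂) hst).trans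
      (hgrowth₂ s t hs hst)
    linarith [abs_sub (∫ τ in s..t, f₂ τ) (∫ τ in s..t, f₁ τ)]
  have hMH : H * M ≤ 2 * (ta * H + td) := by
    have h := (hwindow 0 le_rfl).trans ((le_abs_self _).trans (habs 0 (0 + H) le_rfl (by linarith)))
    simpa using h
  have hmain (s t : ℝ) (hs : 0 ≤ s) (hst : s ≤ t) :
      (M - 2 * tb) * (t - s) - 4 * tb * s - 4 * (ta * H + td) ≤
        ∫ τ in s..t, (f₂ τ - f₁ τ) := by
    set n := ⌊(t - s) / H⌋₊
    have hn : n * H ≤ t - s :=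
      (le_div_iff₀ hH).1 (Nat.floor_le (div_nonneg (sub_nonneg.2 hst) hH.le))
    have hn' : t - s < (n + 1) * H := (div_lt_iff₀ hH).1 (Nat.lt_floor_add_one _)
    clear_value n
    have hfull := nat_mul_le_integral_of_window_le hg hH.le hwindow hs n
    have hrest := (abs_le.1 (habs (s + n * H) t (by positivity) (by linarith))).1
    rw [← intervalIntegral.integral_add_adjacent_intervals
      (hg.intervalIntegrable s (s + n * H)) (hg.intervalIntegrable _ t)]
    obtain ⟨r, hr⟩ : ∃ r, r = t - (s + n * H) := ⟨_, rfl⟩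
    have hr₀ : 0 ≤ r := by linarith
    have hrH : r ≤ H := by linarith
    have hM₀ : 0 ≤ M := by linarith
    have hMr := mul_le_mul_of_nonneg_right hrH hM₀
    have htar := mul_le_mul_of_nonneg_left hrH hta
    have htbr := mul_nonneg htb hr₀
    have htbs := mul_nonneg htb hs
    obtain rfl : t = s + n * H + r := by linarith
    linarith
  refine ⟨hmain, by linarith, -(4 * (ta * H + td)), fun s t hs hst => ?_⟩
  linarith [hmain s t hs hst]
end

section
/- (Theorem 4.2, first part, scalar form.) Let a : [0,∞) → ℝ be continuous with nonuniformly bounded growth with constants ã ≥ 0, b̃ ≥ 0, d̃ ≥ 0, let H > 0, M > b̃, and λ ∈ ℝ. (i) If λ − a^H(t) ≥ M for all t ≥ 0 (i.e., λ exceeds the supremum β^H of the Steklov averages by at least M), then ∫_s^t (λ − a(τ)) dτ ≥ (M − b̃)(t−s) − b̃s − ((|λ| + ã)H + d̃) for all t ≥ s ≥ 0, so the pair (a, λ) is weakly integrally separated with rate constant M − b̃ > 0 and bias constant b̃. (ii) Symmetrically, if a^H(t) − λ ≥ M for all t ≥ 0, then ∫_s^t (a(τ) − λ) dτ ≥ (M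 − b̃)(t−s) − b̃s − ((|λ| + ã)H + d̃) for all t ≥ s ≥ 0, so the pair (λ, a) is weakly integrally separated with rate constant M − b̃ > 0 and bias constant b̃. -/
theorem mul_le_integral_of_le_integral_step {f : ℝ → ℝ} (hf : Continuous f) {H K : ℝ}
    (hH : 0 ≤ H) (hstep : ∀ t : ℝ, 0 ≤ t → K ≤ ∫ τ in t..(t + H), f τ)
    {s : ℝ} (hs : 0 ≤ s) (n : ℕ) : n * K ≤ ∫ τ in s..(s + n * H), f τ := by
  induction n with
  | zero => simp
  | succ n ih =>
    have h := hstep (s + n * H) (by positivity)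
    have hadd := intervalIntegral.integral_add_adjacent_intervals
      (μ := MeasureTheory.volume) (hf.intervalIntegrable s (s + n * H))
      (hf.intervalIntegrable (s + n * H) (s + n * H + H))
    have he : s + ((n + 1 : ℕ) : ℝ) * H = s + n * H + H := by push_cast; ring
    rw [he, ← hadd]
    push_cast
    linarith

/-- Cover `[s, t]` by steps of length `H`, overshooting `t` by at most `H`; the growth bound
controls the integral over the overshoot. -/
theorem le_integral_of_le_integral_step {f : ℝ → ℝ} (hf : Continuous f) {c b d : ℝ}
    (hc : 0 ≤ c)
    (hgrowth : ∀ s t : ℝ, 0 ≤ s → s ≤ t → (∫ τ in s..t, |f τ|) ≤ c * (t - s) + b * s + d)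
    {H M : ℝ} (hH : 0 < H) (hM : 0 ≤ M)
    (hstep : ∀ t : ℝ, 0 ≤ t → M * H ≤ ∫ τ in t..(t + H), f τ)
    {s t : ℝ} (hs : 0 ≤ s) (hst : s ≤ t) :
    (M - b) * (t - s) - b * s - (c * H + d) ≤ ∫ τ in s..t, f τ := by
  set n := ⌈(t - s) / H⌉₊
  have hle : t - s ≤ n * H := (div_le_iff₀ hH).1 (Nat.le_ceil _)
  have hlt : n * H ≤ t - s + H := by
    have h := (Nat.ceil_lt_add_one (div_nonneg (sub_nonneg.2 hst) hH.le)).le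
    calc n * H ≤ ((t - s) / H + 1) * H := mul_le_mul_of_nonneg_right h hH.le
      _ = t - s + H := by field_simp
  have hsteps := mul_le_integral_of_le_integral_step hf hH.le hstep hs n
  have hadd := intervalIntegral.integral_add_adjacent_intervals
    (μ := MeasureTheory.volume) (hf.intervalIntegrable s t)
    (hf.intervalIntegrable t (s + n * H))
  have htu : t ≤ s + n * H := by linarith
  have habs := (le_abs_self _).trans
    (intervalIntegral.abs_integral_le_integral_abs (f := f) (μ := MeasureTheory.volume) htu)
  have hg := hgrowth t (s + n * H) (hs.trans hst) htu
  have hcH : c * (s + n * H - t) ≤ c * H := mul_le_mul_of_nonneg_left (by linarith) hc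
  have hMn : M * (t - s) ≤ M * (n * H) := mul_le_mul_of_nonneg_left hle hM
  linarith

theorem integral_abs_sub_const_le {a : ℝ → ℝ} (ha : Continuous a) (l : ℝ) {s t : ℝ}
    (hst : s ≤ t) : (∫ τ in s..t, |a τ - l|) ≤ |l| * (t - s) + ∫ τ in s..t, |a τ| := by
  calc (∫ τ in s..t, |a τ - l|) ≤ ∫ τ in s..t, (|a τ| + |l|) :=
        intervalIntegral.integral_mono_on hst
          ((ha.sub continuous_const).abs.intervalIntegrable s t)
          ((ha.abs.add continuous_const).intervalIntegrable s t) fun τ _ => abs_sub _ _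
    _ = |l| * (t - s) + ∫ τ in s..t, |a τ| := by
        rw [intervalIntegral.integral_add (ha.abs.intervalIntegrable s t)
          (continuous_const.intervalIntegrable s t), intervalIntegral.integral_const, smul_eq_mul]
        ring

/-- Theorem 4.2, first part, scalar form. Let `a` be continuous with
nonuniformly bounded growth with constants `ã ≥ 0`, `b̃ ≥ 0`, `d̃ ≥ 0`, let `H > 0`,
`M > b̃`, and `λ ∈ ℝ`.
(i) If `λ - a^H(t) ≥ M` for all `t ≥ 0`, then
`∫_s^t (λ - a) ≥ (M - b̃)(t-s) - b̃ s - ((|λ| + ã) H + d̃)` for all `t ≥ s ≥ 0`, so the pair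
`(a, λ)` is weakly integrally separated with rate constant `M - b̃ > 0` and bias constant `b̃`.
(ii) Symmetrically, if `a^H(t) - λ ≥ M` for all `t ≥ 0`, then
`∫_s^t (a - λ) ≥ (M - b̃)(t-s) - b̃ s - ((|λ| + ã) H + d̃)` for all `t ≥ s ≥ 0`, so the pair
`(λ, a)` is weakly integrally separated with rate constant `M - b̃ > 0` and bias constant
`b̃`. -/
theorem steklov_gap_implies_weak_separation_from_lambda
    (a : ℝ → ℝ) (ha : Continuous a)
    (ta tb td : ℝ) (hta : 0 ≤ ta) (htb : 0 ≤ tb) (htd : 0 ≤ td)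
    (hgrowth : ∀ s t : ℝ, 0 ≤ s → s ≤ t →
      (∫ τ in s..t, |a τ|) ≤ ta * (t - s) + tb * s + td)
    (H : ℝ) (hH : 0 < H) (M : ℝ) (hM : tb < M) (lam : ℝ) :
    ((∀ t : ℝ, 0 ≤ t → M ≤ lam - (1 / H) * ∫ τ in t..(t + H), a τ) →
      (∀ s t : ℝ, 0 ≤ s → s ≤ t →
        (M - tb) * (t - s) - tb * s - ((|lam| + ta) * H + td) ≤
          ∫ τ in s..t, (lam - a τ)) ∧
      (0 < M - tb ∧ ∃ d : ℝ, ∀ s t : ℝ, 0 ≤ s → s ≤ t →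
        (M - tb) * (t - s) - tb * s + d ≤ ∫ τ in s..t, (lam - a τ))) ∧
    ((∀ t : ℝ, 0 ≤ t → M ≤ (1 / H) * (∫ τ in t..(t + H), a τ) - lam) →
      (∀ s t : ℝ, 0 ≤ s → s ≤ t →
        (M - tb) * (t - s) - tb * s - ((|lam| + ta) * H + td) ≤
          ∫ τ in s..t, (a τ - lam)) ∧
      (0 < M - tb ∧ ∃ d : ℝ, ∀ s t : ℝ, 0 ≤ s → s ≤ t →
        (M - tb) * (t - s) - tb * s + d ≤ ∫ τ in s..t, (a τ - lam))) := by
  have hM0 : 0 ≤ M := htb.trans hM.le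
  have hc : 0 ≤ |lam| + ta := by positivity
  have hg : ∀ s t : ℝ, 0 ≤ s → s ≤ t →
      (∫ τ in s..t, |a τ - lam|) ≤ (|lam| + ta) * (t - s) + tb * s + td := fun s t hs hst => by
    linarith [integral_abs_sub_const_le ha lam hst, hgrowth s t hs hst]
  have hsteklov : ∀ t : ℝ, (∫ τ in t..(t + H), (a τ - lam)) =
      ((1 / H) * (∫ τ in t..(t + H), a τ) - lam) * H := fun t => by
    rw [intervalIntegral.integral_sub (ha.intervalIntegrable _ _)
      (continuous_const.intervalIntegrable _ _), intervalIntegral.integral_const, smul_eq_mul]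
    field_simp
    ring
  have hsep : ∀ f : ℝ → ℝ,
      (∀ s t : ℝ, 0 ≤ s → s ≤ t →
        (M - tb) * (t - s) - tb * s - ((|lam| + ta) * H + td) ≤ ∫ τ in s..t, f τ) →
      (∀ s t : ℝ, 0 ≤ s → s ≤ t →
        (M - tb) * (t - s) - tb * s - ((|lam| + ta) * H + td) ≤ ∫ τ in s..t, f τ) ∧
      (0 < M - tb ∧ ∃ d : ℝ, ∀ s t : ℝ, 0 ≤ s → s ≤ t →
        (M - tb) * (t - s) - tb * s + d ≤ ∫ τ in s..t, f τ) :=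
    fun f h => ⟨h, sub_pos.2 hM, -((|lam| + ta) * H + td), h⟩
  refine ⟨fun h => hsep _ fun s t hs hst => ?_, fun h => hsep _ fun s t hs hst => ?_⟩
  · refine le_integral_of_le_integral_step (f := fun τ => lam - a τ)
      (continuous_const.sub ha) hc
      (fun s t hs hst => ?_) hH hM0 (fun t ht => ?_) hs hst
    · simpa only [abs_sub_comm lam] using hg s t hs hst
    · have hneg : (∫ τ in t..(t + H), (lam - a τ)) = -∫ τ in t..(t + H), (a τ - lam) := by
        simp only [← intervalIntegral.integral_neg, neg_sub]
      rw [hneg, hsteklov]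
      linarith [mul_le_mul_of_nonneg_right (h t ht) hH.le]
  · refine le_integral_of_le_integral_step (f := fun τ => a τ - lam)
      (ha.sub continuous_const) hc hg hH hM0
      (fun t ht => ?_) hs hst
    rw [hsteklov]
    exact mul_le_mul_of_nonneg_right (h t ht) hH.le
end

section
/- (Theorem 4.2, converse part, scalar form.) Let a : [0,∞) → ℝ be continuous and λ ∈ ℝ, and suppose there exist constants a₀ > 0, b₀ ≥ 0 and D ∈ ℝ such that ∫_s^t (λ − a(τ)) dτ ≥ a₀(t−s) − b₀s + D for all t ≥ s ≥ 0. Then for every t ≥ 0 and every H ≥ (2/a₀)(b₀t + |D|), the Steklov average satisfies (1/H)∫_t^{t+H} (λ − a(τ)) dτ ≥ a₀/2; in particular λ ≥ a^H(t) + a₀/2 > a^H(t). -/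
/-- Theorem 4.2, converse part, scalar form. Let `a` be continuous and
`λ ∈ ℝ`, and suppose there exist `a₀ > 0`, `b₀ ≥ 0`, `D ∈ ℝ` with
`∫_s^t (λ - a) ≥ a₀(t-s) - b₀ s + D` for all `t ≥ s ≥ 0`. Then for every `t ≥ 0` and every
`H ≥ (2/a₀)(b₀ t + |D|)` (with `H > 0`), the Steklov average satisfies
`(1/H) ∫_t^{t+H} (λ - a) ≥ a₀/2`; in particular `λ ≥ a^H(t) + a₀/2 > a^H(t)`. -/
theorem weak_separation_from_lambda_implies_steklov_gap
    (a : ℝ → ℝ) (ha : Continuous a) (lam : ℝ)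
    (a₀ b₀ D : ℝ) (ha₀ : 0 < a₀) (hb₀ : 0 ≤ b₀)
    (hsep : ∀ s t : ℝ, 0 ≤ s → s ≤ t →
      a₀ * (t - s) - b₀ * s + D ≤ ∫ τ in s..t, (lam - a τ)) :
    ∀ t : ℝ, 0 ≤ t → ∀ H : ℝ, 0 < H → (2 / a₀) * (b₀ * t + |D|) ≤ H →
      a₀ / 2 ≤ (1 / H) * (∫ τ in t..(t + H), (lam - a τ)) ∧
      (1 / H) * (∫ τ in t..(t + H), a τ) + a₀ / 2 ≤ lam ∧
      (1 / H) * (∫ τ in t..(t + H), a τ) < lam := by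
  intro t ht H hH hHlarge
  have hdiff : ∫ τ in t..(t + H), (lam - a τ) = H * lam - ∫ τ in t..(t + H), a τ := by
    rw [intervalIntegral.integral_sub intervalIntegrable_const (ha.intervalIntegrable _ _),
      intervalIntegral.integral_const, smul_eq_mul, add_sub_cancel_left]
  have hthreshold : b₀ * t + |D| ≤ a₀ / 2 * H := by
    calc b₀ * t + |D| = a₀ / 2 * (2 / a₀ * (b₀ * t + |D|)) := by field_simp
      _ ≤ a₀ / 2 * H := by gcongr
  have hgap : a₀ / 2 * H ≤ ∫ τ in t..(t + H), (lam - a τ) := by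
    have hlower := hsep t (t + H) ht (by linarith)
    rw [add_sub_cancel_left] at hlower
    linarith [neg_abs_le D]
  have hmean : a₀ / 2 ≤ 1 / H * ∫ τ in t..(t + H), (lam - a τ) := by
    rwa [one_div_mul_eq_div, le_div_iff₀ hH]
  have hsplit : 1 / H * ∫ τ in t..(t + H), (lam - a τ) =
      lam - 1 / H * ∫ τ in t..(t + H), a τ := by
    rw [hdiff]
    field_simp
  exact ⟨hmean, by linarith, by linarith⟩
end

section
/- (Theorem 3.1; Bylov–Izobov.) Consider x' = A(t)x with A : [0,∞) → n×n real matrices continuous and bounded, and assume the system has n distinct (upper) Lyapunov exponents λ₁ > λ₂ > … > λₙ. Then the Lyapunov exponents are stable under small bounded perturbations if and only if there exists a fundamental matrix whose columns are integrally separated. -/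
open Filter

/-- The (upper) characteristic exponent of the `j`-th column of a fundamental matrix. -/
noncomputable def chiExp {n : ℕ}
    (Φ : ℝ → EuclideanSpace ℝ (Fin n) →L[ℝ] EuclideanSpace ℝ (Fin n)) (j : Fin n) : ℝ :=
  limsup (fun t : ℝ => t⁻¹ * Real.log ‖Φ t (EuclideanSpace.single j 1)‖) atTop

/-- `Φ` is a fundamental matrix of `x' = A(t) x`: it solves `Φ' = A Φ` and `Φ(t)` is
invertible for every `t ≥ 0`. -/
def IsFundamentalMatrix {n : ℕ}
    (A Φ : ℝ → EuclideanSpace ℝ (Fin n) →L[ℝ] EuclideanSpace ℝ (Fin n)) : Prop :=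
  (∀ t : ℝ, 0 ≤ t → HasDerivAt Φ (A t ∘L Φ t) t) ∧
  (∀ t : ℝ, 0 ≤ t → ∃ Ψ : EuclideanSpace ℝ (Fin n) →L[ℝ] EuclideanSpace ℝ (Fin n),
    Φ t ∘L Ψ = 1 ∧ Ψ ∘L Φ t = 1)

/-- A fundamental matrix is normal if it minimizes the sum of the characteristic exponents
of its columns among all fundamental matrices. -/
def IsNormalFundamentalMatrix {n : ℕ}
    (A Φ : ℝ → EuclideanSpace ℝ (Fin n) →L[ℝ] EuclideanSpace ℝ (Fin n)) : Prop :=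
  IsFundamentalMatrix A Φ ∧
  ∀ Ψ : ℝ → EuclideanSpace ℝ (Fin n) →L[ℝ] EuclideanSpace ℝ (Fin n),
    IsFundamentalMatrix A Ψ → ∑ j, chiExp Φ j ≤ ∑ j, chiExp Ψ j

/-- `lam` is the decreasingly ordered tuple of (upper) Lyapunov exponents of `x' = A(t) x`:
the column exponents of some normal fundamental matrix, arranged in decreasing order. -/
def HasLyapunovExponents {n : ℕ}
    (A : ℝ → EuclideanSpace ℝ (Fin n) →L[ℝ] EuclideanSpace ℝ (Fin n))
    (lam : Fin n → ℝ) : Prop :=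
  Antitone lam ∧
  ∃ Φ : ℝ → EuclideanSpace ℝ (Fin n) →L[ℝ] EuclideanSpace ℝ (Fin n),
    IsNormalFundamentalMatrix A Φ ∧
    ∃ σ : Equiv.Perm (Fin n), ∀ j : Fin n, lam j = chiExp Φ (σ j)

open Topology

/-- Vectors of the phase space. -/
abbrev EVec (n : ℕ) := EuclideanSpace ℝ (Fin n)

/-- Operators of the phase space. -/
abbrev EOp (n : ℕ) := EVec n →L[ℝ] EVec n

section Growth

variable {n : ℕ} {A Φ : ℝ → EOp n} {C : ℝ}

theorem norm_solution_le {y : ℝ → EVec n} (hC : ∀ t, 0 ≤ t → ‖A t‖ ≤ C)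
    (hy : ∀ t, 0 ≤ t → HasDerivAt y (A t (y t)) t) {s t : ℝ} (hs : 0 ≤ s) (hst : s ≤ t) :
    ‖y t‖ ≤ Real.exp (C * (t - s)) * ‖y s‖ := by
  have h := norm_le_gronwallBound_of_norm_deriv_right_le (f := y) (f' := fun τ => A τ (y τ))
    (δ := ‖y s‖) (K := C) (ε := 0) (a := s) (b := t)
    (fun τ hτ => (hy τ (hs.trans hτ.1)).continuousAt.continuousWithinAt)
    (fun τ hτ => (hy τ (hs.trans hτ.1)).hasDerivWithinAt) le_rfl
    (fun τ hτ => by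
      rw [add_zero]
      exact (A τ).le_of_opNorm_le (hC τ (hs.trans hτ.1)) _) t ⟨hst, le_rfl⟩
  rwa [gronwallBound_ε0, mul_comm] at h

theorem norm_solution_ge {y : ℝ → EVec n} (hC : ∀ t, 0 ≤ t → ‖A t‖ ≤ C)
    (hy : ∀ t, 0 ≤ t → HasDerivAt y (A t (y t)) t) {s t : ℝ} (hs : 0 ≤ s) (hst : s ≤ t) :
    ‖y s‖ ≤ Real.exp (C * (t - s)) * ‖y t‖ := by
  have key : ∀ τ ∈ Set.Icc s t, HasDerivAt (fun r => y (s + t - r))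
      (-(A (s + t - τ) (y (s + t - τ)))) τ := fun τ hτ => by
    have h1 : HasDerivAt (fun r : ℝ => s + t - r) (-1) τ := by
      simpa using (hasDerivAt_id τ).const_sub (s + t)
    have h2 := hy (s + t - τ) (by linarith [hτ.2])
    have h3 := h2.scomp τ h1
    simpa [Function.comp_def] using h3
  have h := norm_le_gronwallBound_of_norm_deriv_right_le (f := fun r => y (s + t - r))
    (f' := fun τ => -(A (s + t - τ) (y (s + t - τ))))
    (δ := ‖y t‖) (K := C) (ε := 0) (a := s) (b := t)
    (fun τ hτ => (key τ hτ).continuousAt.continuousWithinAt)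
    (fun τ hτ => (key τ ⟨hτ.1, hτ.2.le⟩).hasDerivWithinAt) (by simp)
    (fun τ hτ => by
      rw [add_zero, norm_neg]
      exact (A _).le_of_opNorm_le (hC _ (by linarith [hτ.2])) _) t ⟨hst, le_rfl⟩
  rw [gronwallBound_ε0, mul_comm] at h
  simpa using h

theorem IsFundamentalMatrix.hasDerivAt_apply (hΦ : IsFundamentalMatrix A Φ) (x : EVec n) {t : ℝ}
    (ht : 0 ≤ t) : HasDerivAt (fun τ => Φ τ x) (A t (Φ t x)) t := by
  simpa using (hΦ.1 t ht).clm_apply (hasDerivAt_const t x)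

theorem IsFundamentalMatrix.apply_eq_zero_iff (hΦ : IsFundamentalMatrix A Φ) {x : EVec n} {t : ℝ}
    (ht : 0 ≤ t) : Φ t x = 0 ↔ x = 0 := by
  refine ⟨fun h => ?_, fun h => by simp [h]⟩
  obtain ⟨Ψ, -, h2⟩ := hΦ.2 t ht
  have := DFunLike.congr_fun h2 x
  simpa [h] using this.symm

theorem IsFundamentalMatrix.norm_pos (hΦ : IsFundamentalMatrix A Φ) {x : EVec n} (hx : x ≠ 0)
    {t : ℝ} (ht : 0 ≤ t) : 0 < ‖Φ t x‖ :=
  norm_pos_iff.2 fun h => hx ((hΦ.apply_eq_zero_iff ht).1 h)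

theorem IsFundamentalMatrix.exists_apply_eq (hΦ : IsFundamentalMatrix A Φ) (y : EVec n) {t : ℝ}
    (ht : 0 ≤ t) : ∃ x, Φ t x = y := by
  obtain ⟨Ψ, h1, -⟩ := hΦ.2 t ht
  exact ⟨Ψ y, DFunLike.congr_fun h1 y⟩

theorem IsFundamentalMatrix.norm_apply_le (hΦ : IsFundamentalMatrix A Φ)
    (hC : ∀ t, 0 ≤ t → ‖A t‖ ≤ C) (x : EVec n) {s t : ℝ} (hs : 0 ≤ s) (hst : s ≤ t) :
    ‖Φ t x‖ ≤ Real.exp (C * (t - s)) * ‖Φ s x‖ :=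
  norm_solution_le hC (fun _ h => hΦ.hasDerivAt_apply x h) hs hst

theorem IsFundamentalMatrix.norm_apply_ge (hΦ : IsFundamentalMatrix A Φ)
    (hC : ∀ t, 0 ≤ t → ‖A t‖ ≤ C) (x : EVec n) {s t : ℝ} (hs : 0 ≤ s) (hst : s ≤ t) :
    ‖Φ s x‖ ≤ Real.exp (C * (t - s)) * ‖Φ t x‖ :=
  norm_solution_ge hC (fun _ h => hΦ.hasDerivAt_apply x h) hs hst

/-- The upper characteristic exponent of the solution `Φ(t) x`. -/
noncomputable def solutionExponent (Φ : ℝ → EOp n) (x : EVec n) : ℝ :=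
  limsup (fun t : ℝ => t⁻¹ * Real.log ‖Φ t x‖) atTop

/-- Initial vectors whose solutions have upper characteristic exponent at most `c`. -/
def growthSubmodule (Φ : ℝ → EOp n) (c : ℝ) : Submodule ℝ (EVec n) where
  carrier := {x | ∀ c' > c, (fun t => Φ t x) =O[atTop] fun t => Real.exp (c' * t)}
  add_mem' {x y} hx hy c' hc' := by simpa using (hx c' hc').add (hy c' hc')
  zero_mem' c' _ := by simpa using Asymptotics.isBigO_zero _ _
  smul_mem' r x hx c' hc' := by
    have := (hx c' hc').const_smul_left r
    simp only [map_smul]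
    exact this

theorem exp_mul_isBigO {a b : ℝ} (h : a ≤ b) :
    (fun t : ℝ => Real.exp (a * t)) =O[atTop] fun t => Real.exp (b * t) := by
  refine Asymptotics.IsBigO.of_bound 1 ?_
  filter_upwards [eventually_ge_atTop 0] with t ht
  rw [one_mul, Real.norm_eq_abs, Real.norm_eq_abs, Real.abs_exp, Real.abs_exp]
  gcongr

theorem growthSubmodule_mono {c d : ℝ} (h : c ≤ d) :
    growthSubmodule Φ c ≤ growthSubmodule Φ d :=
  fun _ hx _ hd => hx _ (h.trans_lt hd)

/-- A constant factor is absorbed by an exponential. -/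
theorem eventually_mul_exp_lt (K : ℝ) {a b : ℝ} (h : a < b) :
    ∀ᶠ t : ℝ in atTop, K * Real.exp (a * t) < Real.exp (b * t) := by
  have h1 : Tendsto (fun t : ℝ => Real.exp ((b - a) * t)) atTop atTop :=
    Real.tendsto_exp_atTop.comp (tendsto_id.const_mul_atTop (sub_pos.2 h))
  filter_upwards [h1.eventually_gt_atTop K] with t ht
  calc K * Real.exp (a * t) < Real.exp ((b - a) * t) * Real.exp (a * t) := by gcongr
    _ = _ := by rw [← Real.exp_add]; ring_nf

theorem mem_growthSubmodule_iff_eventually {c : ℝ} {x : EVec n} : x ∈ growthSubmodule Φ c ↔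
    ∀ c' > c, ∀ᶠ t in atTop, ‖Φ t x‖ < Real.exp (c' * t) := by
  refine ⟨fun h c' hc' => ?_, fun h c' hc' => ?_⟩
  · obtain ⟨d, hd, hd'⟩ := exists_between hc'
    obtain ⟨K, hK⟩ := (h d hd).bound
    filter_upwards [hK, eventually_mul_exp_lt K hd'] with t h1 h2
    rw [Real.norm_eq_abs, Real.abs_exp] at h1
    exact h1.trans_lt h2
  · refine Asymptotics.IsBigO.of_bound 1 ?_
    filter_upwards [h c' hc'] with t ht
    rw [one_mul, Real.norm_eq_abs, Real.abs_exp]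
    exact ht.le

theorem IsFundamentalMatrix.isBigO_exp (hΦ : IsFundamentalMatrix A Φ)
    (hC : ∀ t, 0 ≤ t → ‖A t‖ ≤ C) (x : EVec n) : x ∈ growthSubmodule Φ C := by
  intro c' hc'
  refine Asymptotics.IsBigO.trans ?_ (exp_mul_isBigO hc'.le)
  refine Asymptotics.IsBigO.of_bound ‖Φ 0 x‖ ?_
  filter_upwards [eventually_ge_atTop 0] with t ht
  have := hΦ.norm_apply_le hC x le_rfl ht
  rw [Real.norm_eq_abs, Real.abs_exp]
  rw [sub_zero] at this
  linarith

theorem log_bound_iff {t c r : ℝ} (ht : 0 < t) (hr : 0 < r) :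
    t⁻¹ * Real.log r < c ↔ r < Real.exp (c * t) := by
  rw [← Real.log_lt_iff_lt_exp hr, inv_mul_lt_iff₀ ht, mul_comm]

theorem IsFundamentalMatrix.mem_growthSubmodule_iff (hΦ : IsFundamentalMatrix A Φ)
    (hC : ∀ t, 0 ≤ t → ‖A t‖ ≤ C) {x : EVec n} (hx : x ≠ 0) {c : ℝ} :
    x ∈ growthSubmodule Φ c ↔ solutionExponent Φ x ≤ c := by
  have hev : ∀ c' : ℝ, (∀ᶠ t in atTop, ‖Φ t x‖ < Real.exp (c' * t)) ↔
      ∀ᶠ t : ℝ in atTop, t⁻¹ * Real.log ‖Φ t x‖ < c' := fun c' => by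
    apply eventually_congr
    filter_upwards [eventually_gt_atTop 0] with t ht
    exact (log_bound_iff ht (hΦ.norm_pos hx ht.le)).symm
  have hbdd : IsBoundedUnder (· ≤ ·) atTop fun t : ℝ => t⁻¹ * Real.log ‖Φ t x‖ := by
    refine isBoundedUnder_of_eventually_le (a := C + 1) ?_
    have := mem_growthSubmodule_iff_eventually.1 (hΦ.isBigO_exp hC x) (C + 1) (by linarith)
    filter_upwards [(hev _).1 this] with t ht using ht.le
  have hcob : IsCoboundedUnder (· ≤ ·) atTop fun t : ℝ => t⁻¹ * Real.log ‖Φ t x‖ := by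
    have : IsBoundedUnder (· ≥ ·) atTop fun t : ℝ => t⁻¹ * Real.log ‖Φ t x‖ := by
      refine isBoundedUnder_of_eventually_ge (a := -C - 1) ?_
      filter_upwards [eventually_mul_exp_lt (‖Φ 0 x‖⁻¹) (show -1 < (0 : ℝ) by norm_num),
        eventually_gt_atTop 0] with t h1 ht
      have h0 := hΦ.norm_pos hx le_rfl
      have h2 := hΦ.norm_apply_ge hC x le_rfl ht.le
      rw [← not_lt, log_bound_iff ht (hΦ.norm_pos hx ht.le), not_lt]
      rw [zero_mul, Real.exp_zero, inv_mul_lt_iff₀ h0, mul_one] at h1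
      calc Real.exp ((-C - 1) * t) = Real.exp (-(C * t)) * Real.exp (-1 * t) := by
            rw [← Real.exp_add]; ring_nf
        _ ≤ Real.exp (-(C * t)) * (Real.exp (C * (t - 0)) * ‖Φ t x‖) := by
            gcongr; exact h1.le.trans h2
        _ = ‖Φ t x‖ := by rw [← mul_assoc, ← Real.exp_add]; simp
    exact this.isCoboundedUnder_le
  rw [mem_growthSubmodule_iff_eventually, solutionExponent, limsup_le_iff hcob hbdd]
  exact forall₂_congr fun c' _ => hev c'

end Growth

section Exponents

variable {n : ℕ} {A Φ Ψ : ℝ → EOp n} {C : ℝ}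

theorem IsFundamentalMatrix.comp_const (hΦ : IsFundamentalMatrix A Φ) {M N : EOp n}
    (hMN : M ∘L N = 1) (hNM : N ∘L M = 1) : IsFundamentalMatrix A fun t => Φ t ∘L M := by
  refine ⟨fun t ht => ?_, fun t ht => ?_⟩
  · have := (hΦ.1 t ht).clm_comp (hasDerivAt_const t M)
    simpa [ContinuousLinearMap.comp_assoc] using this
  · obtain ⟨Ψ, h1, h2⟩ := hΦ.2 t ht
    refine ⟨N ∘L Ψ, ?_, ?_⟩
    · ext1 x
      have e1 := DFunLike.congr_fun hMN (Ψ x)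
      have e2 := DFunLike.congr_fun h1 x
      simp at e1 e2 ⊢
      rw [e1, e2]
    · ext1 x
      have e1 := DFunLike.congr_fun h2 (M x)
      have e2 := DFunLike.congr_fun hNM x
      simp at e1 e2 ⊢
      rw [e1, e2]

/-- Two fundamental matrices of the same bounded system differ by a constant factor. -/
theorem IsFundamentalMatrix.exists_eq_comp (hΦ : IsFundamentalMatrix A Φ)
    (hΨ : IsFundamentalMatrix A Ψ) (hC : ∀ t, 0 ≤ t → ‖A t‖ ≤ C) :
    ∃ M : EOp n, Function.Injective M ∧ ∀ t, 0 ≤ t → ∀ x, Ψ t x = Φ t (M x) := by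
  obtain ⟨Θ, h1, h2⟩ := hΦ.2 0 le_rfl
  refine ⟨Θ ∘L Ψ 0, ?_, fun t ht x => ?_⟩
  · rw [injective_iff_map_eq_zero]
    intro x hx
    have e := DFunLike.congr_fun h1 (Ψ 0 x)
    simp at e hx
    rw [hx, map_zero] at e
    exact (hΨ.apply_eq_zero_iff le_rfl).1 e.symm
  · have hd : ∀ t, 0 ≤ t → HasDerivAt (fun τ => Ψ τ x - Φ τ (Θ (Ψ 0 x)))
        (A t (Ψ t x - Φ t (Θ (Ψ 0 x)))) t := fun t ht => by
      rw [map_sub]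
      exact (hΨ.hasDerivAt_apply x ht).sub (hΦ.hasDerivAt_apply _ ht)
    have h := norm_solution_le hC hd le_rfl ht
    have e := DFunLike.congr_fun h1 (Ψ 0 x)
    simp at e
    simp [e] at h
    simpa using sub_eq_zero.1 h

/-- The number of column exponents not exceeding `c` is at most the dimension of the space of
solutions with exponent at most `c`. -/
theorem IsFundamentalMatrix.card_le_finrank (hΦ : IsFundamentalMatrix A Φ)
    (hC : ∀ t, 0 ≤ t → ‖A t‖ ≤ C) (c : ℝ) :
    (Finset.univ.filter fun j => chiExp Φ j ≤ c).card ≤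
      Module.finrank ℝ (growthSubmodule Φ c) := by
  classical
  let f : {j // chiExp Φ j ≤ c} → growthSubmodule Φ c := fun j =>
    ⟨EuclideanSpace.single j.1 1, (hΦ.mem_growthSubmodule_iff hC (by simp)).2 j.2⟩
  have hli : LinearIndependent ℝ f := by
    have h1 : LinearIndependent ℝ (fun j : Fin n =>
        (EuclideanSpace.single j (1 : ℝ) : EVec n)) := by
      have := (EuclideanSpace.basisFun (Fin n) ℝ).orthonormal.linearIndependent
      rwa [show ⇑(EuclideanSpace.basisFun (Fin n) ℝ) = fun j => EuclideanSpace.single j (1 : ℝ)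
        from funext fun j => by simp] at this
    have h2 := h1.comp (fun j : {j // chiExp Φ j ≤ c} => j.1) Subtype.val_injective
    exact LinearIndependent.of_comp (growthSubmodule Φ c).subtype h2
  have := hli.fintype_card_le_finrank
  rwa [Fintype.card_subtype] at this

theorem exists_coord_ne_zero_of_card_lt (J : Finset (Fin n)) (W : Submodule ℝ (EVec n))
    (h : J.card < Module.finrank ℝ W) : ∃ x ∈ W, ∃ j ∉ J, x j ≠ 0 := by
  by_contra! hcon
  let g : W →ₗ[ℝ] (J → ℝ) :=
    { toFun := fun x j => x.1 j
      map_add' := fun x y => by ext; simp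
      map_smul' := fun r x => by ext; simp }
  have hg : Function.Injective g := by
    rw [injective_iff_map_eq_zero]
    intro x hx
    ext j
    by_cases hj : j ∈ J
    · exact congr_fun hx ⟨j, hj⟩
    · exact hcon x.1 x.2 j hj
  have := LinearMap.finrank_le_finrank_of_injective hg
  simp at this
  omega

/-- For a normal fundamental matrix the space of solutions with exponent at most `c` has as
dimension the number of columns with exponent at most `c`. -/
theorem IsNormalFundamentalMatrix.finrank_eq_card (hΦ : IsNormalFundamentalMatrix A Φ)
    (hC : ∀ t, 0 ≤ t → ‖A t‖ ≤ C) (c : ℝ) :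
    Module.finrank ℝ (growthSubmodule Φ c) =
      (Finset.univ.filter fun j => chiExp Φ j ≤ c).card := by
  classical
  refine le_antisymm (not_lt.1 fun hlt => ?_) (hΦ.1.card_le_finrank hC c)
  obtain ⟨x, hx, k, hk, hxk⟩ := exists_coord_ne_zero_of_card_lt _ _ hlt
  simp only [Finset.mem_filter, Finset.mem_univ, true_and, not_le] at hk
  set e : EVec n := EuclideanSpace.single k 1 with he
  let M : EOp n := 1 + (EuclideanSpace.proj k : EVec n →L[ℝ] ℝ).smulRight (x - e)
  let N : EOp n := 1 - (EuclideanSpace.proj k : EVec n →L[ℝ] ℝ).smulRight ((x k)⁻¹ • (x - e))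
  have hMN : M ∘L N = 1 := by
    ext v i
    simp [M, N, he]
    field_simp
    ring
  have hNM : N ∘L M = 1 := by
    ext v i
    simp [M, N, he]
    field_simp
    ring
  have hΨ := hΦ.1.comp_const hMN hNM
  have hle := hΦ.2 _ hΨ
  have hMk : M e = x := by
    ext i
    simp [M, he]
  have hMj : ∀ j, j ≠ k → M (EuclideanSpace.single j 1) = EuclideanSpace.single j 1 := by
    intro j hj
    ext i
    simp [M, hj.symm]
  have hx0 : x ≠ 0 := fun h => hxk (by simp [h])
  have hlt' : ∑ j, chiExp (fun t => Φ t ∘L M) j < ∑ j, chiExp Φ j := by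
    refine Finset.sum_lt_sum (fun j _ => ?_) ⟨k, Finset.mem_univ _, ?_⟩
    · by_cases hj : j = k
      · subst hj
        refine le_trans ?_ hk.le
        simp only [chiExp, ContinuousLinearMap.comp_apply]
        rw [← he, hMk]
        exact (hΦ.1.mem_growthSubmodule_iff hC hx0).1 hx
      · simp only [chiExp, ContinuousLinearMap.comp_apply, hMj j hj, le_refl]
    · refine lt_of_le_of_lt ?_ hk
      simp only [chiExp, ContinuousLinearMap.comp_apply]
      rw [← he, hMk]
      exact (hΦ.1.mem_growthSubmodule_iff hC hx0).1 hx
  exact absurd hle (not_le.2 hlt')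

theorem HasLyapunovExponents.exists_fundamentalMatrix {μ : Fin n → ℝ}
    (hμ : HasLyapunovExponents A μ) (hC : ∀ t, 0 ≤ t → ‖A t‖ ≤ C) :
    ∃ Φ, IsFundamentalMatrix A Φ ∧ ∀ c, Module.finrank ℝ (growthSubmodule Φ c) =
      (Finset.univ.filter fun j => μ j ≤ c).card := by
  obtain ⟨-, Φ, hΦ, σ, hσ⟩ := hμ
  refine ⟨Φ, hΦ.1, fun c => ?_⟩
  rw [hΦ.finrank_eq_card hC c]
  refine (Finset.card_equiv σ fun j => ?_).symm
  simp [hσ]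

theorem growthSubmodule_finrank_eq (hΦ : IsFundamentalMatrix A Φ)
    (hΨ : IsFundamentalMatrix A Ψ) (hC : ∀ t, 0 ≤ t → ‖A t‖ ≤ C) (c : ℝ) :
    Module.finrank ℝ (growthSubmodule Φ c) = Module.finrank ℝ (growthSubmodule Ψ c) := by
  have key : ∀ {Φ Ψ : ℝ → EOp n}, IsFundamentalMatrix A Φ → IsFundamentalMatrix A Ψ →
      Module.finrank ℝ (growthSubmodule Ψ c) ≤ Module.finrank ℝ (growthSubmodule Φ c) := by
    intro Φ Ψ hΦ hΨ
    obtain ⟨M, hM, hMΨ⟩ := hΦ.exists_eq_comp hΨ hC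
    have hmem : ∀ x ∈ growthSubmodule Ψ c, M x ∈ growthSubmodule Φ c := fun x hx c' hc' => by
      refine (hx c' hc').congr' ?_ EventuallyEq.rfl
      filter_upwards [eventually_ge_atTop 0] with t ht using hMΨ t ht x
    exact LinearMap.finrank_le_finrank_of_injective
      (f := (M : EVec n →ₗ[ℝ] EVec n).restrict hmem)
      (fun x y hxy => Subtype.ext (hM (congrArg Subtype.val hxy)))
  exact le_antisymm (key hΨ hΦ) (key hΦ hΨ)

theorem HasLyapunovExponents.finrank_growthSubmodule {μ : Fin n → ℝ}
    (hμ : HasLyapunovExponents A μ) (hC : ∀ t, 0 ≤ t → ‖A t‖ ≤ C)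
    (hΦ : IsFundamentalMatrix A Φ) (c : ℝ) : Module.finrank ℝ (growthSubmodule Φ c) =
      (Finset.univ.filter fun j => μ j ≤ c).card := by
  obtain ⟨Ψ, hΨ, h⟩ := hμ.exists_fundamentalMatrix hC
  rw [growthSubmodule_finrank_eq hΦ hΨ hC, h]

theorem antitone_le_of_lt_card {μ : Fin n → ℝ} (hμ : Antitone μ) {c : ℝ} (k : Fin n)
    (h : (k : ℕ) < (Finset.univ.filter fun j => μ j ≤ c).card) : μ (Fin.rev k) ≤ c := by
  by_contra! hlt
  have hsub : (Finset.univ.filter fun j => μ j ≤ c) ⊆ Finset.Ioi (Fin.rev k) := by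
    intro j hj
    simp only [Finset.mem_filter, Finset.mem_univ, true_and] at hj
    rw [Finset.mem_Ioi]
    by_contra! hjk
    exact absurd (hμ hjk) (not_le.2 (hj.trans_lt hlt))
  have := Finset.card_le_card hsub
  rw [Fin.card_Ioi, Fin.val_rev] at this
  omega

theorem antitone_gt_of_card_le {μ : Fin n → ℝ} (hμ : Antitone μ) {c : ℝ} (k : Fin n)
    (h : (Finset.univ.filter fun j => μ j ≤ c).card ≤ k) : c < μ (Fin.rev k) := by
  by_contra! hle
  have hsub : Finset.Ici (Fin.rev k) ⊆ (Finset.univ.filter fun j => μ j ≤ c) := by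
    intro j hj
    simp only [Finset.mem_filter, Finset.mem_univ, true_and]
    exact (hμ (Finset.mem_Ici.1 hj)).trans hle
  have := Finset.card_le_card hsub
  rw [Fin.card_Ici, Fin.val_rev] at this
  omega

theorem IsFundamentalMatrix.finite_exponents (hΦ : IsFundamentalMatrix A Φ)
    (hC : ∀ t, 0 ≤ t → ‖A t‖ ≤ C) : (solutionExponent Φ '' {0}ᶜ).Finite := by
  have hmono : ∀ a ∈ solutionExponent Φ '' {0}ᶜ, ∀ b ∈ solutionExponent Φ '' {0}ᶜ, a < b →
      Module.finrank ℝ (growthSubmodule Φ a) < Module.finrank ℝ (growthSubmodule Φ b) := by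
    rintro a - b ⟨x, hx, rfl⟩ hab
    refine Submodule.finrank_lt_finrank_of_lt (lt_of_le_of_ne (growthSubmodule_mono hab.le) ?_)
    intro heq
    have h1 := (hΦ.mem_growthSubmodule_iff hC hx).2 le_rfl
    rw [← heq] at h1
    exact absurd ((hΦ.mem_growthSubmodule_iff hC hx).1 h1) (not_le.2 hab)
  refine Set.Finite.of_finite_image (f := fun c => Module.finrank ℝ (growthSubmodule Φ c))
    ((Set.finite_Iic n).subset ?_) ?_
  · rintro _ ⟨c, -, rfl⟩
    simpa using (growthSubmodule Φ c).finrank_le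
  · intro a ha b hb hab
    rcases lt_trichotomy a b with h | h | h
    · exact absurd hab (hmono a ha b hb h).ne
    · exact h
    · exact absurd hab.symm (hmono b hb a ha h).ne

/-- A bounded system possessing a fundamental matrix possesses a normal one. -/
theorem IsFundamentalMatrix.exists_hasLyapunovExponents (hΦ : IsFundamentalMatrix A Φ)
    (hC : ∀ t, 0 ≤ t → ‖A t‖ ≤ C) : ∃ μ, HasLyapunovExponents A μ := by
  have hfin : {r | ∃ Ψ, IsFundamentalMatrix A Ψ ∧ ∑ j, chiExp Ψ j = r}.Finite := by
    have h1 : (Set.pi Set.univ fun _ : Fin n => solutionExponent Φ '' {0}ᶜ).Finite :=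
      Set.Finite.pi fun _ => hΦ.finite_exponents hC
    refine (h1.image fun f => ∑ j, f j).subset ?_
    rintro _ ⟨Ψ, hΨ, rfl⟩
    refine ⟨chiExp Ψ, fun j _ => ?_, rfl⟩
    obtain ⟨M, hM, hMΨ⟩ := hΦ.exists_eq_comp hΨ hC
    refine ⟨M (EuclideanSpace.single j 1), ?_, ?_⟩
    · simp [map_eq_zero_iff M hM]
    · refine limsup_congr ?_
      filter_upwards [eventually_ge_atTop 0] with t ht
      rw [hMΨ t ht]
  obtain ⟨r, ⟨Ψ, hΨ, rfl⟩, hr⟩ := Set.exists_min_image _ id hfin ⟨_, Φ, hΦ, rfl⟩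
  refine ⟨fun j => chiExp Ψ (Tuple.sort (fun j => -chiExp Ψ j) j), fun i j hij => ?_, Ψ,
    ⟨hΨ, fun Θ hΘ => hr _ ⟨Θ, hΘ, rfl⟩⟩, _, fun j => rfl⟩
  simpa using Tuple.monotone_sort (fun j => -chiExp Ψ j) hij

end Exponents

section Sufficiency

variable {n : ℕ} {A A' Φ Y : ℝ → EOp n} {C a D : ℝ}

/-- The columns of `Φ` are integrally separated with constants `a` and `D`. -/
def IntegrallySeparated (Φ : ℝ → EOp n) (a D : ℝ) : Prop :=
  ∀ i : Fin n, ∀ hi : (i : ℕ) + 1 < n, ∀ s t : ℝ, 0 ≤ s → s ≤ t →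
    D * Real.exp (a * (t - s)) ≤
      (‖Φ t (EuclideanSpace.single (⟨(i : ℕ) + 1, hi⟩ : Fin n) 1)‖ /
        ‖Φ s (EuclideanSpace.single (⟨(i : ℕ) + 1, hi⟩ : Fin n) 1)‖) *
      (‖Φ s (EuclideanSpace.single i 1)‖ / ‖Φ t (EuclideanSpace.single i 1)‖)

/-- The growth factor of the `i`-th column between two times. -/
noncomputable def columnRatio (Φ : ℝ → EOp n) (s t : ℝ) (i : Fin n) : ℝ :=
  ‖Φ t (EuclideanSpace.single i 1)‖ / ‖Φ s (EuclideanSpace.single i 1)‖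

theorem IsFundamentalMatrix.norm_column_pos (hΦ : IsFundamentalMatrix A Φ) (i : Fin n) {t : ℝ}
    (ht : 0 ≤ t) : 0 < ‖Φ t (EuclideanSpace.single i 1)‖ :=
  hΦ.norm_pos (by simp) ht

theorem IsFundamentalMatrix.exp_le_columnRatio (hΦ : IsFundamentalMatrix A Φ)
    (hC : ∀ t, 0 ≤ t → ‖A t‖ ≤ C) (i : Fin n) {s t : ℝ} (hs : 0 ≤ s) (hst : s ≤ t) :
    Real.exp (-(C * (t - s))) ≤ columnRatio Φ s t i := by
  rw [columnRatio, le_div_iff₀ (hΦ.norm_column_pos i hs), Real.exp_neg,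
    inv_mul_le_iff₀ (Real.exp_pos _)]
  exact hΦ.norm_apply_ge hC _ hs hst

theorem IntegrallySeparated.columnRatio_le (h : IntegrallySeparated Φ a D)
    (hΦ : IsFundamentalMatrix A Φ) {R s t : ℝ} (hR : 1 ≤ R) (hs : 0 ≤ s) (hst : s ≤ t)
    (hRD : R ≤ D * Real.exp (a * (t - s))) {i j : Fin n} (hij : i < j) :
    R * columnRatio Φ s t i ≤ columnRatio Φ s t j := by
  have ht := hs.trans hst
  have hstep : ∀ (i : Fin n) (hi : (i : ℕ) + 1 < n),
      R * columnRatio Φ s t i ≤ columnRatio Φ s t ⟨i + 1, hi⟩ := by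
    intro i hi
    have h1 := hRD.trans (h i hi s t hs hst)
    have p1 := hΦ.norm_column_pos i hs
    have p2 := hΦ.norm_column_pos i ht
    have p3 := hΦ.norm_column_pos ⟨i + 1, hi⟩ hs
    have p4 := hΦ.norm_column_pos ⟨i + 1, hi⟩ ht
    unfold columnRatio
    refine (mul_le_mul_of_nonneg_right h1 (div_pos p2 p1).le).trans_eq ?_
    field_simp
  have hpos : ∀ i, 0 ≤ columnRatio Φ s t i := fun i => by unfold columnRatio; positivity
  obtain ⟨j, hj⟩ := j
  induction j with
  | zero => exact absurd (Fin.lt_def.1 hij) (Nat.not_lt_zero _)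
  | succ j ih =>
    rcases (Nat.lt_succ_iff.1 (Fin.lt_def.1 hij)).lt_or_eq with hlt | heq
    · have h1 := ih (by omega) (Fin.lt_def.2 hlt)
      refine h1.trans ?_
      have h2 := hstep ⟨j, by omega⟩ hj
      exact le_trans (le_mul_of_one_le_left (hpos _) hR) h2
    · have h2 := hstep i (by omega)
      convert h2 using 2
      exact Fin.ext (by simp [heq])

theorem norm_apply_le_sum (L : EOp n) (x : EVec n) :
    ‖L x‖ ≤ ∑ i, |x i| * ‖L (EuclideanSpace.single i 1)‖ := by
  have hx : x = ∑ i, x i • (EuclideanSpace.single i (1 : ℝ) : EVec n) := by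
    ext j
    simp [Finset.sum_apply, Pi.single_apply]
  conv_lhs => rw [hx, map_sum]
  refine (norm_sum_le _ _).trans (Finset.sum_le_sum fun i _ => ?_)
  rw [map_smul, norm_smul, Real.norm_eq_abs]

theorem exists_le_mul_exp (ha : 0 < a) (hD : 0 < D) (R : ℝ) :
    ∃ T > 0, R ≤ D * Real.exp (a * T) := by
  have h1 : Tendsto (fun t : ℝ => D * Real.exp (a * t)) atTop atTop :=
    (Real.tendsto_exp_atTop.comp (tendsto_id.const_mul_atTop ha)).const_mul_atTop hD
  obtain ⟨T, hT, hT0⟩ := ((h1.eventually_ge_atTop R).and (eventually_gt_atTop 0)).exists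
  exact ⟨T, hT0, hT⟩

/-- The angles between integrally separated columns are bounded away from zero. -/
theorem IntegrallySeparated.exists_coord_bound (h : IntegrallySeparated Φ a D)
    (hΦ : IsFundamentalMatrix A Φ) (hC : ∀ t, 0 ≤ t → ‖A t‖ ≤ C) (ha : 0 < a) (hD : 0 < D) :
    ∃ K > 0, ∀ t, 0 ≤ t → ∀ x : EVec n, ∀ i,
      |x i| * ‖Φ t (EuclideanSpace.single i 1)‖ ≤ K * ‖Φ t x‖ := by
  suffices H : ∀ k ≤ n, ∃ K > 0, ∀ t, 0 ≤ t → ∀ x : EVec n, (∀ i : Fin n, k ≤ i → x i = 0) →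
      ∀ i, |x i| * ‖Φ t (EuclideanSpace.single i 1)‖ ≤ K * ‖Φ t x‖ by
    obtain ⟨K, hK, hK'⟩ := H n le_rfl
    exact ⟨K, hK, fun t ht x => hK' t ht x fun i hi => absurd i.2 (by omega)⟩
  intro k
  induction k with
  | zero =>
    refine fun _ => ⟨1, one_pos, fun t _ x hx i => ?_⟩
    rw [hx i (Nat.zero_le _)]
    simp
  | succ k ih =>
    intro hk
    obtain ⟨K, hK, hKb⟩ := ih (by omega)
    obtain ⟨T, hT, hTR⟩ := exists_le_mul_exp ha hD (max 1 (2 * (n * K)))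
    set κ : Fin n := ⟨k, by omega⟩ with hκ
    set K1 : ℝ := 2 * (Real.exp (C * T) * Real.exp (C * T)) + 1 with hK1
    have hK1pos : 0 < K1 := by positivity
    refine ⟨K1 + K * (1 + K1), by positivity, fun t ht x hx => ?_⟩
    set p : EVec n := x - x κ • EuclideanSpace.single κ 1 with hp
    have hpκ : p κ = 0 := by simp [hp]
    have hpi : ∀ i, i ≠ κ → p i = x i := fun i hi => by simp [hp, hi]
    have hp0 : ∀ i : Fin n, k ≤ i → p i = 0 := fun i hi => by
      by_cases hik : i = κ
      · rw [hik, hpκ]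
      · rw [hpi i hik]
        refine hx i (lt_of_le_of_ne hi fun e => hik (Fin.ext e.symm))
    have hxp : ∀ τ, Φ τ x = Φ τ p + x κ • Φ τ (EuclideanSpace.single κ 1) := fun τ => by
      rw [hp, map_sub, map_smul]; abel
    have htT : 0 ≤ t + T := by linarith
    have hN := hΦ.norm_column_pos κ ht
    set γ := columnRatio Φ t (t + T) κ with hγ
    have hγN : ‖Φ (t + T) (EuclideanSpace.single κ 1)‖ =
        γ * ‖Φ t (EuclideanSpace.single κ 1)‖ := by
      rw [hγ, columnRatio, div_mul_cancel₀ _ hN.ne']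
    have hγpos : 0 < γ := div_pos (hΦ.norm_column_pos κ htT) hN
    have hu : ‖Φ t p‖ ≤ ‖Φ t x‖ + |x κ| * ‖Φ t (EuclideanSpace.single κ 1)‖ := by
      have : Φ t p = Φ t x - x κ • Φ t (EuclideanSpace.single κ 1) := by rw [hxp t]; abel
      rw [this]
      refine (norm_sub_le _ _).trans_eq ?_
      rw [norm_smul, Real.norm_eq_abs]
    have hpT : ‖Φ (t + T) p‖ ≤ γ / 2 * ‖Φ t p‖ := by
      set R : ℝ := max 1 (2 * (n * K)) with hR
      have hR1 : 1 ≤ R := le_max_left _ _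
      have hterm : ∀ i, |p i| * ‖Φ (t + T) (EuclideanSpace.single i 1)‖ ≤
          γ / R * (K * ‖Φ t p‖) := by
        intro i
        by_cases hik : k ≤ i
        · rw [hp0 i hik]; simp; positivity
        · have h1 := h.columnRatio_le hΦ hR1 ht (by linarith : t ≤ t + T)
            (by simpa using hTR) (show i < κ from Fin.lt_def.2 (by simp [hκ]; omega))
          have hNi := hΦ.norm_column_pos i ht
          have h2 : ‖Φ (t + T) (EuclideanSpace.single i 1)‖ =
              columnRatio Φ t (t + T) i * ‖Φ t (EuclideanSpace.single i 1)‖ := by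
            rw [columnRatio, div_mul_cancel₀ _ hNi.ne']
          have h3 : columnRatio Φ t (t + T) i ≤ γ / R := by
            rw [le_div_iff₀ (by linarith), mul_comm]; exact h1
          calc |p i| * ‖Φ (t + T) (EuclideanSpace.single i 1)‖
              = columnRatio Φ t (t + T) i * (|p i| * ‖Φ t (EuclideanSpace.single i 1)‖) := by
                rw [h2]; ring
            _ ≤ γ / R * (K * ‖Φ t p‖) := by
                exact mul_le_mul h3 (hKb t ht p hp0 i) (by positivity) (by positivity)
      refine (norm_apply_le_sum _ _).trans ((Finset.sum_le_sum fun i _ => hterm i).trans ?_)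
      rw [Finset.sum_const, Finset.card_univ, Fintype.card_fin, nsmul_eq_mul]
      have h2 : 2 * (n * K) ≤ R := le_max_right _ _
      have h4 : (n : ℝ) * K / R ≤ 1 / 2 := by
        rw [div_le_div_iff₀ (by linarith) two_pos]; linarith
      calc (n : ℝ) * (γ / R * (K * ‖Φ t p‖)) = γ * ‖Φ t p‖ * (n * K / R) := by ring
        _ ≤ γ * ‖Φ t p‖ * (1 / 2) := by gcongr
        _ = _ := by ring
    have hxT := hΦ.norm_apply_le hC x ht (by linarith : t ≤ t + T)
    rw [add_sub_cancel_left] at hxT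
    have hγlow := hΦ.exp_le_columnRatio hC κ ht (by linarith : t ≤ t + T)
    rw [add_sub_cancel_left, ← hγ, Real.exp_neg] at hγlow
    have hmain : |x κ| * ‖Φ t (EuclideanSpace.single κ 1)‖ ≤ K1 * ‖Φ t x‖ := by
      have e1 : |x κ| * (γ * ‖Φ t (EuclideanSpace.single κ 1)‖) ≤
          ‖Φ (t + T) x‖ + ‖Φ (t + T) p‖ := by
        rw [← hγN, ← Real.norm_eq_abs, ← norm_smul]
        have : x κ • Φ (t + T) (EuclideanSpace.single κ 1) = Φ (t + T) x - Φ (t + T) p := by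
          rw [hxp]; abel
        rw [this]
        exact norm_sub_le _ _
      set E := Real.exp (C * T) with hE
      have hEpos : 0 < E := Real.exp_pos _
      have e2 : E ≤ E * E * γ := by
        have := mul_le_mul_of_nonneg_left hγlow (mul_pos hEpos hEpos).le
        rwa [mul_assoc, mul_inv_cancel₀ hEpos.ne', mul_one] at this
      have e3 : γ * (|x κ| * ‖Φ t (EuclideanSpace.single κ 1)‖) ≤ γ * (K1 * ‖Φ t x‖) := by
        have e4 : γ / 2 * ‖Φ t p‖ ≤
            γ / 2 * (‖Φ t x‖ + |x κ| * ‖Φ t (EuclideanSpace.single κ 1)‖) := by gcongr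
        have e5 : E * ‖Φ t x‖ ≤ E * E * γ * ‖Φ t x‖ := by gcongr
        rw [hK1]
        linarith
      exact le_of_mul_le_mul_left e3 hγpos
    intro i
    have hX := norm_nonneg (Φ t x)
    by_cases hi : i = κ
    · rw [hi]
      refine hmain.trans ?_
      gcongr
      have : 0 < K * (1 + K1) := by positivity
      linarith
    · rw [← hpi i hi]
      calc _ ≤ K * ‖Φ t p‖ := hKb t ht p hp0 i
        _ ≤ K * (‖Φ t x‖ + K1 * ‖Φ t x‖) := by gcongr; linarith
        _ ≤ (K1 + K * (1 + K1)) * ‖Φ t x‖ := by nlinarith [mul_nonneg hK1pos.le hX]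

/-- Solutions of the perturbed and unperturbed systems with common initial value stay close. -/
theorem norm_sub_le_of_perturbation {B : ℝ → EOp n} {δ T : ℝ} (hΦ : IsFundamentalMatrix A Φ)
    (hC : ∀ t, 0 ≤ t → ‖A t‖ ≤ C) (hC1 : 1 ≤ C)
    (hY : IsFundamentalMatrix (fun t => A t + B t) Y) (hB : ∀ t, 0 ≤ t → ‖B t‖ ≤ δ)
    (hδ : δ ≤ 1) (hT : 0 ≤ T) {t : ℝ} (ht : 0 ≤ t) {x z : EVec n} (hz : Φ t z = Y t x) :
    ‖Y (t + T) x - Φ (t + T) z‖ ≤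
      δ * (Real.exp ((C + 1) * T) * Real.exp (C * T)) * ‖Y t x‖ := by
  have hδ0 : 0 ≤ δ := (norm_nonneg _).trans (hB 0 le_rfl)
  have hAB : ∀ t, 0 ≤ t → ‖A t + B t‖ ≤ C + 1 := fun t ht =>
    (norm_add_le _ _).trans (add_le_add (hC t ht) ((hB t ht).trans hδ))
  set ε := δ * (Real.exp ((C + 1) * T) * ‖Y t x‖) with hε
  have hder : ∀ τ, 0 ≤ τ → HasDerivAt (fun τ => Y τ x - Φ τ z)
      ((A τ + B τ) (Y τ x) - A τ (Φ τ z)) τ := fun τ hτ =>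
    (hY.hasDerivAt_apply x hτ).sub (hΦ.hasDerivAt_apply z hτ)
  have h := norm_le_gronwallBound_of_norm_deriv_right_le (f := fun τ => Y τ x - Φ τ z)
    (f' := fun τ => (A τ + B τ) (Y τ x) - A τ (Φ τ z))
    (δ := 0) (K := C) (ε := ε) (a := t) (b := t + T)
    (fun τ hτ => (hder τ (ht.trans hτ.1)).continuousAt.continuousWithinAt)
    (fun τ hτ => (hder τ (ht.trans hτ.1)).hasDerivWithinAt) (by simp [hz])
    (fun τ hτ => by
      have e : (A τ + B τ) (Y τ x) - A τ (Φ τ z) = A τ (Y τ x - Φ τ z) + B τ (Y τ x) := by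
        simp; abel
      have hτ0 := ht.trans hτ.1
      rw [e]
      refine (norm_add_le _ _).trans (add_le_add ((A τ).le_of_opNorm_le (hC τ hτ0) _) ?_)
      refine ((B τ).le_of_opNorm_le (hB τ hτ0) _).trans ?_
      rw [hε]
      gcongr
      refine (hY.norm_apply_le hAB x ht hτ.1).trans ?_
      gcongr
      linarith [hτ.2]) (t + T) ⟨by linarith, le_rfl⟩
  rw [gronwallBound_of_K_ne_0 (by linarith), add_sub_cancel_left] at h
  simp only [zero_mul, zero_add] at h
  refine h.trans ?_
  have hε0 : 0 ≤ ε := by positivity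
  have h1 : 0 ≤ Real.exp (C * T) - 1 := by
    have := Real.add_one_le_exp (C * T)
    nlinarith
  calc ε / C * (Real.exp (C * T) - 1) ≤ ε * (Real.exp (C * T) - 1) := by
        gcongr; exact div_le_self hε0 hC1
    _ ≤ ε * Real.exp (C * T) := by gcongr; linarith
    _ = _ := by rw [hε]; ring

/-- Comparison of two solutions along an arithmetic progression of times gives a comparison of
exponents. -/
theorem mem_growthSubmodule_of_discrete (hΦ : IsFundamentalMatrix A Φ)
    (hC : ∀ t, 0 ≤ t → ‖A t‖ ≤ C) (hY : IsFundamentalMatrix A' Y)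
    (hC' : ∀ t, 0 ≤ t → ‖A' t‖ ≤ C) (hC0 : 0 ≤ C) {T K η c : ℝ} (hT : 0 < T) (hK : 0 ≤ K)
    (hη : 0 ≤ η) {x z : EVec n}
    (h : ∀ m : ℕ, ‖Y (m * T) x‖ ≤ K * Real.exp (η * T) ^ m * ‖Φ (m * T) z‖)
    (hz : z ∈ growthSubmodule Φ c) : x ∈ growthSubmodule Y (c + η) := by
  intro c' hc'
  have hz' := hz (c' - η) (by linarith)
  have e1 : (fun t => Y t x) =O[atTop] fun t => Real.exp (η * t) • Φ t z := by
    refine Asymptotics.IsBigO.of_bound (Real.exp (C * T) * K * Real.exp (C * T)) ?_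
    filter_upwards [eventually_ge_atTop 0] with t ht
    set m := ⌊t / T⌋₊ with hm
    have h1 : m * T ≤ t := by
      rw [← le_div_iff₀ hT]; exact Nat.floor_le (by positivity)
    have h2 : t < m * T + T := by
      have := Nat.lt_floor_add_one (t / T)
      rw [div_lt_iff₀ hT] at this
      rw [hm]; linarith
    have h0 : 0 ≤ m * T := by positivity
    have hexp : Real.exp (C * (t - m * T)) ≤ Real.exp (C * T) := by
      gcongr; linarith
    rw [norm_smul, Real.norm_eq_abs, Real.abs_exp]
    calc ‖Y t x‖ ≤ Real.exp (C * T) * ‖Y (m * T) x‖ :=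
          (hY.norm_apply_le hC' x h0 h1).trans (by gcongr)
      _ ≤ Real.exp (C * T) * (K * Real.exp (η * T) ^ m * (Real.exp (C * T) * ‖Φ t z‖)) := by
          gcongr
          refine (h m).trans ?_
          gcongr
          exact (hΦ.norm_apply_ge hC z h0 h1).trans (by gcongr)
      _ ≤ Real.exp (C * T) * (K * Real.exp (η * t) * (Real.exp (C * T) * ‖Φ t z‖)) := by
          gcongr
          rw [← Real.exp_nat_mul]
          refine Real.exp_le_exp.2 ?_
          nlinarith [mul_le_mul_of_nonneg_left h1 hη]
      _ = _ := by ring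
  have e2 := e1.trans ((Asymptotics.isBigO_refl (fun t : ℝ => Real.exp (η * t)) atTop).smul hz')
  refine e2.congr_right fun t => ?_
  rw [smul_eq_mul, ← Real.exp_add]
  ring_nf

end Sufficiency

section DiscreteComparison

variable {n : ℕ}

theorem exists_norm_eq_abs [Nonempty (Fin n)] (w : Fin n → ℝ) : ∃ i, ‖w‖ = |w i| := by
  obtain ⟨i, hi⟩ := Finite.exists_max fun i => |w i|
  refine ⟨i, le_antisymm ((pi_norm_le_iff_of_nonneg (abs_nonneg _)).2 hi) ?_⟩
  simpa using norm_le_pi_norm w i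

theorem abs_apply_le_norm (w : Fin n → ℝ) (i : Fin n) : |w i| ≤ ‖w‖ := by
  simpa using norm_le_pi_norm w i

theorem exists_ne_zero_apply_eq_zero {V : Type*} [AddCommGroup V] [Module ℝ V]
    [FiniteDimensional ℝ V] (f : V →ₗ[ℝ] (Fin n → ℝ))
    (J : Finset (Fin n)) (W : Submodule ℝ V) (h : J.card < Module.finrank ℝ W) :
    ∃ x ∈ W, x ≠ 0 ∧ ∀ j ∈ J, f x j = 0 := by
  let g : W →ₗ[ℝ] (J → ℝ) := (LinearMap.funLeft ℝ ℝ (fun j : J => (j : Fin n))) ∘ₗ f ∘ₗ W.subtype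
  have hg : LinearMap.ker g ≠ ⊥ := LinearMap.ker_ne_bot_of_finrank_lt (by simpa using h)
  obtain ⟨x, hx, hx0⟩ := Submodule.exists_mem_ne_zero_of_ne_bot hg
  refine ⟨x, x.2, fun e => hx0 (Subtype.ext e), fun j hj => ?_⟩
  simpa [g, LinearMap.funLeft] using congrFun (LinearMap.mem_ker.1 hx) ⟨j, hj⟩

variable {w w' γ : Fin n → ℝ} {q ε : ℝ}

theorem le_norm_of_abs_sub_le (hγ : ∀ i, q ≤ γ i) (hq : 0 < q)
    (hw : ∀ i, |w' i - γ i * w i| ≤ ε * ‖w‖) {i : Fin n} (hi : ‖w‖ = |w i|) :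
    (γ i - ε) * ‖w‖ ≤ |w' i| := by
  have h1 : γ i * |w i| ≤ |w' i| + |w' i - γ i * w i| := by
    rw [← abs_of_pos (hq.trans_le (hγ i)), ← abs_mul, abs_of_pos (hq.trans_le (hγ i)),
      abs_sub_comm]
    linarith [abs_sub_abs_le_abs_sub (γ i * w i) (w' i)]
  rw [← hi] at h1
  linarith [hw i]

theorem abs_le_of_abs_sub_le (hγ : ∀ i, q ≤ γ i) (hq : 0 < q)
    (hw : ∀ i, |w' i - γ i * w i| ≤ ε * ‖w‖) (i : Fin n) :
    |w' i| ≤ (γ i + ε) * ‖w‖ := by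
  have h1 : |w' i| ≤ γ i * |w i| + |w' i - γ i * w i| := by
    rw [← abs_of_pos (hq.trans_le (hγ i)), ← abs_mul, abs_of_pos (hq.trans_le (hγ i))]
    linarith [abs_sub_abs_le_abs_sub (w' i) (γ i * w i)]
  have h2 : γ i * |w i| ≤ γ i * ‖w‖ :=
    mul_le_mul_of_nonneg_left (abs_apply_le_norm w i) (hq.trans_le (hγ i)).le
  linarith [hw i]

theorem argmax_le_argmax (hγ : ∀ i, q ≤ γ i) (hq : 0 < q)
    (hγ2 : ∀ i j, i < j → 2 * γ i ≤ γ j) (hε : 4 * ε < q)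
    (hw : ∀ i, |w' i - γ i * w i| ≤ ε * ‖w‖) (hw0 : 0 < ‖w‖) {i j : Fin n}
    (hi : ‖w‖ = |w i|) (hj : ‖w'‖ = |w' j|) : i ≤ j := by
  by_contra! hlt
  have h1 := le_norm_of_abs_sub_le hγ hq hw hi
  have h2 := abs_le_of_abs_sub_le hγ hq hw j
  have h3 := abs_apply_le_norm w' i
  have h4 : γ j + ε < γ i - ε := by linarith [hγ2 j i hlt, hγ i]
  nlinarith [mul_lt_mul_of_pos_right h4 hw0]

end DiscreteComparison

section Sufficiency

variable {n : ℕ} {A Φ Y : ℝ → EOp n} {C a D T K η : ℝ}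

/-- Coordinates of the solutions of a perturbed system, adapted to integrally separated columns
of the unperturbed one. -/
structure ComparisonCoordinates (Φ Y : ℝ → EOp n) (T K η : ℝ)
    (W : ℕ → EVec n →L[ℝ] (Fin n → ℝ)) : Prop where
  norm_le : ∀ (m : ℕ) x, ‖Y (m * T) x‖ ≤ K * ‖W m x‖
  norm_ge : ∀ (m : ℕ) x, ‖W m x‖ ≤ K * ‖Y (m * T) x‖
  argmax_le : ∀ m x i j, 0 < ‖W m x‖ → ‖W m x‖ = |W m x i| →
    ‖W (m + 1) x‖ = |W (m + 1) x j| → i ≤ j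
  growth_ge : ∀ (m : ℕ) x i k, k ≤ i → ‖W m x‖ = |W m x i| →
    columnRatio Φ (m * T) ((m + 1 : ℕ) * T) k * ‖W m x‖ ≤ Real.exp (η * T) * ‖W (m + 1) x‖
  growth_le : ∀ (m : ℕ) x j k, j ≤ k → ‖W (m + 1) x‖ = |W (m + 1) x j| →
    ‖W (m + 1) x‖ ≤ Real.exp (η * T) *
      (columnRatio Φ (m * T) ((m + 1 : ℕ) * T) k * ‖W m x‖)

theorem ComparisonCoordinates.mem_of_slow {W : ℕ → EVec n →L[ℝ] (Fin n → ℝ)} {A' : ℝ → EOp n}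
    (hW : ComparisonCoordinates Φ Y T K η W)
    (hΦ : IsFundamentalMatrix A Φ) (hC : ∀ t, 0 ≤ t → ‖A t‖ ≤ C) (hY : IsFundamentalMatrix A' Y)
    (hC' : ∀ t, 0 ≤ t → ‖A' t‖ ≤ C) (hC0 : 0 ≤ C) (hT : 0 < T) (hK : 0 ≤ K) (hη : 0 ≤ η)
    {k : Fin n} {x : EVec n} (hx : ∀ m, ∃ j ≤ k, ‖W m x‖ = |W m x j|) {c : ℝ}
    (hk : EuclideanSpace.single k 1 ∈ growthSubmodule Φ c) : x ∈ growthSubmodule Y (c + η) := by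
  have hN : ∀ m : ℕ, 0 < ‖Φ (m * T) (EuclideanSpace.single k 1)‖ := fun m =>
    hΦ.norm_column_pos k (by positivity)
  refine mem_growthSubmodule_of_discrete hΦ hC hY hC' hC0 hT
    (K := K * (‖W 0 x‖ / ‖Φ ((0 : ℕ) * T) (EuclideanSpace.single k 1)‖)) (by positivity) hη
    (fun m => ?_) hk
  have h : ‖W m x‖ ≤ ‖W 0 x‖ / ‖Φ ((0 : ℕ) * T) (EuclideanSpace.single k 1)‖ *
      Real.exp (η * T) ^ m * ‖Φ (m * T) (EuclideanSpace.single k 1)‖ := by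
    induction m with
    | zero => have := (hN 0).ne'; rw [pow_zero, mul_one, div_mul_cancel₀ _ this]
    | succ m ih =>
      obtain ⟨j, hj, hj'⟩ := hx (m + 1)
      refine (hW.growth_le m x j k hj hj').trans ?_
      have h0 : 0 ≤ columnRatio Φ (m * T) ((m + 1 : ℕ) * T) k := by
        unfold columnRatio; positivity
      refine (mul_le_mul_of_nonneg_left (mul_le_mul_of_nonneg_left ih h0)
        (Real.exp_pos _).le).trans_eq ?_
      have h1 := (hN m).ne'
      have h2 := (hN 0).ne'
      unfold columnRatio
      generalize ‖Φ ((0 : ℕ) * T) (EuclideanSpace.single k 1)‖ = N₀ at h2 ⊢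
      generalize ‖Φ (m * T) (EuclideanSpace.single k 1)‖ = N₁ at h1 ⊢
      field_simp
      ring
  refine (hW.norm_le m x).trans ((mul_le_mul_of_nonneg_left h hK).trans_eq ?_)
  simp only [mul_assoc]

theorem ComparisonCoordinates.mem_of_fast {W : ℕ → EVec n →L[ℝ] (Fin n → ℝ)} {A' : ℝ → EOp n}
    (hW : ComparisonCoordinates Φ Y T K η W)
    (hΦ : IsFundamentalMatrix A Φ) (hC : ∀ t, 0 ≤ t → ‖A t‖ ≤ C) (hY : IsFundamentalMatrix A' Y)
    (hC' : ∀ t, 0 ≤ t → ‖A' t‖ ≤ C) (hC0 : 0 ≤ C) (hT : 0 < T) (hK : 0 < K) (hη : 0 ≤ η)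
    {k : Fin n} {x : EVec n} (hx0 : x ≠ 0) (hx : ∃ j, k ≤ j ∧ ‖W 0 x‖ = |W 0 x j|) {c : ℝ}
    (hxc : x ∈ growthSubmodule Y c) : EuclideanSpace.single k 1 ∈ growthSubmodule Φ (c + η) := by
  have : Nonempty (Fin n) := ⟨k⟩
  have hWpos : ∀ m, 0 < ‖W m x‖ := fun m => by
    have h1 := (hY.norm_pos hx0 (show 0 ≤ (m : ℝ) * T by positivity)).trans_le (hW.norm_le m x)
    exact pos_of_mul_pos_right h1 hK.le
  have hN : ∀ m : ℕ, 0 < ‖Φ (m * T) (EuclideanSpace.single k 1)‖ := fun m =>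
    hΦ.norm_column_pos k (by positivity)
  have hfast : ∀ m, ∃ j, k ≤ j ∧ ‖W m x‖ = |W m x j| := fun m => by
    induction m with
    | zero => exact hx
    | succ m ih =>
      obtain ⟨i, hi, hi'⟩ := ih
      obtain ⟨j, hj⟩ := exists_norm_eq_abs (W (m + 1) x)
      exact ⟨j, hi.trans (hW.argmax_le m x i j (hWpos m) hi' hj), hj⟩
  refine mem_growthSubmodule_of_discrete hY hC' hΦ hC hC0 hT
    (K := K * (‖Φ ((0 : ℕ) * T) (EuclideanSpace.single k 1)‖ / ‖W 0 x‖)) (by positivity) hη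
    (fun m => ?_) hxc
  have h : ‖Φ (m * T) (EuclideanSpace.single k 1)‖ ≤
      ‖Φ ((0 : ℕ) * T) (EuclideanSpace.single k 1)‖ / ‖W 0 x‖ *
      Real.exp (η * T) ^ m * ‖W m x‖ := by
    induction m with
    | zero => rw [pow_zero, mul_one, div_mul_cancel₀ _ (hWpos 0).ne']
    | succ m ih =>
      obtain ⟨i, hi, hi'⟩ := hfast m
      have h1 := hW.growth_ge m x i k hi hi'
      have h2 : ‖Φ ((m + 1 : ℕ) * T) (EuclideanSpace.single k 1)‖ =
          columnRatio Φ (m * T) ((m + 1 : ℕ) * T) k *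
            ‖Φ (m * T) (EuclideanSpace.single k 1)‖ := by
        rw [columnRatio, div_mul_cancel₀ _ (hN m).ne']
      have h0 : 0 ≤ columnRatio Φ (m * T) ((m + 1 : ℕ) * T) k := by
        unfold columnRatio; positivity
      rw [h2]
      set Q := ‖Φ ((0 : ℕ) * T) (EuclideanSpace.single k 1)‖ / ‖W 0 x‖ with hQ
      have hQ0 : 0 ≤ Q := by positivity
      calc columnRatio Φ (m * T) ((m + 1 : ℕ) * T) k * ‖Φ (m * T) (EuclideanSpace.single k 1)‖
          ≤ columnRatio Φ (m * T) ((m + 1 : ℕ) * T) k *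
            (Q * Real.exp (η * T) ^ m * ‖W m x‖) := by gcongr
        _ = Q * Real.exp (η * T) ^ m * (columnRatio Φ (m * T) ((m + 1 : ℕ) * T) k * ‖W m x‖) := by
            ring
        _ ≤ Q * Real.exp (η * T) ^ m * (Real.exp (η * T) * ‖W (m + 1) x‖) := by gcongr
        _ = _ := by ring
  refine h.trans ?_
  have h3 := hW.norm_ge m x
  calc _ ≤ ‖Φ ((0 : ℕ) * T) (EuclideanSpace.single k 1)‖ / ‖W 0 x‖ *
      Real.exp (η * T) ^ m * (K * ‖Y (m * T) x‖) := by gcongr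
    _ = _ := by ring

theorem ComparisonCoordinates.lt_finrank {W : ℕ → EVec n →L[ℝ] (Fin n → ℝ)} {A' : ℝ → EOp n}
    (hW : ComparisonCoordinates Φ Y T K η W)
    (hΦ : IsFundamentalMatrix A Φ) (hC : ∀ t, 0 ≤ t → ‖A t‖ ≤ C) (hY : IsFundamentalMatrix A' Y)
    (hC' : ∀ t, 0 ≤ t → ‖A' t‖ ≤ C) (hC0 : 0 ≤ C) (hT : 0 < T) (hK : 0 < K) (hη : 0 ≤ η)
    {k : Fin n} {c : ℝ} (hk : EuclideanSpace.single k 1 ∈ growthSubmodule Φ c) :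
    (k : ℕ) < Module.finrank ℝ (growthSubmodule Y (c + η)) := by
  have : Nonempty (Fin n) := ⟨k⟩
  by_contra! hle
  set V := growthSubmodule Y (c + η) with hV
  let S : ℕ → Set (EVec n) := fun m =>
    {x | x ∈ Vᗮ ∧ ‖x‖ = 1 ∧ ∃ j ≤ k, ‖W m x‖ = |W m x j|}
  have hclosed : ∀ m, IsClosed (S m) := fun m => by
    have h1 : IsClosed {x : EVec n | ∃ j ≤ k, ‖W m x‖ = |W m x j|} := by
      have : {x : EVec n | ∃ j ≤ k, ‖W m x‖ = |W m x j|} =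
          ⋃ j ∈ {j | j ≤ k}, {x : EVec n | ‖W m x‖ = |W m x j|} := by ext; simp
      rw [this]
      refine (Set.toFinite _).isClosed_biUnion fun j _ => isClosed_eq (by fun_prop) ?_
      exact ((continuous_apply j).comp (W m).continuous).abs
    exact ((Submodule.isClosed_orthogonal V).inter
      ((isClosed_eq continuous_norm continuous_const).inter h1) :)
  have hcompact : IsCompact (S 0) := by
    refine (isCompact_sphere (0 : EVec n) 1).of_isClosed_subset (hclosed 0) fun x hx => ?_
    simpa using hx.2.1
  have hnonempty : ∀ m, (S m).Nonempty := fun m => by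
    have hdim := V.finrank_add_finrank_orthogonal
    rw [finrank_euclideanSpace_fin] at hdim
    obtain ⟨x, hxV, hx0, hxj⟩ := exists_ne_zero_apply_eq_zero (W m).toLinearMap (Finset.Ioi k) Vᗮ
      (by rw [Fin.card_Ioi]; have := k.2; omega)
    have hx0' : ‖x‖ ≠ 0 := norm_ne_zero_iff.2 hx0
    refine ⟨‖x‖⁻¹ • x, Submodule.smul_mem _ _ hxV, by simp [norm_smul, hx0'], ?_⟩
    obtain ⟨j, hj⟩ := exists_norm_eq_abs (W m (‖x‖⁻¹ • x))
    by_cases hjk : j ≤ k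
    · exact ⟨j, hjk, hj⟩
    · have h0 : W m (‖x‖⁻¹ • x) j = 0 := by
        have := hxj j (by simpa using hjk)
        simp only [ContinuousLinearMap.coe_coe] at this
        simp [this]
      rw [h0, abs_zero] at hj
      refine ⟨k, le_rfl, ?_⟩
      rw [norm_eq_zero.1 hj]
      simp
  have hmono : ∀ m, S (m + 1) ⊆ S m := by
    rintro m x ⟨h1, h2, j, hj, hj'⟩
    refine ⟨h1, h2, ?_⟩
    obtain ⟨i, hi⟩ := exists_norm_eq_abs (W m x)
    rcases (norm_nonneg (W m x)).eq_or_lt with h0 | h0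
    · refine ⟨k, le_rfl, ?_⟩
      rw [norm_eq_zero.1 h0.symm]
      simp
    · exact ⟨i, (hW.argmax_le m x i j h0 hi hj').trans hj, hi⟩
  obtain ⟨x, hx⟩ := IsCompact.nonempty_iInter_of_sequence_nonempty_isCompact_isClosed S hmono
    hnonempty hcompact hclosed
  rw [Set.mem_iInter] at hx
  have hxV := hW.mem_of_slow hΦ hC hY hC' hC0 hT hK.le hη (fun m => (hx m).2.2) hk
  have h0 : x = 0 := inner_self_eq_zero (𝕜 := ℝ).1 ((hx 0).1 x hxV)
  have := (hx 0).2.1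
  rw [h0] at this
  simp at this

theorem ComparisonCoordinates.mem_of_lt_finrank {W : ℕ → EVec n →L[ℝ] (Fin n → ℝ)}
    {A' : ℝ → EOp n} (hW : ComparisonCoordinates Φ Y T K η W)
    (hΦ : IsFundamentalMatrix A Φ) (hC : ∀ t, 0 ≤ t → ‖A t‖ ≤ C) (hY : IsFundamentalMatrix A' Y)
    (hC' : ∀ t, 0 ≤ t → ‖A' t‖ ≤ C) (hC0 : 0 ≤ C) (hT : 0 < T) (hK : 0 < K) (hη : 0 ≤ η)
    {k : Fin n} {c : ℝ} (hk : (k : ℕ) < Module.finrank ℝ (growthSubmodule Y c)) :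
    EuclideanSpace.single k 1 ∈ growthSubmodule Φ (c + η) := by
  have : Nonempty (Fin n) := ⟨k⟩
  obtain ⟨x, hxV, hx0, hxj⟩ := exists_ne_zero_apply_eq_zero (W 0).toLinearMap (Finset.Iio k)
    (growthSubmodule Y c) (by rwa [Fin.card_Iio])
  refine hW.mem_of_fast hΦ hC hY hC' hC0 hT hK hη hx0 ?_ hxV
  obtain ⟨j, hj⟩ := exists_norm_eq_abs (W 0 x)
  refine ⟨j, ?_, hj⟩
  by_contra! hlt
  have h0 : W 0 x j = 0 := hxj j (by simpa using hlt)
  rw [h0, abs_zero] at hj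
  have h1 := (hY.norm_pos hx0 (show 0 ≤ ((0 : ℕ) : ℝ) * T by simp)).trans_le (hW.norm_le 0 x)
  rw [hj] at h1
  simp at h1

end Sufficiency

section Sufficiency

variable {n : ℕ} {A Φ : ℝ → EOp n} {C a D η : ℝ}

theorem exists_perturbation_size {q G K x : ℝ} (hq : 0 < q) (hx : 0 < x) :
    ∃ δ > 0, δ ≤ 1 ∧ 4 * (K * (δ * G) * K) < q ∧
      K * (δ * G) * K ≤ q * (1 - Real.exp (-x)) := by
  have h1 : 0 < 1 - Real.exp (-x) := by
    have := Real.exp_lt_one_iff.2 (show -x < 0 by linarith)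
    linarith
  have hcont : Tendsto (fun δ : ℝ => K * (δ * G) * K) (𝓝[>] 0) (𝓝 0) := by
    have : Continuous fun δ : ℝ => K * (δ * G) * K := by fun_prop
    have h2 := this.tendsto 0
    simp only [zero_mul, mul_zero] at h2
    exact h2.mono_left nhdsWithin_le_nhds
  have e1 := hcont.eventually_lt_const (show 0 < q / 4 by positivity)
  have e2 := hcont.eventually_lt_const (mul_pos hq h1)
  have e3 : ∀ᶠ δ : ℝ in 𝓝[>] 0, δ < 1 :=
    (continuous_id.tendsto (0 : ℝ)).mono_left nhdsWithin_le_nhds |>.eventually_lt_const one_pos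
  obtain ⟨δ, h3, h4, h5, h6⟩ := (e1.and (e2.and (e3.and self_mem_nhdsWithin))).exists
  exact ⟨δ, h6, h5.le, by linarith, h4.le⟩

theorem IntegrallySeparated.exists_comparisonCoordinates (h : IntegrallySeparated Φ a D)
    (hΦ : IsFundamentalMatrix A Φ) (hC : ∀ t, 0 ≤ t → ‖A t‖ ≤ C) (hC1 : 1 ≤ C) (ha : 0 < a)
    (hD : 0 < D) (hη : 0 < η) : ∃ T > 0, ∃ K > 0, ∃ δ > 0, δ ≤ 1 ∧ ∀ B Y : ℝ → EOp n,
      (∀ t, 0 ≤ t → ‖B t‖ ≤ δ) → IsFundamentalMatrix (fun t => A t + B t) Y →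
      ∃ W, ComparisonCoordinates Φ Y T K η W := by
  obtain ⟨T, hT, hTD⟩ := exists_le_mul_exp ha hD 2
  obtain ⟨K₀, hK₀, hcoord⟩ := h.exists_coord_bound hΦ hC ha hD
  set K : ℝ := K₀ + n with hK
  have hK0 : K₀ ≤ K := by simp [hK]
  have hnK : (n : ℝ) ≤ K := by simp [hK, hK₀.le]
  have hKpos : 0 < K := hK₀.trans_le hK0
  set G := Real.exp ((C + 1) * T) * Real.exp (C * T) with hG
  set q := Real.exp (-(C * T)) with hq
  have hqpos : 0 < q := Real.exp_pos _
  obtain ⟨δ, hδ, hδ1, hδ4, hδη⟩ := exists_perturbation_size (G := G) (K := K) hqpos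
    (mul_pos hη hT)
  set ε := K * (δ * G) * K with hε
  refine ⟨T, hT, K, hKpos, δ, hδ, hδ1, fun B Y hB hY => ?_⟩
  choose! Θ hΘ hΘ' using hΦ.2
  have hΘa : ∀ t, 0 ≤ t → ∀ y, Φ t (Θ t y) = y := fun t ht y => DFunLike.congr_fun (hΘ t ht) y
  set N : ℕ → Fin n → ℝ := fun m i => ‖Φ (m * T) (EuclideanSpace.single i 1)‖ with hN
  have hm0 : ∀ m : ℕ, 0 ≤ (m : ℝ) * T := fun m => by positivity
  have hNpos : ∀ m i, 0 < N m i := fun m i => hΦ.norm_column_pos i (hm0 m)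
  let W : ℕ → EVec n →L[ℝ] (Fin n → ℝ) := fun m =>
    ContinuousLinearMap.pi fun i => N m i • (EuclideanSpace.proj i ∘L Θ (m * T) ∘L Y (m * T))
  have hW : ∀ m x i, W m x i = N m i * (Θ (m * T) (Y (m * T) x)) i := fun m x i => by simp [W]
  have hle : ∀ (m : ℕ) x, ‖Y (m * T) x‖ ≤ K * ‖W m x‖ := fun m x => by
    have h1 := norm_apply_le_sum (Φ (m * T)) (Θ (m * T) (Y (m * T) x))
    rw [hΘa _ (hm0 m)] at h1
    refine h1.trans ?_
    calc _ ≤ ∑ _i : Fin n, ‖W m x‖ := by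
          refine Finset.sum_le_sum fun i _ => ?_
          refine le_trans (le_of_eq ?_) (abs_apply_le_norm (W m x) i)
          rw [hW, abs_mul, abs_of_pos (hNpos m i), mul_comm]
      _ = n * ‖W m x‖ := by simp
      _ ≤ _ := by gcongr
  have hγq : ∀ (m : ℕ) i, q ≤ columnRatio Φ (m * T) ((m + 1 : ℕ) * T) i := fun m i => by
    have := hΦ.exp_le_columnRatio hC i (hm0 m) (show (m : ℝ) * T ≤ (m + 1 : ℕ) * T by
      push_cast; linarith)
    convert this using 2
    push_cast; ring
  have hγ2 : ∀ (m : ℕ) i j, i < j → 2 * columnRatio Φ (m * T) ((m + 1 : ℕ) * T) i ≤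
      columnRatio Φ (m * T) ((m + 1 : ℕ) * T) j := fun m i j hij => by
    refine h.columnRatio_le hΦ one_le_two (hm0 m) (by push_cast; linarith) ?_ hij
    have : ((m + 1 : ℕ) : ℝ) * T - m * T = T := by push_cast; ring
    rwa [this]
  have hstep : ∀ (m : ℕ) x i,
      |W (m + 1) x i - columnRatio Φ (m * T) ((m + 1 : ℕ) * T) i * W m x i| ≤ ε * ‖W m x‖ := by
    intro m x i
    have hm1 : ((m + 1 : ℕ) : ℝ) * T = m * T + T := by push_cast; ring
    set z := Θ (m * T) (Y (m * T) x) with hz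
    set z' := Θ ((m + 1 : ℕ) * T) (Y ((m + 1 : ℕ) * T) x) with hz'
    have e1 : W (m + 1) x i - columnRatio Φ (m * T) ((m + 1 : ℕ) * T) i * W m x i =
        (z' - z) i * N (m + 1) i := by
      rw [hW, hW, columnRatio]
      have h1 : ‖Φ (m * T) (EuclideanSpace.single i 1)‖ = N m i := rfl
      have h2 : ‖Φ ((m + 1 : ℕ) * T) (EuclideanSpace.single i 1)‖ = N (m + 1) i := rfl
      have h3 := (hNpos m i).ne'
      rw [h1, h2, PiLp.sub_apply, ← hz, ← hz']
      field_simp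
    rw [e1, abs_mul, abs_of_pos (hNpos _ _)]
    have hpert := norm_sub_le_of_perturbation hΦ hC hC1 hY hB hδ1 hT.le (hm0 m) (x := x) (z := z)
      (hΘa _ (hm0 m) _)
    have e2 : Φ ((m + 1 : ℕ) * T) (z' - z) = Y (m * T + T) x - Φ (m * T + T) z := by
      rw [map_sub, hz', hΘa _ (hm0 _), hm1]
    calc _ ≤ K₀ * ‖Φ ((m + 1 : ℕ) * T) (z' - z)‖ := hcoord _ (hm0 _) _ _
      _ ≤ K * (δ * G * (K * ‖W m x‖)) := by
        rw [e2]
        gcongr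
        exact hpert.trans (mul_le_mul_of_nonneg_left (hle m x) (by positivity))
      _ = _ := by rw [hε]; ring
  refine ⟨W, hle, fun m x => ?_, fun m x i j hpos hi hj => ?_, fun m x i k hki hi => ?_,
    fun m x j k hjk hj => ?_⟩
  · refine (pi_norm_le_iff_of_nonneg (by positivity)).2 fun i => ?_
    rw [Real.norm_eq_abs, hW, abs_mul, abs_of_pos (hNpos _ _), mul_comm]
    refine (hcoord _ (hm0 m) _ _).trans ?_
    rw [hΘa _ (hm0 m)]
    gcongr
  · exact argmax_le_argmax (hγq m) hqpos (hγ2 m) hδ4 (hstep m x) hpos hi hj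
  · have h1 := (le_norm_of_abs_sub_le (hγq m) hqpos (hstep m x) hi).trans
      (abs_apply_le_norm (W (m + 1) x) i)
    have hki' : columnRatio Φ (m * T) ((m + 1 : ℕ) * T) k ≤
        columnRatio Φ (m * T) ((m + 1 : ℕ) * T) i := by
      rcases hki.eq_or_lt with rfl | hlt
      · exact le_rfl
      · linarith [hγ2 m k i hlt, hγq m k]
    set γ := columnRatio Φ (m * T) ((m + 1 : ℕ) * T)
    have h2 : γ i * Real.exp (-(η * T)) ≤ γ i - ε := by
      have h3 : 0 ≤ 1 - Real.exp (-(η * T)) := by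
        rw [sub_nonneg, Real.exp_le_one_iff]
        have := mul_pos hη hT
        linarith
      nlinarith [mul_le_mul_of_nonneg_right (hγq m i) h3]
    have h4 : Real.exp (η * T) * Real.exp (-(η * T)) = 1 := by
      rw [← Real.exp_add, add_neg_cancel, Real.exp_zero]
    calc γ k * ‖W m x‖ ≤ γ i * ‖W m x‖ := by gcongr
      _ = Real.exp (η * T) * (γ i * Real.exp (-(η * T)) * ‖W m x‖) := by
        linear_combination -(γ i * ‖W m x‖) * h4
      _ ≤ Real.exp (η * T) * ((γ i - ε) * ‖W m x‖) := by gcongr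
      _ ≤ _ := by gcongr
  · have h1 := abs_le_of_abs_sub_le (hγq m) hqpos (hstep m x) j
    rw [← hj] at h1
    have hjk' : columnRatio Φ (m * T) ((m + 1 : ℕ) * T) j ≤
        columnRatio Φ (m * T) ((m + 1 : ℕ) * T) k := by
      rcases hjk.eq_or_lt with rfl | hlt
      · exact le_rfl
      · linarith [hγ2 m j k hlt, hγq m j]
    set γ := columnRatio Φ (m * T) ((m + 1 : ℕ) * T)
    have h4 : Real.exp (η * T) * Real.exp (-(η * T)) = 1 := by
      rw [← Real.exp_add, add_neg_cancel, Real.exp_zero]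
    have h5 : 1 + (1 - Real.exp (-(η * T))) ≤ Real.exp (η * T) := by
      have := Real.exp_pos (-(η * T))
      nlinarith [sq_nonneg (1 - Real.exp (-(η * T)))]
    have h6 : γ k + ε ≤ Real.exp (η * T) * γ k := by
      have h3 : 0 ≤ 1 - Real.exp (-(η * T)) := by
        rw [sub_nonneg, Real.exp_le_one_iff]
        have := mul_pos hη hT
        linarith
      nlinarith [mul_le_mul_of_nonneg_right (hγq m k) h3, hγq m k]
    calc _ ≤ (γ j + ε) * ‖W m x‖ := h1
      _ ≤ (Real.exp (η * T) * γ k) * ‖W m x‖ := by gcongr; linarith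
      _ = _ := by ring

/-- Integral separation implies stability of the exponents. -/
theorem IntegrallySeparated.stable (h : IntegrallySeparated Φ a D)
    (hΦ : IsFundamentalMatrix A Φ) (hC : ∀ t, 0 ≤ t → ‖A t‖ ≤ C) (ha : 0 < a)
    (hD : 0 < D) {lam : Fin n → ℝ} (hlam : HasLyapunovExponents A lam) (hη : 0 < η) :
    ∃ δ > 0, ∀ B : ℝ → EOp n, Continuous B → (∀ t, 0 ≤ t → ‖B t‖ ≤ δ) →
      ∀ μ : Fin n → ℝ, HasLyapunovExponents (fun t => A t + B t) μ →
        ∀ j, |μ j - lam j| ≤ η := by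
  set C' := max C 1 with hC'
  have hAC : ∀ t, 0 ≤ t → ‖A t‖ ≤ C' := fun t ht => (hC t ht).trans (le_max_left _ _)
  have hC1 : 1 ≤ C' := le_max_right _ _
  obtain ⟨T, hT, K, hK, δ, hδ, hδ1, hcoord⟩ :=
    h.exists_comparisonCoordinates hΦ hAC hC1 ha hD (half_pos hη)
  have key : ∀ B : ℝ → EOp n, (∀ t, 0 ≤ t → ‖B t‖ ≤ δ) → ∀ μ : Fin n → ℝ,
      HasLyapunovExponents (fun t => A t + B t) μ → ∀ k, |μ (Fin.rev k) - chiExp Φ k| ≤ η / 2 := by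
    intro B hB μ hμ k
    obtain ⟨hanti, Y, hY, -⟩ := id hμ
    obtain ⟨W, hW⟩ := hcoord B Y hB hY.1
    have hA1 : ∀ t, 0 ≤ t → ‖A t‖ ≤ C' + 1 := fun t ht => (hAC t ht).trans (by linarith)
    have hAB : ∀ t, 0 ≤ t → ‖A t + B t‖ ≤ C' + 1 := fun t ht =>
      (norm_add_le _ _).trans (add_le_add (hAC t ht) ((hB t ht).trans hδ1))
    have hmem : ∀ c, EuclideanSpace.single k 1 ∈ growthSubmodule Φ c ↔ chiExp Φ k ≤ c := fun c =>
      hΦ.mem_growthSubmodule_iff hC (by simp)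
    rw [abs_le]
    constructor
    · have h2 := hW.mem_of_lt_finrank hΦ hA1 hY.1 hAB (by linarith) hT hK (half_pos hη).le
        (k := k) (c := μ (Fin.rev k)) (by
          rw [hμ.finrank_growthSubmodule hAB hY.1]
          have h2 : Finset.Ici (Fin.rev k) ⊆
              Finset.univ.filter fun j => μ j ≤ μ (Fin.rev k) := fun j hj => by
            simpa using hanti (Finset.mem_Ici.1 hj)
          have h3 := Finset.card_le_card h2
          rw [Fin.card_Ici, Fin.val_rev] at h3
          have := k.2
          omega)
      have h3 := (hmem _).1 h2
      linarith
    · have h2 := hW.lt_finrank hΦ hA1 hY.1 hAB (by linarith) hT hK (half_pos hη).le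
        ((hmem _).2 le_rfl)
      rw [hμ.finrank_growthSubmodule hAB hY.1] at h2
      have h3 := antitone_le_of_lt_card hanti k h2
      linarith
  refine ⟨δ, hδ, fun B _ hB μ hμ j => ?_⟩
  have h1 := key B hB μ hμ (Fin.rev j)
  have h2 := key (fun _ => 0) (fun t _ => by simp [hδ.le]) lam (by simpa using hlam) (Fin.rev j)
  rw [Fin.rev_rev] at h1 h2
  rw [abs_le] at h1 h2 ⊢
  constructor <;> linarith [h1.1, h1.2, h2.1, h2.2]

end Sufficiency

section Inverse

variable {n : ℕ} {A X : ℝ → EOp n} {C : ℝ}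

/-- The inverse of a fundamental matrix, extended by a constant to negative times. -/
noncomputable def inverseMatrix (X : ℝ → EOp n) (t : ℝ) : EOp n := Ring.inverse (X (max t 0))

theorem isUnit_iff_exists_comp {F : EOp n} :
    IsUnit F ↔ ∃ G : EOp n, F ∘L G = 1 ∧ G ∘L F = 1 := isUnit_iff_exists

theorem IsFundamentalMatrix.isUnit (hX : IsFundamentalMatrix A X) {t : ℝ} (ht : 0 ≤ t) :
    IsUnit (X t) :=
  isUnit_iff_exists_comp.2 (hX.2 t ht)

theorem IsFundamentalMatrix.mul_inverseMatrix (hX : IsFundamentalMatrix A X) {t : ℝ}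
    (ht : 0 ≤ t) : X t * inverseMatrix X t = 1 := by
  rw [inverseMatrix, max_eq_left ht, Ring.mul_inverse_cancel _ (hX.isUnit ht)]

theorem IsFundamentalMatrix.inverseMatrix_mul (hX : IsFundamentalMatrix A X) {t : ℝ}
    (ht : 0 ≤ t) : inverseMatrix X t * X t = 1 := by
  rw [inverseMatrix, max_eq_left ht, Ring.inverse_mul_cancel _ (hX.isUnit ht)]

theorem IsFundamentalMatrix.apply_inverseMatrix (hX : IsFundamentalMatrix A X) {t : ℝ}
    (ht : 0 ≤ t) (x : EVec n) : X t (inverseMatrix X t x) = x :=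
  DFunLike.congr_fun (hX.mul_inverseMatrix ht) x

theorem IsFundamentalMatrix.inverseMatrix_apply (hX : IsFundamentalMatrix A X) {t : ℝ}
    (ht : 0 ≤ t) (x : EVec n) : inverseMatrix X t (X t x) = x :=
  DFunLike.congr_fun (hX.inverseMatrix_mul ht) x

theorem IsFundamentalMatrix.continuous_max (hX : IsFundamentalMatrix A X) :
    Continuous fun t => X (max t 0) := by
  have h : ContinuousOn X (Set.Ici 0) := fun t ht => (hX.1 t ht).continuousAt.continuousWithinAt
  exact h.comp_continuous (by fun_prop) fun t => Set.mem_Ici.2 (le_max_right _ _)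

theorem IsFundamentalMatrix.continuous_inverseMatrix (hX : IsFundamentalMatrix A X) :
    Continuous (inverseMatrix X) := by
  rw [continuous_iff_continuousAt]
  intro t
  obtain ⟨u, hu⟩ := hX.isUnit (le_max_right t 0)
  have h1 := NormedRing.inverse_continuousAt u
  rw [hu] at h1
  exact ContinuousAt.comp (f := fun t => X (max t 0)) h1 hX.continuous_max.continuousAt

end Inverse

section Scalars

variable {n : ℕ} (R S : EOp n) (r : ℝ)

theorem EOp.smul_mul : (r • R) * S = r • (R * S) := rfl

theorem EOp.mul_smul : R * (r • S) = r • (R * S) := by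
  ext1 x
  simp

theorem EOp.zero_smul : (0 : ℝ) • R = 0 := by
  ext1 x
  simp

theorem EOp.smul_zero : r • (0 : EOp n) = 0 := by
  ext1 x
  simp

theorem EOp.norm_smul : ‖r • R‖ = |r| * ‖R‖ :=
  _root_.norm_smul (β := EOp n) r R

end Scalars

section Tail

variable {n : ℕ} {A X B Y : ℝ → EOp n} {C δ t₀ : ℝ} {H : EOp n}

/-- `B` is a small perturbation vanishing from time `t₀` on, where the fundamental matrix `Y` of
the perturbed system is `X` up to the constant factor `H`. -/
structure PerturbedTail (A X : ℝ → EOp n) (δ : ℝ) (B Y : ℝ → EOp n) (H : EOp n) (t₀ : ℝ) :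
    Prop where
  nonneg : 0 ≤ t₀
  cont : Continuous B
  bound : ∀ τ, 0 ≤ τ → ‖B τ‖ ≤ δ
  fund : IsFundamentalMatrix (fun t => A t + B t) Y
  isUnit : IsUnit H
  eq_mul : ∀ τ, t₀ ≤ τ → Y τ = X τ * H
  eq_zero : ∀ τ, t₀ ≤ τ → B τ = 0

theorem isUnit_one_add_of_mul_self_eq_zero {R : EOp n} (hR : R * R = 0) (r : ℝ) :
    IsUnit (1 + r • R) := by
  refine isUnit_iff_exists.2 ⟨1 - r • R, ?_, ?_⟩
  · simp [mul_sub, add_mul, hR, EOp.smul_mul, EOp.mul_smul, EOp.smul_zero]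
  · simp [mul_add, sub_mul, hR, EOp.smul_mul, EOp.mul_smul, EOp.smul_zero]

theorem PerturbedTail.extend (h : PerturbedTail A X δ B Y H t₀) (hX : IsFundamentalMatrix A X)
    {T T' : ℝ} (hT : t₀ < T) (hT' : T ≤ T') {b : ℝ → ℝ} (hb : Continuous b)
    (hbT : ∀ τ ≤ T, b τ = 0) (hbT' : ∀ τ, T' ≤ τ → b τ = 0) {R : EOp n} (hR : R * R = 0)
    (hbR : ∀ τ, T ≤ τ → τ ≤ T' → |b τ| * ‖X τ * R * inverseMatrix X τ‖ ≤ δ) :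
    ∃ B' Y', PerturbedTail A X δ B' Y' ((1 + (∫ τ in T..T', b τ) • R) * H) T' ∧
      ∀ τ ≤ T, B' τ = B τ ∧ Y' τ = Y τ := by
  have hδ : 0 ≤ δ := (norm_nonneg _).trans (h.bound 0 le_rfl)
  set κ : ℝ → ℝ := fun τ => ∫ r in T..τ, b r with hκ
  have hκ' : ∀ τ, HasDerivAt κ (b τ) τ := fun τ =>
    intervalIntegral.integral_hasDerivAt_right (hb.intervalIntegrable _ _)
      hb.aestronglyMeasurable.stronglyMeasurableAtFilter hb.continuousAt
  have hκT : ∀ τ ≤ T, κ τ = 0 := fun τ hτ => by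
    rw [hκ]
    refine intervalIntegral.integral_zero_ae (Eventually.of_forall fun r hr => hbT r ?_)
    rw [Set.uIoc_of_ge hτ] at hr
    exact hr.2
  have hκT' : ∀ τ, T' ≤ τ → κ τ = κ T' := fun τ hτ => by
    have h1 : ∫ r in T'..τ, b r = 0 := by
      refine intervalIntegral.integral_zero_ae (Eventually.of_forall fun r hr => hbT' r ?_)
      rw [Set.uIoc_of_le hτ] at hr
      exact hr.1.le
    simp only [hκ]
    rw [← intervalIntegral.integral_add_adjacent_intervals (hb.intervalIntegrable T T')
      (hb.intervalIntegrable T' τ), h1, add_zero]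
  set B' : ℝ → EOp n := fun τ => B τ + b τ • (X (max τ 0) * R * inverseMatrix X τ) with hB'
  set Y' : ℝ → EOp n := fun τ => Y τ + κ τ • (X τ * R * H) with hY'
  have hY'eq : ∀ τ, t₀ ≤ τ → Y' τ = X τ * ((1 + κ τ • R) * H) := fun τ hτ => by
    simp only [hY', h.eq_mul τ hτ, add_mul, mul_add, one_mul, EOp.smul_mul, EOp.mul_smul,
      mul_assoc]
  have hagree : ∀ τ ≤ T, B' τ = B τ ∧ Y' τ = Y τ := fun τ hτ => by
    simp [hB', hY', hbT τ hτ, hκT τ hτ, EOp.zero_smul]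
  have hu : ∀ r : ℝ, IsUnit ((1 + r • R) * H) := fun r =>
    (isUnit_one_add_of_mul_self_eq_zero hR r).mul h.isUnit
  refine ⟨B', Y', ⟨h.nonneg.trans (hT.le.trans hT'), ?_, ?_, ⟨?_, ?_⟩, hu _, ?_, ?_⟩, hagree⟩
  · exact h.cont.add (hb.smul ((hX.continuous_max.mul continuous_const).mul
      hX.continuous_inverseMatrix))
  · intro τ hτ
    rcases le_total τ T with h1 | h1
    · rw [(hagree τ h1).1]
      exact h.bound τ hτ
    rcases le_total τ T' with h2 | h2
    · simp only [hB', h.eq_zero τ (hT.le.trans h1), zero_add, EOp.norm_smul,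
        max_eq_left hτ]
      exact hbR τ h1 h2
    · simp only [hB', h.eq_zero τ (hT.le.trans h1), hbT' τ h2, EOp.zero_smul, zero_add, norm_zero]
      exact hδ
  · intro τ hτ
    have h1 : HasDerivAt (fun τ => X τ * R * H) (A τ * X τ * R * H) τ :=
      ((hX.1 τ hτ).mul_const R).mul_const H
    have h2 : HasDerivAt Y' ((A τ + B τ) * Y τ +
        (κ τ • (A τ * X τ * R * H) + b τ • (X τ * R * H))) τ :=
      (h.fund.1 τ hτ).add ((hκ' τ).smul h1)
    change HasDerivAt Y' ((A τ + B' τ) * Y' τ) τ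
    convert h2 using 1
    rcases lt_or_ge τ T with h3 | h3
    · simp [hB', hY', hbT τ h3.le, hκT τ h3.le, EOp.zero_smul, add_mul]
    · have h4 := h.eq_zero τ (hT.le.trans h3)
      have h5 := h.eq_mul τ (hT.le.trans h3)
      simp only [hB', hY', h4, h5, zero_add, add_zero, max_eq_left hτ, add_mul, mul_add,
        EOp.smul_mul, EOp.mul_smul]
      have e1 : X τ * R * inverseMatrix X τ * (X τ * H) = X τ * R * H := by
        rw [← mul_assoc, mul_assoc _ _ (X τ), hX.inverseMatrix_mul hτ, mul_one]
      have e2 : X τ * R * inverseMatrix X τ * (X τ * R * H) = 0 := by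
        rw [show X τ * R * inverseMatrix X τ * (X τ * R * H) =
          X τ * R * (inverseMatrix X τ * X τ) * R * H by simp only [mul_assoc],
          hX.inverseMatrix_mul hτ, mul_one, mul_assoc (X τ) R R, hR, mul_zero, zero_mul]
      rw [e1, e2]
      simp only [EOp.smul_zero, add_zero, mul_assoc]
      abel
  · intro τ hτ
    rw [← isUnit_iff_exists_comp]
    rcases lt_or_ge τ T with h3 | h3
    · rw [(hagree τ h3.le).2]
      exact h.fund.isUnit hτ
    · rw [hY'eq τ (hT.le.trans h3)]
      exact (hX.isUnit hτ).mul (hu _)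
  · intro τ hτ
    rw [hY'eq τ (hT.le.trans (hT'.trans hτ)), hκT' τ hτ]
  · intro τ hτ
    simp [hB', h.eq_zero τ (hT.le.trans (hT'.trans hτ)), hbT' τ hτ, EOp.zero_smul]

end Tail

section Coupling

variable {n : ℕ} {A X : ℝ → EOp n} {C : ℝ} {u : EVec n} {ψ : EVec n →L[ℝ] ℝ}

theorem IsFundamentalMatrix.comp_inverseMatrix_comp (hX : IsFundamentalMatrix A X)
    (ψ : EVec n →L[ℝ] ℝ) {t : ℝ} (ht : 0 ≤ t) (x : EVec n) :
    (ψ ∘L inverseMatrix X t) (X t x) = ψ x := by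
  simp [hX.inverseMatrix_apply ht]

theorem IsFundamentalMatrix.norm_comp_inverseMatrix_pos (hX : IsFundamentalMatrix A X)
    (hψ : ψ ≠ 0) (t : ℝ) : 0 < ‖ψ ∘L inverseMatrix X t‖ := by
  refine norm_pos_iff.2 fun h => hψ ?_
  have h' : ψ ∘L inverseMatrix X (max t 0) = 0 := by
    simpa [inverseMatrix] using h
  ext1 x
  rw [← hX.comp_inverseMatrix_comp ψ (le_max_right t 0) x, h']
  rfl

theorem IsFundamentalMatrix.norm_comp_inverseMatrix_le (hX : IsFundamentalMatrix A X)
    (hC : ∀ t, 0 ≤ t → ‖A t‖ ≤ C) (ψ : EVec n →L[ℝ] ℝ) {s t : ℝ} (hs : 0 ≤ s) (hst : s ≤ t) :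
    ‖ψ ∘L inverseMatrix X t‖ ≤ Real.exp (C * (t - s)) * ‖ψ ∘L inverseMatrix X s‖ := by
  refine ContinuousLinearMap.opNorm_le_bound _ (by positivity) fun x => ?_
  have h1 := hX.norm_apply_ge hC (inverseMatrix X t x) hs hst
  rw [hX.apply_inverseMatrix (hs.trans hst)] at h1
  calc ‖(ψ ∘L inverseMatrix X t) x‖
      = ‖(ψ ∘L inverseMatrix X s) (X s (inverseMatrix X t x))‖ := by
        rw [hX.comp_inverseMatrix_comp ψ hs]
        rfl
    _ ≤ ‖ψ ∘L inverseMatrix X s‖ * ‖X s (inverseMatrix X t x)‖ :=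
        ContinuousLinearMap.le_opNorm _ _
    _ ≤ ‖ψ ∘L inverseMatrix X s‖ * (Real.exp (C * (t - s)) * ‖x‖) := by gcongr
    _ = _ := by ring

theorem IsFundamentalMatrix.norm_comp_inverseMatrix_ge (hX : IsFundamentalMatrix A X)
    (hC : ∀ t, 0 ≤ t → ‖A t‖ ≤ C) (ψ : EVec n →L[ℝ] ℝ) {s t : ℝ} (hs : 0 ≤ s) (hst : s ≤ t) :
    ‖ψ ∘L inverseMatrix X s‖ ≤ Real.exp (C * (t - s)) * ‖ψ ∘L inverseMatrix X t‖ := by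
  refine ContinuousLinearMap.opNorm_le_bound _ (by positivity) fun x => ?_
  have h1 := hX.norm_apply_le hC (inverseMatrix X s x) hs hst
  rw [hX.apply_inverseMatrix hs] at h1
  calc ‖(ψ ∘L inverseMatrix X s) x‖
      = ‖(ψ ∘L inverseMatrix X t) (X t (inverseMatrix X s x))‖ := by
        rw [hX.comp_inverseMatrix_comp ψ (hs.trans hst)]
        rfl
    _ ≤ ‖ψ ∘L inverseMatrix X t‖ * ‖X t (inverseMatrix X s x)‖ :=
        ContinuousLinearMap.le_opNorm _ _
    _ ≤ ‖ψ ∘L inverseMatrix X t‖ * (Real.exp (C * (t - s)) * ‖x‖) := by gcongr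
    _ = _ := by ring

/-- The norm of the rank one operator `x ↦ ψ(x) u` transported along the flow, extended by a
constant to negative times. -/
noncomputable def coupling (X : ℝ → EOp n) (u : EVec n) (ψ : EVec n →L[ℝ] ℝ) (t : ℝ) : ℝ :=
  ‖X (max t 0) u‖ * ‖ψ ∘L inverseMatrix X t‖

theorem IsFundamentalMatrix.coupling_pos (hX : IsFundamentalMatrix A X) (hu : u ≠ 0)
    (hψ : ψ ≠ 0) (t : ℝ) : 0 < coupling X u ψ t :=
  mul_pos (hX.norm_pos hu (le_max_right _ _)) (hX.norm_comp_inverseMatrix_pos hψ t)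

theorem IsFundamentalMatrix.continuous_coupling (hX : IsFundamentalMatrix A X) :
    Continuous (coupling X u ψ) :=
  (hX.continuous_max.clm_apply continuous_const).norm.mul
    (continuous_const.clm_comp hX.continuous_inverseMatrix).norm

theorem IsFundamentalMatrix.coupling_le (hX : IsFundamentalMatrix A X)
    (hC : ∀ t, 0 ≤ t → ‖A t‖ ≤ C) {s t : ℝ} (hs : 0 ≤ s) (hst : s ≤ t) :
    coupling X u ψ t ≤ Real.exp (2 * C * (t - s)) * coupling X u ψ s := by
  rw [coupling, coupling, max_eq_left hs, max_eq_left (hs.trans hst)]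
  calc _ ≤ (Real.exp (C * (t - s)) * ‖X s u‖) *
        (Real.exp (C * (t - s)) * ‖ψ ∘L inverseMatrix X s‖) := by
        gcongr
        · exact hX.norm_apply_le hC u hs hst
        · exact hX.norm_comp_inverseMatrix_le hC ψ hs hst
    _ = Real.exp (C * (t - s) + C * (t - s)) * (‖X s u‖ * ‖ψ ∘L inverseMatrix X s‖) := by
        rw [Real.exp_add]
        ring
    _ = _ := by ring_nf

theorem IsFundamentalMatrix.coupling_ge (hX : IsFundamentalMatrix A X)
    (hC : ∀ t, 0 ≤ t → ‖A t‖ ≤ C) {s t : ℝ} (hs : 0 ≤ s) (hst : s ≤ t) :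
    coupling X u ψ s ≤ Real.exp (2 * C * (t - s)) * coupling X u ψ t := by
  rw [coupling, coupling, max_eq_left hs, max_eq_left (hs.trans hst)]
  calc _ ≤ (Real.exp (C * (t - s)) * ‖X t u‖) *
        (Real.exp (C * (t - s)) * ‖ψ ∘L inverseMatrix X t‖) := by
        gcongr
        · exact hX.norm_apply_ge hC u hs hst
        · exact hX.norm_comp_inverseMatrix_ge hC ψ hs hst
    _ = Real.exp (C * (t - s) + C * (t - s)) * (‖X t u‖ * ‖ψ ∘L inverseMatrix X t‖) := by
        rw [Real.exp_add]
        ring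
    _ = _ := by ring_nf

theorem norm_mul_smulRight_mul (F G : EOp n) (u : EVec n) (ψ : EVec n →L[ℝ] ℝ) :
    ‖F * ψ.smulRight u * G‖ = ‖F u‖ * ‖ψ ∘L G‖ := by
  have h : F * ψ.smulRight u * G = (ψ ∘L G).smulRight (F u) := by
    ext1 x
    simp
  rw [h, ContinuousLinearMap.norm_smulRight_apply, mul_comm]

variable {B Y : ℝ → EOp n} {δ t₀ : ℝ} {H : EOp n}

theorem PerturbedTail.extend_smulRight (h : PerturbedTail A X δ B Y H t₀)
    (hX : IsFundamentalMatrix A X) (hu : u ≠ 0) (hψ : ψ ≠ 0) (hψu : ψ u = 0) {s t r : ℝ}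
    (hs : t₀ < s - 1) (hst : s ≤ t) (hr : |r| ≤ δ * ∫ τ in s..t, (coupling X u ψ τ)⁻¹) :
    ∃ B' Y', PerturbedTail A X δ B' Y' ((1 + r • ψ.smulRight u) * H) (t + 1) ∧
      ∀ τ ≤ s - 1, B' τ = B τ ∧ Y' τ = Y τ := by
  have hδ : 0 ≤ δ := (norm_nonneg _).trans (h.bound 0 le_rfl)
  set g : ℝ → ℝ := fun τ => (coupling X u ψ τ)⁻¹ with hg
  have hgc : Continuous g :=
    hX.continuous_coupling.inv₀ fun τ => (hX.coupling_pos hu hψ τ).ne'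
  have hgpos : ∀ τ, 0 < g τ := fun τ => inv_pos.2 (hX.coupling_pos hu hψ τ)
  set ρ : ℝ → ℝ := fun τ => max 0 (min 1 (min (τ - (s - 1)) (t + 1 - τ))) with hρ
  have hρc : Continuous ρ := by fun_prop
  have hρ0 : ∀ τ, 0 ≤ ρ τ := fun τ => le_max_left _ _
  have hρ1 : ∀ τ, ρ τ ≤ 1 := fun τ => max_le zero_le_one (min_le_left _ _)
  set I : ℝ := ∫ τ in (s - 1)..(t + 1), ρ τ * g τ with hI
  have hInt : ∀ a b, IntervalIntegrable (fun τ => ρ τ * g τ) MeasureTheory.volume a b :=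
    fun a b => (hρc.mul hgc).intervalIntegrable a b
  have hJI : ∫ τ in s..t, g τ ≤ I := by
    have e : ∫ τ in s..t, g τ = ∫ τ in s..t, ρ τ * g τ := by
      refine intervalIntegral.integral_congr fun τ hτ => ?_
      rw [Set.uIcc_of_le hst] at hτ
      have : ρ τ = 1 := by
        simp only [hρ]
        rw [min_eq_left, max_eq_right zero_le_one]
        exact le_min (by linarith [hτ.1]) (by linarith [hτ.2])
      simp [this]
    rw [e]
    exact intervalIntegral.integral_mono_interval (by linarith) hst (by linarith)
      (Eventually.of_forall fun τ => mul_nonneg (hρ0 τ) (hgpos τ).le) (hInt _ _)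
  have hI0 : 0 ≤ I := intervalIntegral.integral_nonneg (by linarith)
    fun τ _ => mul_nonneg (hρ0 τ) (hgpos τ).le
  have hrI : |r| ≤ δ * I := hr.trans (mul_le_mul_of_nonneg_left hJI hδ)
  have hR : ψ.smulRight u * ψ.smulRight u = (0 : EOp n) := by
    ext1 x
    simp [hψu]
  have hκ : ∫ τ in (s - 1)..(t + 1), r / I * (ρ τ * g τ) = r := by
    rw [intervalIntegral.integral_const_mul, ← hI]
    refine div_mul_cancel_of_imp fun h0 => ?_
    rw [h0, mul_zero] at hrI
    exact abs_nonpos_iff.1 hrI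
  have key := h.extend hX hs (T' := t + 1) (by linarith) (b := fun τ => r / I * (ρ τ * g τ))
    (by fun_prop) (fun τ hτ => ?_) (fun τ hτ => ?_) hR fun τ h1 h2 => ?_
  · rwa [hκ] at key
  · have : ρ τ = 0 := max_eq_left ((min_le_right _ _).trans
      ((min_le_left _ _).trans (by linarith)))
    simp [this]
  · have : ρ τ = 0 := max_eq_left ((min_le_right _ _).trans
      ((min_le_right _ _).trans (by linarith)))
    simp [this]
  · have h0 : 0 ≤ τ := h.nonneg.trans (hs.le.trans h1)
    have e : ‖X τ * ψ.smulRight u * inverseMatrix X τ‖ = coupling X u ψ τ := by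
      rw [norm_mul_smulRight_mul, coupling, max_eq_left h0]
    rw [e, abs_mul, abs_mul, abs_of_nonneg (hρ0 τ), abs_of_pos (hgpos τ), abs_div,
      abs_of_nonneg hI0]
    calc |r| / I * (ρ τ * g τ) * coupling X u ψ τ = |r| / I * ρ τ := by
          rw [mul_assoc, mul_assoc, inv_mul_cancel₀ (hX.coupling_pos hu hψ τ).ne', mul_one]
      _ ≤ δ * 1 := by
          gcongr
          · exact div_le_of_le_mul₀ hI0 hδ hrI
          · exact hρ1 τ
      _ = δ := mul_one δ

end Coupling

section Window

variable {n : ℕ} {X : ℝ → EOp n} {E : Submodule ℝ (EVec n)} {c : ℝ}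

theorem exists_uniform_window (hgrow : ∀ x ∉ E, ∃ᶠ t in atTop, Real.exp (c * t) < ‖X t x‖)
    {K : Set (EVec n)} (hK : IsCompact K) (hKE : ∀ x ∈ K, x ∉ E) (T₀ : ℝ) :
    ∃ T₁, ∀ x ∈ K, ∃ τ, T₀ ≤ τ ∧ τ ≤ T₁ ∧ Real.exp (c * τ) < ‖X τ x‖ := by
  let V : ℕ → Set (EVec n) := fun N => {x | ∃ τ, T₀ ≤ τ ∧ τ ≤ N ∧ Real.exp (c * τ) < ‖X τ x‖}
  have hV : ∀ N, IsOpen (V N) := fun N => by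
    have : V N = ⋃ τ : {τ : ℝ // T₀ ≤ τ ∧ τ ≤ N}, {x | Real.exp (c * τ) < ‖X τ x‖} := by
      ext x
      simp [V, and_assoc]
    rw [this]
    exact isOpen_iUnion fun τ => isOpen_lt continuous_const (by fun_prop)
  obtain ⟨N, hN⟩ := hK.elim_directed_cover V hV (fun x hx => by
    obtain ⟨τ, h1, h2⟩ := ((hgrow x (hKE x hx)).and_eventually (eventually_ge_atTop T₀)).exists
    obtain ⟨N, hN⟩ := exists_nat_ge τ
    exact Set.mem_iUnion.2 ⟨N, τ, h2, hN, h1⟩) (Monotone.directed_le fun N N' h x hx => by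
      obtain ⟨τ, h1, h2, h3⟩ := hx
      exact ⟨τ, h1, h2.trans (by exact_mod_cast h), h3⟩)
  exact ⟨N, fun x hx => hN hx⟩

end Window

section LinearAlgebra

variable {n : ℕ}

theorem exists_ne_zero_mem_inf (P Q : Submodule ℝ (EVec n))
    (h : n < Module.finrank ℝ P + Module.finrank ℝ Q) : ∃ x ∈ P, x ∈ Q ∧ x ≠ 0 := by
  have h1 := Submodule.finrank_sup_add_finrank_inf_eq P Q
  have h2 : Module.finrank ℝ ↥(P ⊔ Q) ≤ n := by
    simpa using Submodule.finrank_le (P ⊔ Q)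
  have h3 : P ⊓ Q ≠ ⊥ := fun h0 => by
    rw [h0, finrank_bot] at h1
    omega
  obtain ⟨x, hx, hx0⟩ := Submodule.exists_mem_ne_zero_of_ne_bot h3
  exact ⟨x, hx.1, hx.2, hx0⟩

theorem exists_unit_orthogonal_map_mem {F : EOp n} (hF : Function.Injective F)
    {U W : Submodule ℝ (EVec n)} {z : EVec n} (hz : z ≠ 0)
    (h : n + 1 < Module.finrank ℝ U + Module.finrank ℝ W) :
    ∃ y ∈ U, F y ∈ W ∧ ‖y‖ = 1 ∧ inner ℝ z y = (0 : ℝ) := by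
  set P := U ⊓ (ℝ ∙ z)ᗮ with hP
  have h1 := Submodule.finrank_sup_add_finrank_inf_eq U (ℝ ∙ z)ᗮ
  have h2 : Module.finrank ℝ ↥(U ⊔ (ℝ ∙ z)ᗮ) ≤ n := by
    simpa using Submodule.finrank_le (U ⊔ (ℝ ∙ z)ᗮ)
  have h3 := Submodule.finrank_add_finrank_orthogonal (ℝ ∙ z)
  rw [finrank_span_singleton hz, finrank_euclideanSpace_fin] at h3
  have h4 : Module.finrank ℝ (P.map (F : EVec n →ₗ[ℝ] EVec n)) = Module.finrank ℝ P :=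
    (Submodule.equivMapOfInjective _ hF P).finrank_eq.symm
  obtain ⟨w, hw, hwW, hw0⟩ := exists_ne_zero_mem_inf (P.map (F : EVec n →ₗ[ℝ] EVec n)) W (by
    rw [← hP] at h1
    omega)
  obtain ⟨x, hx, rfl⟩ := hw
  have hx0 : x ≠ 0 := by
    rintro rfl
    exact hw0 (map_zero _)
  have hxz : inner ℝ z x = (0 : ℝ) := Submodule.mem_orthogonal_singleton_iff_inner_right.1 hx.2
  refine ⟨‖x‖⁻¹ • x, U.smul_mem _ hx.1, ?_, norm_smul_inv_norm (𝕜 := ℝ) hx0, ?_⟩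
  · rw [map_smul]
    exact W.smul_mem _ hwW
  · rw [inner_smul_right, hxz, mul_zero]

/-- A vector of `span {p, r}` close to `p` and not orthogonal to `r`. -/
theorem exists_combination_inner_ne_zero {p r : EVec n} (hp : p ≠ 0) (hr : r ≠ 0) :
    ∃ a b : ℝ, inner ℝ (a • p + b • r) p = ‖p‖ ^ 2 ∧ ‖a • p + b • r‖ ≤ 2 * ‖p‖ ∧
      inner ℝ (a • p + b • r) r ≠ (0 : ℝ) := by
  by_cases h : inner ℝ p r = (0 : ℝ)
  · have hr' := norm_pos_iff.2 hr
    have hp' := norm_pos_iff.2 hp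
    refine ⟨1, ‖p‖ / ‖r‖, ?_, ?_, ?_⟩
    · rw [inner_add_left, inner_smul_left, inner_smul_left, real_inner_comm r p] at *
      simp [h]
    · refine (norm_add_le _ _).trans ?_
      rw [norm_smul, norm_smul, norm_one, one_mul, norm_div, norm_norm, norm_norm,
        div_mul_cancel₀ _ hr'.ne']
      linarith
    · rw [inner_add_left, inner_smul_left, inner_smul_left, h]
      simp [hp, hr]
  · refine ⟨1, 0, ?_, ?_, ?_⟩
    · simp
    · rw [one_smul, zero_smul, add_zero]
      linarith [norm_nonneg p]
    · simpa using h

theorem exists_riesz (f : EVec n →L[ℝ] ℝ) :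
    ∃ w : EVec n, ‖w‖ = ‖f‖ ∧ ∀ x, f x = inner ℝ w x :=
  ⟨(InnerProductSpace.toDual ℝ (EVec n)).symm f, by simp, fun x => by simp⟩

end LinearAlgebra

section Stage

variable {n : ℕ} {A X : ℝ → EOp n} {C δ c : ℝ} {E U : Submodule ℝ (EVec n)}

/-- Solutions starting in `E` and solutions leaving `E` are quantitatively decoupled. -/
def IsDecoupled (X : ℝ → EOp n) (E : Submodule ℝ (EVec n)) : Prop :=
  ∃ M S : ℝ, ∀ s t : ℝ, S ≤ s → s ≤ t → ∀ u ∈ E, u ≠ 0 → ∀ ψ : EVec n →L[ℝ] ℝ, ψ ≠ 0 →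
    (∀ e ∈ E, ψ e = 0) → ∫ τ in s..t, (coupling X u ψ τ)⁻¹ ≤ M * (coupling X u ψ t)⁻¹

/-- A tail perturbation steering into `E` exactly the direction `z` of `U`. -/
structure Stage (A X : ℝ → EOp n) (δ : ℝ) (E U : Submodule ℝ (EVec n)) where
  pert : ℝ → EOp n
  sol : ℝ → EOp n
  shift : EOp n
  time : ℝ
  dir : EVec n
  tail : PerturbedTail A X δ pert sol shift time
  dir_mem : dir ∈ U
  norm_dir : ‖dir‖ = 1
  shift_dir : shift dir ∈ E
  mem_span : ∀ x ∈ U, shift x ∈ E → ∃ a : ℝ, x = a • dir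

/-- `s'` continues `s`, and in the meantime all solutions of `U` away from `s.dir` have grown. -/
structure Stage.Next (c : ℝ) (s s' : Stage A X δ E U) : Prop where
  time_le : s.time + 1 ≤ s'.time
  agree : ∀ τ ≤ s.time, s'.pert τ = s.pert τ ∧ s'.sol τ = s.sol τ
  inner_dir : inner ℝ s.dir s'.dir = (0 : ℝ)
  grow : ∀ x ∈ U, ‖x‖ = 1 → |inner ℝ s.dir x| ≤ (9 / 10 : ℝ) →
    ∃ τ, s.time ≤ τ ∧ Real.exp (c * τ) < ‖s'.sol τ x‖ ∧ τ ≤ s'.time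

theorem Stage.exists_window (s : Stage A X δ E U)
    (hgrow : ∀ x ∉ E, ∃ᶠ t in atTop, Real.exp (c * t) < ‖X t x‖) :
    ∃ T, ∀ x ∈ U, ‖x‖ = 1 → |inner ℝ s.dir x| ≤ (9 / 10 : ℝ) →
      ∃ τ, s.time ≤ τ ∧ τ ≤ T ∧ Real.exp (c * τ) < ‖X τ (s.shift x)‖ := by
  set K₀ : Set (EVec n) :=
    Metric.sphere 0 1 ∩ ((U : Set (EVec n)) ∩ {x | |inner ℝ s.dir x| ≤ (9 / 10 : ℝ)}) with hK₀
  have hK₀c : IsCompact K₀ := (isCompact_sphere 0 1).inter_right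
    ((Submodule.closed_of_finiteDimensional U).inter
      (isClosed_le (by fun_prop) continuous_const))
  obtain ⟨T, hT⟩ := exists_uniform_window hgrow (hK₀c.image s.shift.continuous) (by
    rintro _ ⟨x, ⟨hx1, hxU, hx⟩, rfl⟩ hxE
    obtain ⟨a, rfl⟩ := s.mem_span x hxU hxE
    rw [mem_sphere_zero_iff_norm, norm_smul, s.norm_dir, mul_one, Real.norm_eq_abs] at hx1
    rw [Set.mem_ofPred_eq, inner_smul_right, real_inner_self_eq_norm_sq, s.norm_dir, one_pow,
      mul_one, hx1] at hx
    norm_num at hx) s.time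
  exact ⟨T, fun x hxU hx1 hx => hT _ ⟨x, ⟨by simpa using hx1, hxU, hx⟩, rfl⟩⟩

/-- The splitting of a direction whose image leaves `E` only along the direction dual to `ψ`. -/
theorem Stage.exists_direction (s : Stage A X δ E U) (hX : IsFundamentalMatrix A X) {T : ℝ}
    (hT : 0 ≤ T) {ψ : EVec n →L[ℝ] ℝ} (hψ : ψ ≠ 0) (hψE : ∀ e ∈ E, ψ e = 0)
    (hfin : n < Module.finrank ℝ U + Module.finrank ℝ E) :
    ∃ y p q : EVec n, y ∈ U ∧ ‖y‖ = 1 ∧ inner ℝ s.dir y = (0 : ℝ) ∧ p ∈ E ∧ q ≠ 0 ∧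
      s.shift y = p + q ∧ ψ q ≠ 0 ∧ |ψ q| = ‖ψ ∘L inverseMatrix X T‖ * ‖X T q‖ ∧
      ∀ e ∈ E, inner ℝ (X T e) (X T q) = (0 : ℝ) := by
  obtain ⟨w, hw, hwx⟩ := exists_riesz (ψ ∘L inverseMatrix X T)
  obtain ⟨q₁, rfl⟩ := hX.exists_apply_eq w hT
  have hw' : ∀ x, ψ x = inner ℝ (X T q₁) (X T x) := fun x => by
    rw [← hwx, hX.comp_inverseMatrix_comp ψ hT]
  have hpos := hX.norm_comp_inverseMatrix_pos hψ T
  have hq₁ : ψ q₁ = ‖X T q₁‖ ^ 2 := by rw [hw', real_inner_self_eq_norm_sq]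
  have hq₁E : q₁ ∉ E := fun h => by
    rw [hψE _ h, hw] at hq₁
    exact (pow_pos hpos 2).ne hq₁
  have hinj : Function.Injective s.shift := by
    obtain ⟨G, -, hG⟩ := isUnit_iff_exists_comp.1 s.tail.isUnit
    exact Function.LeftInverse.injective (g := G) fun x => DFunLike.congr_fun hG x
  have hdir : s.dir ≠ 0 := norm_ne_zero_iff.1 (by simp [s.norm_dir])
  have hfin' : Module.finrank ℝ E < Module.finrank ℝ ↥(E ⊔ ℝ ∙ q₁) :=
    Submodule.finrank_lt_finrank_of_lt (lt_of_le_of_ne le_sup_left fun h => hq₁E (by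
      rw [h]
      exact Submodule.mem_sup_right (Submodule.mem_span_singleton_self q₁)))
  obtain ⟨y, hyU, hyW, hy1, hyz⟩ := exists_unit_orthogonal_map_mem hinj hdir
    (U := U) (W := E ⊔ ℝ ∙ q₁) (by omega)
  obtain ⟨p, hp, q, hq, hpq⟩ := Submodule.mem_sup.1 hyW
  obtain ⟨a, rfl⟩ := Submodule.mem_span_singleton.1 hq
  have ha : a ≠ 0 := by
    rintro rfl
    rw [zero_smul, add_zero] at hpq
    obtain ⟨b, rfl⟩ := s.mem_span y hyU (hpq ▸ hp)
    rw [inner_smul_right, real_inner_self_eq_norm_sq, s.norm_dir, one_pow, mul_one] at hyz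
    simp [hyz] at hy1
  refine ⟨y, p, a • q₁, hyU, hy1, hyz, hp, smul_ne_zero ha fun h => hq₁E (h ▸ E.zero_mem),
    hpq.symm, ?_, ?_, fun e he => ?_⟩
  · rw [map_smul, smul_eq_mul, hq₁, hw]
    exact mul_ne_zero ha (pow_pos hpos 2).ne'
  · rw [map_smul, map_smul, norm_smul, smul_eq_mul, abs_mul, hq₁, hw, Real.norm_eq_abs,
      abs_of_nonneg (sq_nonneg ‖ψ ∘L inverseMatrix X T‖)]
    ring
  · rw [map_smul, inner_smul_right, real_inner_comm, ← hw', hψE e he, mul_zero]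

end Stage

section Step

variable {n : ℕ} {A X : ℝ → EOp n} {C δ c : ℝ} {E U : Submodule ℝ (EVec n)}

theorem IsFundamentalMatrix.exists_dual_correction (hX : IsFundamentalMatrix A X) {T : ℝ}
    (hT : 0 ≤ T) {p r q : EVec n} (hp : p ∈ E) (hr : r ∈ E) (hp0 : p ≠ 0) (hr0 : r ≠ 0)
    (hq : ∀ e ∈ E, inner ℝ (X T e) (X T q) = (0 : ℝ)) :
    ∃ β : EVec n →L[ℝ] ℝ, β q = 0 ∧ β p = 1 ∧ β r ≠ 0 ∧
      ‖β ∘L inverseMatrix X T‖ ≤ 2 / ‖X T p‖ := by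
  have hXp := hX.norm_pos hp0 hT
  obtain ⟨a, b, h1, h2, h3⟩ := exists_combination_inner_ne_zero
    (norm_pos_iff.1 hXp) (norm_pos_iff.1 (hX.norm_pos hr0 hT))
  set v := a • X T p + b • X T r with hv
  have hvE : v = X T (a • p + b • r) := by simp [hv]
  have hsq : ‖X T p‖ ^ 2 ≠ 0 := (pow_pos hXp 2).ne'
  refine ⟨innerSL ℝ ((‖X T p‖ ^ 2)⁻¹ • v) ∘L X T, ?_, ?_, ?_, ?_⟩
  · rw [ContinuousLinearMap.comp_apply, innerSL_apply_apply, inner_smul_left, hvE,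
      hq _ (E.add_mem (E.smul_mem _ hp) (E.smul_mem _ hr)), mul_zero]
  · rw [ContinuousLinearMap.comp_apply, innerSL_apply_apply, inner_smul_left, h1]
    simp [hXp.ne']
  · rw [ContinuousLinearMap.comp_apply, innerSL_apply_apply, inner_smul_left]
    exact mul_ne_zero (by simp [hXp.ne']) h3
  · have e : (innerSL ℝ ((‖X T p‖ ^ 2)⁻¹ • v) ∘L X T) ∘L inverseMatrix X T =
        innerSL ℝ ((‖X T p‖ ^ 2)⁻¹ • v) := by
      ext1 x
      simp only [ContinuousLinearMap.comp_apply, hX.apply_inverseMatrix hT]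
    rw [e, innerSL_apply_norm, norm_smul, norm_inv, norm_pow, norm_norm]
    calc (‖X T p‖ ^ 2)⁻¹ * ‖v‖ ≤ (‖X T p‖ ^ 2)⁻¹ * (2 * ‖X T p‖) := by gcongr
      _ = 2 / ‖X T p‖ := by
        field_simp

theorem norm_le_norm_add_of_inner_nonneg {a b : EVec n} (h : 0 ≤ inner ℝ a b) :
    ‖b‖ ≤ ‖a + b‖ := by
  refine le_of_sq_le_sq ?_ (norm_nonneg _)
  rw [norm_add_sq_real]
  nlinarith [sq_nonneg ‖a‖]

theorem le_integral_inv_coupling {u : EVec n} {ψ : EVec n →L[ℝ] ℝ}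
    (hX : IsFundamentalMatrix A X) (hu : u ≠ 0) (hψ : ψ ≠ 0) {K s : ℝ}
    (hK : ∀ τ, s ≤ τ → τ ≤ s + 1 → coupling X u ψ τ ≤ K) :
    K⁻¹ ≤ ∫ τ in s..(s + 1), (coupling X u ψ τ)⁻¹ := by
  have hc : Continuous fun τ => (coupling X u ψ τ)⁻¹ :=
    hX.continuous_coupling.inv₀ fun τ => (hX.coupling_pos hu hψ τ).ne'
  have h := intervalIntegral.integral_mono_on (μ := MeasureTheory.volume) (a := s) (b := s + 1)
    (f := fun _ => K⁻¹) (by linarith) intervalIntegrable_const (hc.intervalIntegrable _ _)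
    fun τ hτ => inv_anti₀ (hX.coupling_pos hu hψ τ) (hK τ hτ.1 hτ.2)
  simpa using h

theorem Stage.exists_next (s : Stage A X δ E U) (hX : IsFundamentalMatrix A X)
    (hC : ∀ t, 0 ≤ t → ‖A t‖ ≤ C) (hδ : 0 < δ)
    (hgrow : ∀ x ∉ E, ∃ᶠ t in atTop, Real.exp (c * t) < ‖X t x‖)
    (hE : ¬ IsDecoupled X E) (hfin : n < Module.finrank ℝ U + Module.finrank ℝ E) :
    ∃ s' : Stage A X δ E U, s.Next c s' := by
  have hC0 : 0 ≤ C := (norm_nonneg _).trans (hC 0 le_rfl)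
  obtain ⟨T₁, hT₁⟩ := s.exists_window hgrow
  simp only [IsDecoupled, not_exists, not_forall, not_le] at hE
  set M : ℝ := 2 * Real.exp (8 * C) / δ ^ 2 with hM
  obtain ⟨r, t, hrS, hrt, u, huE, hu, ψ, hψ, hψE, hInt⟩ := hE M (max T₁ s.time + 2)
  set J := ∫ τ in r..t, (coupling X u ψ τ)⁻¹ with hJ
  set T := t + 1 with hT
  have h0 := s.tail.nonneg
  have hr1 : T₁ + 2 ≤ r := (by gcongr; exact le_max_left _ _ : T₁ + 2 ≤ _).trans hrS
  have hr2 : s.time + 2 ≤ r := (by gcongr; exact le_max_right _ _ : s.time + 2 ≤ _).trans hrS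
  have ht0 : 0 ≤ t := by linarith
  have hT0 : 0 ≤ T := by linarith
  have hcpos := fun τ => hX.coupling_pos hu hψ τ
  have hMpos : 0 < M := by positivity
  have hJpos : 0 < J := (mul_pos hMpos (inv_pos.2 (hcpos t))).trans hInt
  obtain ⟨y, p, q, hyU, hy1, hyz, hpE, hq0, hsplit, hψq, hψqn, hqE⟩ :=
    s.exists_direction hX hT0 hψ hψE hfin
  obtain ⟨k, hk, hksign⟩ : ∃ k : ℝ, |k| = δ * J ∧
      0 ≤ k * (ψ q * inner ℝ (X T p) (X T u)) := by
    rcases le_total 0 (ψ q * inner ℝ (X T p) (X T u)) with h | h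
    · exact ⟨δ * J, abs_of_pos (mul_pos hδ hJpos), mul_nonneg (mul_pos hδ hJpos).le h⟩
    · refine ⟨-(δ * J), by rw [abs_neg, abs_of_pos (mul_pos hδ hJpos)], ?_⟩
      exact mul_nonneg_of_nonpos_of_nonpos (by linarith [mul_pos hδ hJpos]) h
  set P := p + (k * ψ q) • u with hP
  have hPE : P ∈ E := E.add_mem hpE (E.smul_mem _ huE)
  have hXu := hX.norm_pos hu hT0
  have hXq := hX.norm_pos hq0 hT0
  have hXP : δ * J * |ψ q| * ‖X T u‖ ≤ ‖X T P‖ := by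
    have := norm_le_norm_add_of_inner_nonneg (a := X T p) (b := (k * ψ q) • X T u) (by
      rw [inner_smul_right, mul_assoc]
      exact hksign)
    rwa [norm_smul, Real.norm_eq_abs, abs_mul, hk, ← map_smul, ← map_add] at this
  have hXPpos : 0 < ‖X T P‖ := by
    refine lt_of_lt_of_le ?_ hXP
    have := abs_pos.2 hψq
    positivity
  have hP0 : P ≠ 0 := by
    intro h
    rw [h, map_zero, norm_zero] at hXPpos
    exact hXPpos.false
  have hzshift : s.shift s.dir ≠ 0 := by
    intro h
    obtain ⟨G, -, hG⟩ := isUnit_iff_exists_comp.1 s.tail.isUnit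
    have h1 : s.dir = 0 := by simpa [h] using (DFunLike.congr_fun hG s.dir).symm
    simpa [h1] using s.norm_dir
  obtain ⟨β, hβq, hβP, hβz, hβn⟩ := hX.exists_dual_correction hT0 hPE s.shift_dir hP0 hzshift hqE
  have hβ0 : β ≠ 0 := by
    rintro rfl
    simp at hβP
  obtain ⟨B₁, Y₁, htail₁, hagree₁⟩ := s.tail.extend_smulRight hX hu hψ (hψE u huE)
    (s := r) (t := t) (r := k) (by linarith) hrt hk.le
  have hcoup : coupling X q β T ≤ δ * Real.exp (-(6 * C)) := by
    have h1 : M < J * coupling X u ψ t := by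
      rwa [← div_eq_mul_inv, div_lt_iff₀ (hcpos t)] at hInt
    have h2 : δ * J * coupling X u ψ T * ‖X T q‖ ≤ ‖X T P‖ := by
      refine le_trans (le_of_eq ?_) hXP
      rw [hψqn, coupling, max_eq_left hT0]
      ring
    have h3 : coupling X u ψ t ≤ Real.exp (2 * C) * coupling X u ψ T := by
      have := hX.coupling_ge (u := u) (ψ := ψ) hC ht0 (by linarith : t ≤ T)
      rwa [hT, add_sub_cancel_left, mul_one] at this
    have h4 : M ≤ J * coupling X u ψ T * Real.exp (2 * C) := by
      refine h1.le.trans ((mul_le_mul_of_nonneg_left h3 hJpos.le).trans (le_of_eq ?_))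
      ring
    have h5 : δ * (M * Real.exp (-(2 * C))) * ‖X T q‖ ≤ ‖X T P‖ := by
      refine le_trans ?_ h2
      have h6 : M * Real.exp (-(2 * C)) ≤ J * coupling X u ψ T := by
        rw [Real.exp_neg, ← div_eq_mul_inv, div_le_iff₀ (Real.exp_pos _)]
        exact h4
      rw [mul_assoc δ J]
      gcongr
    have h7 : M * Real.exp (-(2 * C)) = 2 * Real.exp (6 * C) / δ ^ 2 := by
      rw [hM, div_mul_eq_mul_div, mul_assoc, ← Real.exp_add]
      ring_nf
    rw [coupling, max_eq_left hT0]
    calc ‖X T q‖ * ‖β ∘L inverseMatrix X T‖ ≤ ‖X T q‖ * (2 / ‖X T P‖) := by gcongr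
      _ ≤ δ * Real.exp (-(6 * C)) := by
        rw [← mul_div_assoc, div_le_iff₀ hXPpos]
        rw [h7] at h5
        calc ‖X T q‖ * 2 = δ * Real.exp (-(6 * C)) *
              (δ * (2 * Real.exp (6 * C) / δ ^ 2) * ‖X T q‖) := by
              rw [Real.exp_neg]
              field_simp
          _ ≤ _ := by gcongr
  have hone : 1 ≤ δ * ∫ τ in (T + 2)..(T + 2 + 1), (coupling X q β τ)⁻¹ := by
    have h1 := le_integral_inv_coupling hX hq0 hβ0 (K := δ) (s := T + 2) fun τ h1 h2 => by
      have h3 := hX.coupling_le (u := q) (ψ := β) hC hT0 (by linarith : T ≤ τ)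
      refine h3.trans ?_
      calc Real.exp (2 * C * (τ - T)) * coupling X q β T
          ≤ Real.exp (6 * C) * coupling X q β T :=
            mul_le_mul_of_nonneg_right (Real.exp_le_exp.2 (by nlinarith))
              (hX.coupling_pos hq0 hβ0 T).le
        _ ≤ Real.exp (6 * C) * (δ * Real.exp (-(6 * C))) := by gcongr
        _ = δ := by
            rw [Real.exp_neg]
            field_simp
    calc 1 = δ * δ⁻¹ := (mul_inv_cancel₀ hδ.ne').symm
      _ ≤ _ := by gcongr
  obtain ⟨B₂, Y₂, htail₂, hagree₂⟩ := htail₁.extend_smulRight hX hq0 hβ0 hβq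
    (s := T + 2) (t := T + 2 + 1) (r := -1) (by linarith) (by linarith) (by simpa using hone)
  set H' : EOp n := (1 + (-1 : ℝ) • β.smulRight q) * ((1 + k • ψ.smulRight u) * s.shift) with hH'
  have hH'x : ∀ x, H' x = s.shift x + (k * ψ (s.shift x)) • u -
      β (s.shift x + (k * ψ (s.shift x)) • u) • q := fun x => by
    simp only [hH', mul_apply_eq_comp, add_apply,
      one_apply_eq_self, smul_apply,
      ContinuousLinearMap.smulRight_apply, smul_smul]
    rw [neg_one_mul, neg_smul, sub_eq_add_neg]
  have hLy : s.shift y + (k * ψ (s.shift y)) • u = P + q := by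
    rw [hsplit, map_add, hψE p hpE, zero_add, hP]
    abel
  have hβy : β (P + q) = 1 := by rw [map_add, hβP, hβq, add_zero]
  have hagree : ∀ τ ≤ r - 1, B₂ τ = s.pert τ ∧ Y₂ τ = s.sol τ := fun τ hτ =>
    ⟨(hagree₂ τ (by linarith)).1.trans (hagree₁ τ hτ).1,
      (hagree₂ τ (by linarith)).2.trans (hagree₁ τ hτ).2⟩
  let s' : Stage A X δ E U :=
    { pert := B₂
      sol := Y₂
      shift := H'
      time := T + 2 + 1 + 1
      dir := y
      tail := htail₂
      dir_mem := hyU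
      norm_dir := hy1
      shift_dir := by
        rw [hH'x, hLy, hβy, one_smul, add_sub_cancel_right]
        exact hPE
      mem_span := fun x hxU hxE => by
        rw [hH'x] at hxE
        set b := β (s.shift x + (k * ψ (s.shift x)) • u) with hb
        have h1 : s.shift (x - b • y) ∈ E := by
          have h2 := E.sub_mem (E.sub_mem hxE (E.smul_mem (k * ψ (s.shift x)) huE))
            (E.smul_mem b hpE)
          convert h2 using 1
          rw [map_sub, map_smul, hsplit, smul_add]
          abel
        obtain ⟨a, ha⟩ := s.mem_span _ (U.sub_mem hxU (U.smul_mem _ hyU)) h1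
        have hx : x = a • s.dir + b • y := by rw [← ha, sub_add_cancel]
        have h3 : b = a * β (s.shift s.dir) + b := by
          have h4 : s.shift x + (k * ψ (s.shift x)) • u =
              a • s.shift s.dir + b • (P + q) := by
            rw [← hLy]
            conv_lhs => rw [hx]
            simp only [map_add, map_smul, hψE _ s.shift_dir, smul_eq_mul]
            module
          conv_lhs => rw [hb, h4]
          rw [map_add, map_smul, map_smul, hβy, smul_eq_mul, smul_eq_mul, mul_one]
        have h5 : a = 0 := by
          have : a * β (s.shift s.dir) = 0 := by linarith
          exact (mul_eq_zero.1 this).resolve_right hβz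
        exact ⟨b, by rw [hx, h5, zero_smul, zero_add]⟩ }
  refine ⟨s', ⟨?_, fun τ hτ => hagree τ (by linarith), hyz, fun x hxU hx1 hx => ?_⟩⟩
  · change s.time + 1 ≤ T + 2 + 1 + 1
    linarith
  · obtain ⟨τ, h1, h2, h3⟩ := hT₁ x hxU hx1 hx
    refine ⟨τ, h1, ?_, ?_⟩
    · change _ < ‖Y₂ τ x‖
      rw [(hagree τ (by linarith)).2, s.tail.eq_mul τ h1]
      exact h3
    · change τ ≤ T + 2 + 1 + 1
      linarith

end Step

section Limit

variable {n : ℕ} {A X : ℝ → EOp n} {C δ c : ℝ} {E U : Submodule ℝ (EVec n)}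

theorem exists_stage (hX : IsFundamentalMatrix A X) (hδ : 0 ≤ δ) (hE : E ≠ ⊥) :
    ∃ U : Submodule ℝ (EVec n), n < Module.finrank ℝ U + Module.finrank ℝ E ∧
      Nonempty (Stage A X δ E U) := by
  obtain ⟨x, hx, hx0⟩ := Submodule.exists_mem_ne_zero_of_ne_bot hE
  set z := ‖x‖⁻¹ • x with hz
  have hzE : z ∈ E := E.smul_mem _ hx
  have hz1 : ‖z‖ = 1 := norm_smul_inv_norm (𝕜 := ℝ) hx0
  have hz0 : z ≠ 0 := norm_ne_zero_iff.1 (by simp [hz1])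
  have hzU : z ∈ Eᗮ ⊔ ℝ ∙ z := Submodule.mem_sup_right (Submodule.mem_span_singleton_self z)
  refine ⟨Eᗮ ⊔ ℝ ∙ z, ?_, ⟨0, X, 1, 0, z, ?_, hzU, hz1, hzE, fun y hyU hyE => ?_⟩⟩
  · have h1 : Module.finrank ℝ Eᗮ < Module.finrank ℝ ↥(Eᗮ ⊔ ℝ ∙ z) :=
      Submodule.finrank_lt_finrank_of_lt (lt_of_le_of_ne le_sup_left fun h => hz0 (by
        rw [← h] at hzU
        exact inner_self_eq_zero.1 (Submodule.inner_right_of_mem_orthogonal hzE hzU)))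
    have h2 := Submodule.finrank_add_finrank_orthogonal E
    rw [finrank_euclideanSpace_fin] at h2
    omega
  · exact
      { nonneg := le_rfl
        cont := continuous_const
        bound := fun τ _ => by simpa using hδ
        fund := by simpa using hX
        isUnit := isUnit_one
        eq_mul := fun τ _ => (mul_one _).symm
        eq_zero := fun τ _ => rfl }
  · obtain ⟨w, hw, v, hv, rfl⟩ := Submodule.mem_sup.1 hyU
    obtain ⟨a, rfl⟩ := Submodule.mem_span_singleton.1 hv
    have hwE : w ∈ E := by
      have := E.sub_mem hyE (E.smul_mem a hzE)
      rwa [one_apply_eq_self, add_sub_cancel_right] at this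
    have hw0 : w = 0 := inner_self_eq_zero.1 (Submodule.inner_right_of_mem_orthogonal hwE hw)
    exact ⟨a, by rw [hw0, zero_add]⟩

theorem abs_inner_le_or_abs_inner_le {z z' x : EVec n} (hz : ‖z‖ = 1) (hz' : ‖z'‖ = 1)
    (hx : ‖x‖ = 1) (h : inner ℝ z z' = (0 : ℝ)) :
    |inner ℝ z x| ≤ (9 / 10 : ℝ) ∨ |inner ℝ z' x| ≤ (9 / 10 : ℝ) := by
  by_contra! hcon
  set a : ℝ := inner ℝ z x with ha
  set b : ℝ := inner ℝ z' x with hb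
  have h1 : inner ℝ x (a • z + b • z') = a ^ 2 + b ^ 2 := by
    rw [inner_add_right, inner_smul_right, inner_smul_right, real_inner_comm, real_inner_comm z',
      ← ha, ← hb]
    ring
  have h2 : ‖a • z + b • z'‖ ^ 2 = a ^ 2 + b ^ 2 := by
    rw [norm_add_sq_real, inner_smul_left, inner_smul_right, h, norm_smul, norm_smul, hz, hz']
    simp
  have h3 := norm_sub_sq_real x (a • z + b • z')
  rw [h1, h2, hx] at h3
  have h4 := sq_nonneg ‖x - (a • z + b • z')‖
  have h5 : (81 / 100 : ℝ) < a ^ 2 := by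
    rw [← sq_abs]
    nlinarith
  have h6 : (81 / 100 : ℝ) < b ^ 2 := by
    rw [← sq_abs]
    nlinarith
  linarith

theorem exists_perturbation_of_chain (f : ℕ → Stage A X δ E U)
    (hf : ∀ m, (f m).Next c (f (m + 1))) :
    ∃ B Y : ℝ → EOp n, Continuous B ∧ (∀ t, 0 ≤ t → ‖B t‖ ≤ δ) ∧
      IsFundamentalMatrix (fun t => A t + B t) Y ∧
      ∀ x ∈ U, ‖x‖ = 1 → ∃ᶠ t in atTop, Real.exp (c * t) < ‖Y t x‖ := by
  have htime : ∀ m : ℕ, (m : ℝ) ≤ (f m).time := fun m => by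
    induction m with
    | zero => simpa using (f 0).tail.nonneg
    | succ m ih =>
      push_cast
      linarith [(hf m).time_le]
  have hmono : Monotone fun m => (f m).time :=
    monotone_nat_of_le_succ fun m => by linarith [(hf m).time_le]
  have hagree : ∀ m m', m ≤ m' → ∀ τ ≤ (f m).time,
      (f m').pert τ = (f m).pert τ ∧ (f m').sol τ = (f m).sol τ := fun m m' h τ hτ => by
    induction m', h using Nat.le_induction with
    | base => exact ⟨rfl, rfl⟩
    | succ k hk ih =>
      have := (hf k).agree τ (hτ.trans (hmono hk))
      exact ⟨this.1.trans ih.1, this.2.trans ih.2⟩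
  set B : ℝ → EOp n := fun τ => (f ⌈τ⌉₊).pert τ with hB
  set Y : ℝ → EOp n := fun τ => (f ⌈τ⌉₊).sol τ with hY
  have hBY : ∀ m, ∀ τ ≤ (f m).time, B τ = (f m).pert τ ∧ Y τ = (f m).sol τ := fun m τ hτ => by
    rcases le_total ⌈τ⌉₊ m with h | h
    · have := hagree _ _ h τ ((Nat.le_ceil τ).trans (htime _))
      exact ⟨this.1.symm, this.2.symm⟩
    · exact hagree _ _ h τ hτ
  have hlt : ∀ τ : ℝ, ∃ m : ℕ, τ < (f m).time := fun τ => by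
    obtain ⟨m, hm⟩ := exists_nat_gt τ
    exact ⟨m, hm.trans_le (htime m)⟩
  refine ⟨B, Y, continuous_iff_continuousAt.2 fun τ => ?_, fun τ hτ => ?_, ⟨fun τ hτ => ?_,
    fun τ hτ => ?_⟩, fun x hxU hx => frequently_atTop.2 fun a => ?_⟩
  · obtain ⟨m, hm⟩ := hlt τ
    refine (f m).tail.cont.continuousAt.congr ?_
    filter_upwards [Iio_mem_nhds hm] with r hr using (hBY m r (le_of_lt hr)).1.symm
  · obtain ⟨m, hm⟩ := hlt τ
    rw [(hBY m τ hm.le).1]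
    exact (f m).tail.bound τ hτ
  · obtain ⟨m, hm⟩ := hlt τ
    have h := (f m).tail.fund.1 τ hτ
    beta_reduce at h
    rw [← (hBY m τ hm.le).1, ← (hBY m τ hm.le).2] at h
    refine h.congr_of_eventuallyEq ?_
    filter_upwards [Iio_mem_nhds hm] with r hr using (hBY m r (le_of_lt hr)).2
  · obtain ⟨m, hm⟩ := hlt τ
    rw [(hBY m τ hm.le).2]
    exact (f m).tail.fund.2 τ hτ
  · obtain ⟨m, hm⟩ := exists_nat_ge a
    rcases abs_inner_le_or_abs_inner_le (f m).norm_dir (f (m + 1)).norm_dir hx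
      (hf m).inner_dir with h | h
    · obtain ⟨τ, h1, h2, h3⟩ := (hf m).grow x hxU hx h
      refine ⟨τ, hm.trans ((htime m).trans h1), ?_⟩
      rwa [(hBY _ τ h3).2]
    · obtain ⟨τ, h1, h2, h3⟩ := (hf (m + 1)).grow x hxU hx h
      refine ⟨τ, hm.trans ((htime m).trans ((hmono m.le_succ).trans h1)), ?_⟩
      rwa [(hBY _ τ h3).2]

theorem exists_perturbation_of_not_isDecoupled (hX : IsFundamentalMatrix A X)
    (hC : ∀ t, 0 ≤ t → ‖A t‖ ≤ C) (hδ : 0 < δ)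
    (hgrow : ∀ x ∉ E, ∃ᶠ t in atTop, Real.exp (c * t) < ‖X t x‖)
    (hE : ¬ IsDecoupled X E) (hE0 : E ≠ ⊥) :
    ∃ B Y : ℝ → EOp n, Continuous B ∧ (∀ t, 0 ≤ t → ‖B t‖ ≤ δ) ∧
      IsFundamentalMatrix (fun t => A t + B t) Y ∧
      ∀ c' < c, Module.finrank ℝ (growthSubmodule Y c') < Module.finrank ℝ E := by
  obtain ⟨U, hfin, ⟨s₀⟩⟩ := exists_stage hX hδ.le hE0
  choose next hnext using fun s : Stage A X δ E U => s.exists_next hX hC hδ hgrow hE hfin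
  obtain ⟨B, Y, hB, hBδ, hY, hYgrow⟩ := exists_perturbation_of_chain (c := c)
    (fun m => next^[m] s₀) fun m => by
      rw [Function.iterate_succ_apply']
      exact hnext _
  refine ⟨B, Y, hB, hBδ, hY, fun c' hc' => ?_⟩
  by_contra! hcon
  obtain ⟨x, hxU, hxG, hx0⟩ := exists_ne_zero_mem_inf U (growthSubmodule Y c') (by omega)
  have h1 := hYgrow _ (U.smul_mem ‖x‖⁻¹ hxU) (norm_smul_inv_norm (𝕜 := ℝ) hx0)
  have h2 := mem_growthSubmodule_iff_eventually.1
    ((growthSubmodule Y c').smul_mem ‖x‖⁻¹ hxG) c hc'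
  obtain ⟨t, h3, h4⟩ := (h1.and_eventually h2).exists
  exact h3.not_gt h4

end Limit

section Decoupled

variable {n : ℕ} {A X : ℝ → EOp n} {C : ℝ} {E : Submodule ℝ (EVec n)}

theorem coupling_decay_of_integral_le (hX : IsFundamentalMatrix A X)
    (hC : ∀ t, 0 ≤ t → ‖A t‖ ≤ C) {u : EVec n} {ψ : EVec n →L[ℝ] ℝ} (hu : u ≠ 0) (hψ : ψ ≠ 0)
    {M s : ℝ} (hM : 1 ≤ M) (hs : 0 ≤ s)
    (h : ∀ t, s ≤ t → ∫ τ in s..t, (coupling X u ψ τ)⁻¹ ≤ M * (coupling X u ψ t)⁻¹)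
    {t : ℝ} (hst : s ≤ t) :
    coupling X u ψ t ≤ M * Real.exp (2 * C + M⁻¹) * Real.exp (-(M⁻¹ * (t - s))) *
      coupling X u ψ s := by
  have hC0 : 0 ≤ C := (norm_nonneg _).trans (hC 0 le_rfl)
  have hM0 : 0 < M := by linarith
  have hpos := fun τ => hX.coupling_pos hu hψ τ
  have hc : Continuous fun τ => (coupling X u ψ τ)⁻¹ :=
    hX.continuous_coupling.inv₀ fun τ => (hpos τ).ne'
  rcases le_total t (s + 1) with ht | ht
  · refine (hX.coupling_le hC hs hst).trans ?_
    refine mul_le_mul_of_nonneg_right ?_ (hpos s).le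
    rw [mul_assoc M, ← Real.exp_add]
    refine le_trans (Real.exp_le_exp.2 ?_) (le_mul_of_one_le_left (Real.exp_pos _).le hM)
    have h1 : M⁻¹ * (t - s) ≤ M⁻¹ * 1 := by gcongr; linarith
    have h2 : 2 * C * (t - s) ≤ 2 * C * 1 := by gcongr; linarith
    linarith
  · set G : ℝ → ℝ := fun t => ∫ τ in s..t, (coupling X u ψ τ)⁻¹ with hG
    have hG' : ∀ τ, HasDerivAt G (coupling X u ψ τ)⁻¹ τ := fun τ =>
      intervalIntegral.integral_hasDerivAt_right (hc.intervalIntegrable _ _)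
        hc.aestronglyMeasurable.stronglyMeasurableAtFilter hc.continuousAt
    have hF : ∀ τ, HasDerivAt (fun τ => G τ * Real.exp (-(M⁻¹ * τ)))
        (((coupling X u ψ τ)⁻¹ - M⁻¹ * G τ) * Real.exp (-(M⁻¹ * τ))) τ := fun τ => by
      have h1 : HasDerivAt (fun τ : ℝ => -(M⁻¹ * τ)) (-M⁻¹) τ := by
        simpa using (hasDerivAt_id τ).const_mul (-M⁻¹)
      refine ((hG' τ).mul h1.exp).congr_deriv ?_
      ring
    have hmono : MonotoneOn (fun τ => G τ * Real.exp (-(M⁻¹ * τ))) (Set.Ici s) := by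
      refine monotoneOn_of_deriv_nonneg (convex_Ici s)
        (fun τ _ => (hF τ).continuousAt.continuousWithinAt)
        (fun τ _ => (hF τ).differentiableAt.differentiableWithinAt) fun τ hτ => ?_
      rw [interior_Ici] at hτ
      rw [(hF τ).deriv]
      refine mul_nonneg (sub_nonneg.2 ?_) (Real.exp_pos _).le
      rw [inv_mul_le_iff₀ hM0]
      exact h τ (le_of_lt hτ)
    have h1 := hmono (Set.mem_Ici.2 (by linarith : s ≤ s + 1)) (Set.mem_Ici.2 hst) ht
    have h2 : (Real.exp (2 * C) * coupling X u ψ s)⁻¹ ≤ G (s + 1) :=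
      le_integral_inv_coupling hX hu hψ fun τ h3 h4 => by
        refine (hX.coupling_le hC hs h3).trans ?_
        refine mul_le_mul_of_nonneg_right (Real.exp_le_exp.2 ?_) (hpos s).le
        nlinarith
    have h3 : (Real.exp (2 * C) * coupling X u ψ s)⁻¹ * Real.exp (-(M⁻¹ * (s + 1))) ≤
        M * (coupling X u ψ t)⁻¹ * Real.exp (-(M⁻¹ * t)) :=
      (mul_le_mul_of_nonneg_right h2 (Real.exp_pos _).le).trans
        (h1.trans (mul_le_mul_of_nonneg_right (h t hst) (Real.exp_pos _).le))
    have hs' := hpos s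
    have ht' := hpos t
    calc coupling X u ψ t = (Real.exp (2 * C) * coupling X u ψ s)⁻¹ *
          Real.exp (-(M⁻¹ * (s + 1))) * (Real.exp (2 * C) * coupling X u ψ s * coupling X u ψ t *
            Real.exp (M⁻¹ * (s + 1))) := by
          rw [Real.exp_neg]
          field_simp
      _ ≤ M * (coupling X u ψ t)⁻¹ * Real.exp (-(M⁻¹ * t)) * (Real.exp (2 * C) *
            coupling X u ψ s * coupling X u ψ t * Real.exp (M⁻¹ * (s + 1))) := by gcongr
      _ = M * (Real.exp (2 * C) * (Real.exp (M⁻¹ * (s + 1)) * Real.exp (-(M⁻¹ * t)))) *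
            coupling X u ψ s := by
          field_simp
      _ = _ := by
          have e : Real.exp (2 * C) * (Real.exp (M⁻¹ * (s + 1)) * Real.exp (-(M⁻¹ * t))) =
              Real.exp (2 * C + M⁻¹) * Real.exp (-(M⁻¹ * (t - s))) := by
            rw [← Real.exp_add, ← Real.exp_add, ← Real.exp_add]
            ring_nf
          rw [e]
          ring

theorem IsDecoupled.exists_coupling_decay (hE : IsDecoupled X E) (hX : IsFundamentalMatrix A X)
    (hC : ∀ t, 0 ≤ t → ‖A t‖ ≤ C) :
    ∃ K a : ℝ, 0 < K ∧ 0 < a ∧ ∀ u ∈ E, u ≠ 0 → ∀ ψ : EVec n →L[ℝ] ℝ, ψ ≠ 0 →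
      (∀ e ∈ E, ψ e = 0) → ∀ s t, 0 ≤ s → s ≤ t →
        coupling X u ψ t ≤ K * Real.exp (-(a * (t - s))) * coupling X u ψ s := by
  have hC0 : 0 ≤ C := (norm_nonneg _).trans (hC 0 le_rfl)
  obtain ⟨M₀, S₀, h⟩ := hE
  set M := max M₀ 1 with hM
  set S := max S₀ 0 with hS
  have hM1 : 1 ≤ M := le_max_right _ _
  have hS0 : 0 ≤ S := le_max_right _ _
  have hMinv : 0 < M⁻¹ := inv_pos.2 (by linarith)
  set K₁ := M * Real.exp (2 * C + M⁻¹) with hK₁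
  have hK₁1 : 1 ≤ K₁ := one_le_mul_of_one_le_of_one_le hM1 (Real.one_le_exp (by positivity))
  refine ⟨K₁ * Real.exp (2 * C * S + M⁻¹ * S), M⁻¹, by positivity, hMinv,
    fun u huE hu ψ hψ hψE s t hs hst => ?_⟩
  have hpos := fun τ => hX.coupling_pos hu hψ τ
  have key : ∀ s t, S ≤ s → s ≤ t → coupling X u ψ t ≤
      K₁ * Real.exp (-(M⁻¹ * (t - s))) * coupling X u ψ s := fun s t h1 h2 =>
    coupling_decay_of_integral_le hX hC hu hψ hM1 (hS0.trans h1) (fun r hr =>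
      (h s r ((le_max_left _ _).trans h1) hr u huE hu ψ hψ hψE).trans
        (mul_le_mul_of_nonneg_right (le_max_left _ _) (inv_pos.2 (hpos r)).le)) h2
  rcases le_total S s with h1 | h1
  · refine (key s t h1 hst).trans (mul_le_mul_of_nonneg_right ?_ (hpos s).le)
    gcongr
    exact le_mul_of_one_le_right (by positivity) (Real.one_le_exp (by positivity))
  rcases le_total t S with h2 | h2
  · refine (hX.coupling_le hC hs hst).trans (mul_le_mul_of_nonneg_right ?_ (hpos s).le)
    rw [mul_assoc K₁, ← Real.exp_add]
    refine le_trans (Real.exp_le_exp.2 ?_) (le_mul_of_one_le_left (Real.exp_pos _).le hK₁1)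
    have h3 : M⁻¹ * (t - s) ≤ M⁻¹ * S := by gcongr; linarith
    have h4 : 2 * C * (t - s) ≤ 2 * C * S := by gcongr; linarith
    linarith
  · calc coupling X u ψ t ≤ K₁ * Real.exp (-(M⁻¹ * (t - S))) * coupling X u ψ S := key S t le_rfl h2
      _ ≤ K₁ * Real.exp (-(M⁻¹ * (t - S))) *
          (Real.exp (2 * C * (S - s)) * coupling X u ψ s) := by
          gcongr
          exact hX.coupling_le hC hs h1
      _ = K₁ * Real.exp (-(M⁻¹ * (t - S)) + 2 * C * (S - s)) * coupling X u ψ s := by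
          rw [Real.exp_add]
          ring
      _ ≤ K₁ * Real.exp ((2 * C * S + M⁻¹ * S) + -(M⁻¹ * (t - s))) * coupling X u ψ s := by
          have h3 : 0 ≤ 2 * C * s := by positivity
          have h4 : 0 ≤ M⁻¹ * s := by positivity
          exact mul_le_mul_of_nonneg_right (mul_le_mul_of_nonneg_left
            (Real.exp_le_exp.2 (by linarith)) (by positivity)) (hpos s).le
      _ = _ := by
          rw [Real.exp_add]
          ring

theorem exists_orthogonal_representative (X : ℝ → EOp n)
    (E : Submodule ℝ (EVec n)) (y : EVec n) (t : ℝ) :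
    ∃ p ∈ E, ∀ e ∈ E, inner ℝ (X t (y - p)) (X t e) = (0 : ℝ) := by
  set W := E.map (X t : EVec n →ₗ[ℝ] EVec n) with hW
  obtain ⟨p, hp, hpe⟩ := W.starProjection_apply_mem (X t y)
  refine ⟨p, hp, fun e he => ?_⟩
  have h := W.sub_starProjection_mem_orthogonal (X t y)
  rw [← hpe] at h
  rw [map_sub]
  exact Submodule.inner_left_of_mem_orthogonal (Submodule.mem_map_of_mem he) h

end Decoupled

section Separation

variable {n : ℕ} {A X : ℝ → EOp n} {C : ℝ} {E : Submodule ℝ (EVec n)}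

theorem norm_le_of_inner_eq_zero {y p u : EVec n} {F : EOp n} (hp : p ∈ E) (hu : u ∈ E)
    (h : ∀ e ∈ E, inner ℝ (F (y - p)) (F e) = (0 : ℝ)) : ‖F (y - p)‖ ≤ ‖F (y - u)‖ := by
  refine le_of_sq_le_sq ?_ (norm_nonneg _)
  have e : F (y - u) = F (y - p) + F (p - u) := by
    rw [← map_add, sub_add_sub_cancel]
  rw [e, norm_add_sq_real, h _ (E.sub_mem hp hu)]
  nlinarith [sq_nonneg ‖F (p - u)‖]

theorem IsFundamentalMatrix.norm_mul_le_of_coupling_decay (hX : IsFundamentalMatrix A X)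
    {K a : ℝ}
    (h : ∀ u ∈ E, u ≠ 0 → ∀ ψ : EVec n →L[ℝ] ℝ, ψ ≠ 0 → (∀ e ∈ E, ψ e = 0) →
      ∀ s t, 0 ≤ s → s ≤ t → coupling X u ψ t ≤ K * Real.exp (-(a * (t - s))) * coupling X u ψ s)
    {y : EVec n} (hy : y ∉ E) {p : ℝ → EVec n} (hpE : ∀ t, p t ∈ E)
    (hp : ∀ t, ∀ e ∈ E, inner ℝ (X t (y - p t)) (X t e) = (0 : ℝ)) {u : EVec n} (hu : u ∈ E)
    {s t : ℝ} (hs : 0 ≤ s) (hst : s ≤ t) :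
    ‖X t u‖ * ‖X s (y - p s)‖ ≤
      K * Real.exp (-(a * (t - s))) * (‖X s u‖ * ‖X t (y - p t)‖) := by
  rcases eq_or_ne u 0 with rfl | hu0
  · simp
  have hne : ∀ r, y - p r ≠ 0 := fun r h0 => hy (sub_eq_zero.1 h0 ▸ hpE r)
  have ht := hs.trans hst
  have hd := hX.norm_pos (hne s) hs
  set ψ : EVec n →L[ℝ] ℝ := innerSL ℝ (X s (y - p s)) ∘L X s with hψ
  have hψx : ∀ x, ψ x = inner ℝ (X s (y - p s)) (X s x) := fun x => by
    rw [hψ, ContinuousLinearMap.comp_apply, innerSL_apply_apply]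
  have hψE : ∀ e ∈ E, ψ e = 0 := fun e he => by rw [hψx, hp s e he]
  have hψq : ψ (y - p s) = ‖X s (y - p s)‖ ^ 2 := by rw [hψx, real_inner_self_eq_norm_sq]
  have hψ0 : ψ ≠ 0 := fun h0 => by
    rw [h0] at hψq
    exact (pow_pos hd 2).ne hψq
  have hψs : ‖ψ ∘L inverseMatrix X s‖ = ‖X s (y - p s)‖ := by
    have e : ψ ∘L inverseMatrix X s = innerSL ℝ (X s (y - p s)) := by
      ext1 x
      rw [ContinuousLinearMap.comp_apply, hψx, hX.apply_inverseMatrix hs, innerSL_apply_apply]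
    rw [e, innerSL_apply_norm]
  have h1 : ‖X s (y - p s)‖ ^ 2 ≤ ‖ψ ∘L inverseMatrix X t‖ * ‖X t (y - p t)‖ := by
    have e : ψ (y - p s) = ψ (y - p t) := by
      rw [map_sub, map_sub, hψE _ (hpE s), hψE _ (hpE t)]
    rw [← hψq, e, ← hX.comp_inverseMatrix_comp ψ ht]
    exact (Real.le_norm_self _).trans (ContinuousLinearMap.le_opNorm _ _)
  have h2 := h u hu hu0 ψ hψ0 hψE s t hs hst
  rw [coupling, coupling, max_eq_left hs, max_eq_left ht, hψs] at h2
  refine le_of_mul_le_mul_right ?_ hd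
  calc ‖X t u‖ * ‖X s (y - p s)‖ * ‖X s (y - p s)‖ = ‖X t u‖ * ‖X s (y - p s)‖ ^ 2 := by ring
    _ ≤ ‖X t u‖ * (‖ψ ∘L inverseMatrix X t‖ * ‖X t (y - p t)‖) := by gcongr
    _ = ‖X t u‖ * ‖ψ ∘L inverseMatrix X t‖ * ‖X t (y - p t)‖ := by ring
    _ ≤ K * Real.exp (-(a * (t - s))) * (‖X s u‖ * ‖X s (y - p s)‖) * ‖X t (y - p t)‖ := by
        gcongr
    _ = _ := by ring

theorem exists_pos_mul_exp_le_half {K a : ℝ} (hK : 0 < K) (ha : 0 < a) :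
    ∃ T > 0, K * Real.exp (-(a * T)) ≤ 1 / 2 := by
  obtain ⟨T, hT, h⟩ := exists_le_mul_exp ha (inv_pos.2 hK) 2
  refine ⟨T, hT, ?_⟩
  rw [Real.exp_neg, ← div_eq_mul_inv, div_le_iff₀ (Real.exp_pos _)]
  rw [← div_eq_inv_mul, le_div_iff₀ hK] at h
  linarith

theorem IsFundamentalMatrix.exists_norm_le_mul_dist (hX : IsFundamentalMatrix A X)
    (hC : ∀ t, 0 ≤ t → ‖A t‖ ≤ C) {K a : ℝ} (hK : 0 < K) (ha : 0 < a)
    (h : ∀ u ∈ E, u ≠ 0 → ∀ ψ : EVec n →L[ℝ] ℝ, ψ ≠ 0 → (∀ e ∈ E, ψ e = 0) →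
      ∀ s t, 0 ≤ s → s ≤ t → coupling X u ψ t ≤ K * Real.exp (-(a * (t - s))) * coupling X u ψ s)
    {y : EVec n} (hy : y ∉ E) {p : ℝ → EVec n} (hpE : ∀ t, p t ∈ E)
    (hp : ∀ t, ∀ e ∈ E, inner ℝ (X t (y - p t)) (X t e) = (0 : ℝ)) :
    ∃ R > 0, ∀ s, 0 ≤ s → ‖X s y‖ ≤ R * ‖X s (y - p s)‖ := by
  have hC0 : 0 ≤ C := (norm_nonneg _).trans (hC 0 le_rfl)
  have hne : ∀ r, y - p r ≠ 0 := fun r h0 => hy (sub_eq_zero.1 h0 ▸ hpE r)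
  have hdpos : ∀ s, 0 ≤ s → 0 < ‖X s (y - p s)‖ := fun s hs => hX.norm_pos (hne s) hs
  obtain ⟨T, hT, hKT⟩ := exists_pos_mul_exp_le_half hK ha
  have hdist : ∀ s t, 0 ≤ s → s ≤ t → t ≤ s + T →
      ‖X s (y - p s)‖ ≤ Real.exp (C * T) * ‖X t (y - p t)‖ := fun s t hs hst ht => by
    refine (norm_le_of_inner_eq_zero (hpE s) (hpE t) (hp s)).trans
      ((hX.norm_apply_ge hC _ hs hst).trans ?_)
    gcongr
    linarith
  set R := max (‖X 0 y‖ / ‖X 0 (y - p 0)‖) (1 + 2 * Real.exp (2 * C * T)) with hR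
  have hR1 : 1 + 2 * Real.exp (2 * C * T) ≤ R := le_max_right _ _
  have hR0 : 0 < R := lt_of_lt_of_le (by positivity) hR1
  have hexp : Real.exp (C * T) * Real.exp (C * T) = Real.exp (2 * C * T) := by
    rw [← Real.exp_add]
    ring_nf
  have key : ∀ m : ℕ, ‖X (m * T) y‖ ≤ R * ‖X (m * T) (y - p (m * T))‖ := fun m => by
    induction m with
    | zero =>
      rw [Nat.cast_zero, zero_mul, ← div_le_iff₀ (hdpos 0 le_rfl)]
      exact le_max_left _ _
    | succ m ih =>
      set s : ℝ := m * T with hs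
      have hs0 : 0 ≤ s := by positivity
      have e : ((m + 1 : ℕ) : ℝ) * T = s + T := by
        push_cast
        ring
      rw [e]
      set d := ‖X s (y - p s)‖ with hd
      set d' := ‖X (s + T) (y - p (s + T))‖ with hd'
      have hdp : 0 < d := hdpos s hs0
      have h1 : ‖X (s + T) (p s)‖ * d ≤ 1 / 2 * (‖X s (p s)‖ * d') := by
        have := hX.norm_mul_le_of_coupling_decay h hy hpE hp (hpE s) hs0
          (by linarith : s ≤ s + T)
        rw [add_sub_cancel_left] at this
        exact this.trans (mul_le_mul_of_nonneg_right hKT (by positivity))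
      have h2 : ‖X s (p s)‖ ≤ (R + 1) * d := by
        have e2 : X s (p s) = X s y - X s (y - p s) := by rw [← map_sub, sub_sub_cancel]
        rw [e2]
        refine (norm_sub_le _ _).trans ?_
        linarith
      have h3 : ‖X (s + T) (p s)‖ ≤ 1 / 2 * ((R + 1) * d') := by
        refine le_of_mul_le_mul_right (h1.trans ?_) hdp
        calc 1 / 2 * (‖X s (p s)‖ * d') ≤ 1 / 2 * ((R + 1) * d * d') := by gcongr
          _ = _ := by ring
      have h4 : ‖X (s + T) (y - p s)‖ ≤ Real.exp (2 * C * T) * d' := by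
        have h5 := hX.norm_apply_le hC (y - p s) hs0 (by linarith : s ≤ s + T)
        rw [add_sub_cancel_left] at h5
        rw [← hexp, mul_assoc]
        exact h5.trans (mul_le_mul_of_nonneg_left (hdist s (s + T) hs0 (by linarith) le_rfl)
          (Real.exp_pos _).le)
      have e3 : X (s + T) y = X (s + T) (p s) + X (s + T) (y - p s) := by
        rw [← map_add, add_sub_cancel]
      have hd'0 : 0 ≤ d' := norm_nonneg _
      rw [e3]
      refine (norm_add_le _ _).trans ?_
      nlinarith
  refine ⟨Real.exp (2 * C * T) * R, by positivity, fun s hs => ?_⟩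
  obtain ⟨m, hm, hm'⟩ : ∃ m : ℕ, m * T ≤ s ∧ s ≤ m * T + T := by
    refine ⟨⌊s / T⌋₊, ?_, ?_⟩
    · rw [← le_div_iff₀ hT]
      exact Nat.floor_le (by positivity)
    · have := (Nat.lt_floor_add_one (s / T)).le
      rw [div_le_iff₀ hT] at this
      linarith
  have hm0 : (0 : ℝ) ≤ m * T := by positivity
  calc ‖X s y‖ ≤ Real.exp (C * (s - m * T)) * ‖X (m * T) y‖ := hX.norm_apply_le hC y hm0 hm
    _ ≤ Real.exp (C * T) * (R * (Real.exp (C * T) * ‖X s (y - p s)‖)) := by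
        gcongr
        · linarith
        · refine (key m).trans ?_
          gcongr
          exact hdist _ s hm0 hm hm'
    _ = _ := by
        rw [← hexp]
        ring

theorem IsDecoupled.exists_separation (hE : IsDecoupled X E) (hX : IsFundamentalMatrix A X)
    (hC : ∀ t, 0 ≤ t → ‖A t‖ ≤ C) {y : EVec n} (hy : y ∉ E) :
    ∃ a > 0, ∃ K > 0, ∀ u ∈ E, ∀ s t, 0 ≤ s → s ≤ t →
      ‖X t u‖ * ‖X s y‖ ≤ K * Real.exp (-(a * (t - s))) * (‖X s u‖ * ‖X t y‖) := by
  obtain ⟨K, a, hK, ha, h⟩ := hE.exists_coupling_decay hX hC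
  choose p hpE hp using exists_orthogonal_representative X E y
  obtain ⟨R, hR, hRs⟩ := hX.exists_norm_le_mul_dist hC hK ha h hy hpE hp
  refine ⟨a, ha, R * K, by positivity, fun u hu s t hs hst => ?_⟩
  calc ‖X t u‖ * ‖X s y‖ ≤ ‖X t u‖ * (R * ‖X s (y - p s)‖) := by
        gcongr
        exact hRs s hs
    _ = R * (‖X t u‖ * ‖X s (y - p s)‖) := by ring
    _ ≤ R * (K * Real.exp (-(a * (t - s))) * (‖X s u‖ * ‖X t (y - p t)‖)) :=
        mul_le_mul_of_nonneg_left (hX.norm_mul_le_of_coupling_decay h hy hpE hp hu hs hst) hR.le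
    _ ≤ R * (K * Real.exp (-(a * (t - s))) * (‖X s u‖ * ‖X t y‖)) := by
        gcongr
        simpa using norm_le_of_inner_eq_zero (hpE t) E.zero_mem (hp t)
    _ = _ := by ring

end Separation

section Necessity

variable {n : ℕ} {A Φ : ℝ → EOp n} {C : ℝ} {lam : Fin n → ℝ}

/-- The Lyapunov exponents of `x' = A(t) x` are stable under small bounded perturbations. -/
def StableExponents (A : ℝ → EOp n) (lam : Fin n → ℝ) : Prop :=
  ∀ η > (0 : ℝ), ∃ δ > (0 : ℝ), ∀ B : ℝ → EOp n, Continuous B → (∀ t, 0 ≤ t → ‖B t‖ ≤ δ) →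
    ∀ μ : Fin n → ℝ, HasLyapunovExponents (fun t => A t + B t) μ → ∀ j, |μ j - lam j| ≤ η

theorem HasLyapunovExponents.exists_increasing_fundamentalMatrix
    (hlam : HasLyapunovExponents A lam) :
    ∃ Φ, IsFundamentalMatrix A Φ ∧ ∀ k, chiExp Φ k = lam (Fin.rev k) := by
  obtain ⟨-, Ψ, hΨ, σ, hσ⟩ := hlam
  let U := LinearIsometryEquiv.piLpCongrLeft 2 ℝ ℝ (Fin.revPerm.trans σ)
  have hM : (U.toContinuousLinearEquiv : EOp n) ∘L
      (U.symm.toContinuousLinearEquiv : EOp n) = 1 := by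
    ext1 x
    exact U.apply_symm_apply x
  have hN : (U.symm.toContinuousLinearEquiv : EOp n) ∘L
      (U.toContinuousLinearEquiv : EOp n) = 1 := by
    ext1 x
    exact U.symm_apply_apply x
  refine ⟨_, hΨ.1.comp_const hM hN, fun k => ?_⟩
  have hU : (U.toContinuousLinearEquiv : EOp n) (EuclideanSpace.single k 1) =
      EuclideanSpace.single (σ (Fin.rev k)) 1 :=
    EuclideanSpace.piLpCongrLeft_single _ _ _
  rw [hσ, chiExp, chiExp]
  simp only [ContinuousLinearMap.comp_apply, hU]

theorem frequently_exp_lt_of_notMem_growthSubmodule {c : ℝ} {x : EVec n}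
    (hx : x ∉ growthSubmodule Φ c) : ∃ᶠ t in atTop, Real.exp (c * t) < ‖Φ t x‖ := by
  rw [mem_growthSubmodule_iff_eventually] at hx
  push Not at hx
  obtain ⟨c', hc, h⟩ := hx
  refine (h.and_eventually (eventually_gt_atTop 0)).mono fun t ht => ?_
  exact (Real.exp_lt_exp.2 (mul_lt_mul_of_pos_right hc ht.2)).trans_le ht.1

theorem StableExponents.isDecoupled (hst : StableExponents A lam)
    (hC : ∀ t, 0 ≤ t → ‖A t‖ ≤ C)
    (hΦ : IsFundamentalMatrix A Φ) {i : Fin n} {c : ℝ} (hi : lam (Fin.rev i) < c)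
    (hc : Module.finrank ℝ (growthSubmodule Φ c) = i + 1) :
    IsDecoupled Φ (growthSubmodule Φ c) := by
  by_contra hE
  obtain ⟨d, hd, hd'⟩ := exists_between hi
  obtain ⟨δ, hδ, h⟩ := hst (d - lam (Fin.rev i)) (sub_pos.2 hd)
  have hE0 : growthSubmodule Φ c ≠ ⊥ := fun h0 => by
    rw [h0, finrank_bot] at hc
    omega
  obtain ⟨B, Y, hB, hBδ, hY, hdim⟩ := exists_perturbation_of_not_isDecoupled hΦ hC hδ
    (fun x hx => frequently_exp_lt_of_notMem_growthSubmodule hx) hE hE0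
  have hC' : ∀ t, 0 ≤ t → ‖A t + B t‖ ≤ C + δ := fun t ht =>
    (norm_add_le _ _).trans (add_le_add (hC t ht) (hBδ t ht))
  obtain ⟨μ, hμ⟩ := hY.exists_hasLyapunovExponents hC'
  have h1 := hdim d hd'
  rw [hμ.finrank_growthSubmodule hC' hY, hc] at h1
  have h2 := antitone_gt_of_card_le hμ.1 i (Nat.lt_succ_iff.1 h1)
  have h3 := (abs_le.1 (h B hB hBδ μ hμ (Fin.rev i))).2
  linarith

theorem StrictAnti.card_filter_le_eq (hlam : StrictAnti lam) {i : Fin n} (hi : (i : ℕ) + 1 < n)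
    {c : ℝ} (h1 : lam (Fin.rev i) ≤ c) (h2 : c < lam (Fin.rev ⟨i + 1, hi⟩)) :
    (Finset.univ.filter fun j => lam j ≤ c).card = i + 1 := by
  have : (Finset.univ.filter fun j => lam j ≤ c) = Finset.Ici (Fin.rev i) := by
    ext j
    simp only [Finset.mem_filter, Finset.mem_univ, true_and, Finset.mem_Ici]
    refine ⟨fun hj => ?_, fun hj => (hlam.antitone hj).trans h1⟩
    have := hlam.lt_iff_gt.1 (hj.trans_lt h2)
    rw [Fin.lt_def, Fin.val_rev] at this
    rw [Fin.le_def, Fin.val_rev]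
    simp only at this
    omega
  rw [this, Fin.card_Ici, Fin.val_rev]
  omega

theorem StableExponents.exists_ratio_bound (hst : StableExponents A lam)
    (hC : ∀ t, 0 ≤ t → ‖A t‖ ≤ C) (hlam : HasLyapunovExponents A lam)
    (hanti : StrictAnti lam) (hΦ : IsFundamentalMatrix A Φ)
    (hχ : ∀ k, chiExp Φ k = lam (Fin.rev k)) (i : Fin n) :
    ∃ a > 0, ∃ D > 0, ∀ hi : (i : ℕ) + 1 < n, ∀ s t : ℝ, 0 ≤ s → s ≤ t →
      D * Real.exp (a * (t - s)) ≤
        (‖Φ t (EuclideanSpace.single (⟨(i : ℕ) + 1, hi⟩ : Fin n) 1)‖ /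
          ‖Φ s (EuclideanSpace.single (⟨(i : ℕ) + 1, hi⟩ : Fin n) 1)‖) *
        (‖Φ s (EuclideanSpace.single i 1)‖ / ‖Φ t (EuclideanSpace.single i 1)‖) := by
  by_cases hi : (i : ℕ) + 1 < n
  swap
  · exact ⟨1, one_pos, 1, one_pos, fun h => absurd h hi⟩
  have hlt : lam (Fin.rev i) < lam (Fin.rev ⟨i + 1, hi⟩) :=
    hanti (Fin.rev_lt_rev.2 (Fin.lt_def.2 (Nat.lt_succ_self _)))
  obtain ⟨c, hc, hc'⟩ := exists_between hlt
  have hdec := hst.isDecoupled hC hΦ hc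
    ((hlam.finrank_growthSubmodule hC hΦ c).trans (hanti.card_filter_le_eq hi hc.le hc'))
  have hmem : ∀ k : Fin n, EuclideanSpace.single k 1 ∈ growthSubmodule Φ c ↔
      lam (Fin.rev k) ≤ c := fun k => by
    rw [hΦ.mem_growthSubmodule_iff hC (by simp), ← hχ]
    rfl
  obtain ⟨a, ha, K, hK, h⟩ := hdec.exists_separation hΦ hC
    (mt (hmem ⟨i + 1, hi⟩).1 (not_le.2 hc'))
  refine ⟨a, ha, K⁻¹, inv_pos.2 hK, fun _ s t hs hts => ?_⟩
  have h1 := h _ ((hmem i).2 hc.le) s t hs hts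
  have ht := hs.trans hts
  have p1 := hΦ.norm_column_pos i ht
  have p2 := hΦ.norm_column_pos ⟨i + 1, hi⟩ hs
  rw [div_mul_div_comm, le_div_iff₀ (mul_pos p2 p1)]
  calc _ = K⁻¹ * Real.exp (a * (t - s)) * (‖Φ t (EuclideanSpace.single i 1)‖ *
          ‖Φ s (EuclideanSpace.single ⟨i + 1, hi⟩ 1)‖) := by ring
    _ ≤ K⁻¹ * Real.exp (a * (t - s)) * _ := mul_le_mul_of_nonneg_left h1 (by positivity)
    _ = _ := by
        rw [Real.exp_neg]
        field_simp

theorem exists_pos_forall_le_of_fintype {ι : Type*} [Finite ι] {f : ι → ℝ} (hf : ∀ i, 0 < f i) :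
    ∃ r > 0, ∀ i, r ≤ f i := by
  obtain h | h := isEmpty_or_nonempty ι
  · exact ⟨1, one_pos, fun i => h.elim i⟩
  · obtain ⟨i, hi⟩ := Finite.exists_min f
    exact ⟨f i, hf i, hi⟩

theorem StableExponents.exists_integrallySeparated (hst : StableExponents A lam)
    (hC : ∀ t, 0 ≤ t → ‖A t‖ ≤ C) (hlam : HasLyapunovExponents A lam)
    (hanti : StrictAnti lam) :
    ∃ Φ, IsFundamentalMatrix A Φ ∧ ∃ a > 0, ∃ D > 0, IntegrallySeparated Φ a D := by
  obtain ⟨Φ, hΦ, hχ⟩ := hlam.exists_increasing_fundamentalMatrix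
  choose a ha D hD h using hst.exists_ratio_bound hC hlam hanti hΦ hχ
  obtain ⟨a₀, ha₀, hle⟩ := exists_pos_forall_le_of_fintype ha
  obtain ⟨D₀, hD₀, hle'⟩ := exists_pos_forall_le_of_fintype hD
  refine ⟨Φ, hΦ, a₀, ha₀, D₀, hD₀, fun i hi s t hs hts => le_trans ?_ (h i hi s t hs hts)⟩
  have := sub_nonneg.2 hts
  exact mul_le_mul (hle' i) (Real.exp_le_exp.2 (mul_le_mul_of_nonneg_right (hle i) this))
    (Real.exp_pos _).le (hD i).le

end Necessity

/-- Theorem 3.1; Bylov–Izobov. For `x' = A(t) x` with `A` continuous and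
bounded and with `n` distinct (upper) Lyapunov exponents `λ₁ > … > λₙ`, the Lyapunov
exponents are stable under small bounded perturbations if and only if there exists a
fundamental matrix whose columns are integrally separated. -/
theorem lyapunov_exponents_stable_iff_integrally_separated
    {n : ℕ}
    (A : ℝ → EuclideanSpace ℝ (Fin n) →L[ℝ] EuclideanSpace ℝ (Fin n))
    (hA : Continuous A) (C : ℝ) (hAbdd : ∀ t : ℝ, 0 ≤ t → ‖A t‖ ≤ C)
    (lam : Fin n → ℝ) (hlam : HasLyapunovExponents A lam)
    (hdistinct : StrictAnti lam) :
    (∀ η > (0 : ℝ), ∃ δ > (0 : ℝ),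
      ∀ B : ℝ → EuclideanSpace ℝ (Fin n) →L[ℝ] EuclideanSpace ℝ (Fin n),
        Continuous B → (∀ t : ℝ, 0 ≤ t → ‖B t‖ ≤ δ) →
        ∀ μ : Fin n → ℝ, HasLyapunovExponents (fun t => A t + B t) μ →
          ∀ j : Fin n, |μ j - lam j| ≤ η) ↔
    (∃ Φ : ℝ → EuclideanSpace ℝ (Fin n) →L[ℝ] EuclideanSpace ℝ (Fin n),
      IsFundamentalMatrix A Φ ∧ ∃ a > (0 : ℝ), ∃ D > (0 : ℝ),
        ∀ i : Fin n, ∀ hi : (i : ℕ) + 1 < n, ∀ s t : ℝ, 0 ≤ s → s ≤ t →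
          D * Real.exp (a * (t - s)) ≤
            (‖Φ t (EuclideanSpace.single (⟨(i : ℕ) + 1, hi⟩ : Fin n) 1)‖ /
              ‖Φ s (EuclideanSpace.single (⟨(i : ℕ) + 1, hi⟩ : Fin n) 1)‖) *
            (‖Φ s (EuclideanSpace.single i 1)‖ / ‖Φ t (EuclideanSpace.single i 1)‖)) := by
  constructor
  · intro hst
    exact StableExponents.exists_integrallySeparated hst hAbdd hlam hdistinct
  · rintro ⟨Φ, hΦ, a, ha, D, hD, h⟩ η hη
    exact IntegrallySeparated.stable h hΦ hAbdd ha hD hlam hη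
end
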